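/- arXiv:2104.10198 — 2 statements merged into one kernel-verified Lean document; each statement's English description precedes it below -/
import Mathlib

section
/- Let k be an algebraically closed field whose characteristic does not divide d(d−1), with d ≥ 3, V a finite-dimensional k-vector space, and f a nonzero homogeneous polynomial of degree d on V. If s ≤ 2^{2−d}·rk^S(f) + 1/2 (respectively s ≤ 2^{2−d}·rk^S(f) − 1/2), then there is a nonempty Zariski open subset of V^s such that for every (v_1,…,v_s) in it, the directional derivatives (∂_{v_1}f,…,∂_{v_s}f) define a complete intersection (respectively a normal complete intersection) of codimension s in V. -/
open MvPolynomial

/-- Krull dimension of the closed subscheme of affine space cut out by an ideal of the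
polynomial ring. -/
noncomputable def affineDim {σ : Type} [Fintype σ] (k : Type) [Field k]
    (I : Ideal (MvPolynomial σ k)) : WithBot ℕ∞ :=
  ringKrullDim (MvPolynomial σ k ⧸ I)

/-- Codimension (inside the affine space of dimension `card σ`) of the closed subscheme of
affine space cut out by an ideal; the empty scheme has codimension `⊤`. -/
noncomputable def affineCodim {σ : Type} [Fintype σ] (k : Type) [Field k]
    (I : Ideal (MvPolynomial σ k)) : ℕ∞ :=
  WithBot.recBotCoe ⊤ (fun dm => (Fintype.card σ : ℕ∞) - dm) (affineDim k I)

/-- The Schmidt rank (strength) of a polynomial: the smallest `r` such that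
`f = ∑ i : Fin r, g i * h i` with all `g i`, `h i` homogeneous of positive degree. -/
noncomputable def polySchmidtRank {k : Type} [Field k] {σ : Type} (f : MvPolynomial σ k) : ℕ :=
  sInf {r | ∃ g h : Fin r → MvPolynomial σ k,
    (∀ i, ∃ a, 0 < a ∧ (g i).IsHomogeneous a) ∧
    (∀ i, ∃ b, 0 < b ∧ (h i).IsHomogeneous b) ∧
    f = ∑ i, g i * h i}

/-- The closed subscheme of affine space cut out by an ideal `I` is a normal scheme: all of
its local rings (the localizations of its coordinate ring at primes) are integrally closed
domains. -/
def IsNormalZeroLocus {k : Type} [Field k] {n : ℕ}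
    (I : Ideal (MvPolynomial (Fin n) k)) : Prop :=
  ∀ q : PrimeSpectrum (MvPolynomial (Fin n) k ⧸ I),
    IsDomain (Localization.AtPrime q.asIdeal) ∧
      IsIntegrallyClosed (Localization.AtPrime q.asIdeal)

theorem exists_kernel_projection {κ m n : Type*} [Field κ] [Fintype m] [Fintype n]
    [DecidableEq m] [DecidableEq n] (H : Matrix m n κ) :
    ∃ (J : Finset n) (E : Matrix n n κ) (X : Matrix n m κ), H * E = 0 ∧ 1 - E = X * H ∧
      (∀ i j, j ∉ J → E i j = 0) ∧ ∀ i ∈ J, ∀ j, E i j = if i = j then 1 else 0 := by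
  classical
  obtain ⟨I, hspan, hli⟩ :
      ∃ I : Set n, Set.range H.col ⊆ Submodule.span κ (H.col '' I) ∧ LinearIndepOn κ H.col I := by
    obtain ⟨I, -, -, h2, h3⟩ := exists_linearIndepOn_extension (K := κ) (v := H.col)
      (linearIndepOn_empty κ H.col) (Set.empty_subset Set.univ)
    exact ⟨I, by simpa using h2, h3⟩
  have hli' : LinearIndependent κ (fun i : I => H.col i) := hli
  have hker : LinearMap.ker (Fintype.linearCombination κ (fun i : I => H.col i)) = ⊥ := by
    refine LinearMap.ker_eq_bot'.2 fun c hc => funext ?_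
    exact Fintype.linearIndependent_iff.1 hli' c
        (by simpa [Fintype.linearCombination_apply] using hc)
  obtain ⟨g, hg⟩ := LinearMap.exists_leftInverse_of_injective
    (Fintype.linearCombination κ (fun i : I => H.col i))
    hker
  let ext : (I → κ) →ₗ[κ] (n → κ) :=
    (LinearMap.pi fun i => if h : i ∈ I then LinearMap.proj ⟨i, h⟩ else 0)
  have hext : ∀ c i, i ∉ I → ext c i = 0 := fun c i hi => by
    simp [ext, hi]
  let X : Matrix n m κ := LinearMap.toMatrix' (ext ∘ₗ g)
  have hX : ∀ i ∈ I, Matrix.mulVec X (H.col i) = Pi.single i 1 := by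
    intro i hi
    have h1 : g (H.col i) = Pi.single ⟨i, hi⟩ 1 := by
      have := LinearMap.congr_fun hg (Pi.single ⟨i, hi⟩ 1)
      simpa using this
    simp only [X, LinearMap.toMatrix'_mulVec, LinearMap.comp_apply, h1]
    ext j
    by_cases hj : j ∈ I
    · simp [ext, hj, Pi.single_apply, Subtype.ext_iff]
    · have : j ≠ i := fun h => hj (h ▸ hi)
      simp [hext _ _ hj, this]
  have hHX : ∀ y ∈ Submodule.span κ (H.col '' I), H.mulVec (X.mulVec y) = y := by
    intro y hy
    induction hy using Submodule.span_induction with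
    | mem y hy => obtain ⟨i, hi, rfl⟩ := hy; rw [hX i hi]; simp
    | zero => simp
    | add a b _ _ ha hb => simp [Matrix.mulVec_add, ha, hb]
    | smul c a _ ha => simp [Matrix.mulVec_smul, ha]
  have hcol : ∀ j, (X * H).col j = X.mulVec (H.col j) := fun j => by
    ext i; simp [Matrix.mul_apply, Matrix.mulVec, dotProduct, Matrix.col]
  refine ⟨Finset.univ.filter (· ∉ I), 1 - X * H, X, ?_, by simp, ?_, ?_⟩
  · rw [Matrix.mul_sub, Matrix.mul_one, ← Matrix.mul_assoc, sub_eq_zero]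
    ext i j
    have := congrFun (hHX _ (hspan ⟨j, rfl⟩)) i
    rw [Matrix.mulVec_mulVec] at this
    simpa [Matrix.mulVec, dotProduct, Matrix.col, Matrix.mul_apply] using this.symm
  · intro i j hj
    have hj : j ∈ I := by simpa using hj
    have := congrFun ((hcol j).trans (hX j hj)) i
    simp only [Matrix.col_apply] at this
    simp [this, Matrix.one_apply, Pi.single_apply]
  · intro i hi j
    have hi : i ∉ I := by simpa using hi
    have : (X * H) i j = 0 := by
      have := congrFun (hcol j) i
      simp only [Matrix.col_apply] at this
      rw [this]
      simp only [X, LinearMap.toMatrix'_mulVec, LinearMap.comp_apply, hext _ _ hi]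
    simp [this, Matrix.one_apply]

theorem exists_vecMul_eq_zero_of_minors {K : Type*} [Field K] {s n : ℕ}
    (M : Matrix (Fin s) (Fin n) K)
    (h : ∀ e : Fin s → Fin n, (M.submatrix id e).det = 0) :
    ∃ c : Fin s → K, c ≠ 0 ∧ Matrix.vecMul c M = 0 := by
  classical
  by_contra! hc
  have hli : LinearIndependent K M.row := by
    rw [Fintype.linearIndependent_iff]
    intro g hg
    by_contra hne
    refine hc g (fun h0 => hne (by simp [h0])) ?_
    rw [Matrix.vecMul_eq_sum]
    exact hg
  have hr : M.rank = s := by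
    simpa using hli.rank_matrix
  have hspan : Submodule.span K (Set.range M.col) = ⊤ := by
    apply Submodule.eq_top_of_finrank_eq
    rw [← Matrix.rank_eq_finrank_span_cols, hr]; simp
  obtain ⟨I, -, -, h2, h3⟩ := exists_linearIndepOn_extension (K := K) (v := M.col)
      (linearIndepOn_empty K M.col) (Set.empty_subset Set.univ)
  have h3' : LinearIndependent K (fun i : I => M.col i) := h3
  have htop : ⊤ ≤ Submodule.span K (Set.range (fun i : I => M.col i)) := by
    have : Set.range (fun i : I => M.col i) = M.col '' I := by
      ext; simp
    rw [this, ← hspan, Submodule.span_le]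
    simpa using h2
  let b := Module.Basis.mk h3' htop
  have hcard : Fintype.card I = s := by
    simpa using (Module.finrank_eq_card_basis b).symm
  let e := (Fintype.equivFinOfCardEq hcard).symm
  have hdet := h (fun i => (e i : Fin n))
  rw [← Matrix.det_transpose] at hdet
  obtain ⟨w, hw, hw0⟩ := Matrix.exists_vecMul_eq_zero_iff.2 hdet
  have := Fintype.linearIndependent_iff.1 (h3'.comp e e.injective) w (by
    rw [Matrix.vecMul_eq_sum] at hw0
    exact hw0)
  exact hw (funext this)

theorem exists_isTranscendenceBasis_isSeparable_of_adjoin_range {k K ι : Type} [Field k]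
    [PerfectField k] [Field K] [Algebra k K] [Finite ι] (x : ι → K)
    (hx : IntermediateField.adjoin k (Set.range x) = ⊤) :
    ∃ S : Set ι, IsTranscendenceBasis k (fun i : S => x i) ∧
      Algebra.IsSeparable (IntermediateField.adjoin k (x '' S)) K := by
  have hex : ∃ S : Set ι, IsTranscendenceBasis k (fun i : S => x i) := by
    have : Algebra.IsAlgebraic (Algebra.adjoin k (Set.range x)) K := by
      rw [← IntermediateField.isAlgebraic_adjoin_iff_top, hx, Algebra.isAlgebraic_iff_isIntegral]
      exact Algebra.isIntegral_of_surjective IntermediateField.topEquiv.surjective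
    obtain ⟨t, hts, ht⟩ := exists_isTranscendenceBasis_subset (R := k) (Set.range x)
    choose g hg using fun i : t => hts i.2
    have hginj : Function.Injective g := fun a b h => Subtype.ext (by rw [← hg, ← hg, h])
    refine ⟨Set.range g, ?_⟩
    have := ht.comp_equiv (Equiv.ofInjective g hginj).symm
    convert! this using 1
    ext ⟨i, a, rfl⟩
    simp [hg, Equiv.ofInjective_symm_apply]
  obtain _ | ⟨p, hp, hpk⟩ := CharP.exists' k
  · obtain ⟨S, hS⟩ := hex
    refine ⟨S, hS, ?_⟩
    have h2 : x '' S = Set.range (fun i : S => x i) := by ext; simp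
    have := hS.isAlgebraic_field
    rw [← h2] at this
    infer_instance
  have : ExpChar k p := .prime hp.out
  have : CharP K p := .of_ringHom_of_ne_zero (algebraMap k K) p hp.out.ne_zero
  have H : ∀ s : Finset K, LinearIndepOn k id (s : Set K) →
      LinearIndepOn k (· ^ p) (s : Set K) := fun s hs => by
    refine hs.map_of_injective_injective (frobeniusEquiv k p).symm (frobenius K p).toAddMonoidHom
      (by simp) (by simp) fun r m => ?_
    change ((frobeniusEquiv k p).symm r • m) ^ p = r • m ^ p
    rw [smul_pow, ← frobenius_def, frobenius_apply_frobeniusEquiv_symm]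
  obtain ⟨S, hS, hmax⟩ := Set.Finite.exists_maximalFor
    (fun S : Set ι => (separableClosure (IntermediateField.adjoin k (x '' S)) K).restrictScalars k)
    {S | IsTranscendenceBasis k (fun i : S => x i)} (Set.toFinite _) hex
  refine ⟨S, hS, ?_⟩
  rw [← separableClosure.eq_top_iff, ← (IntermediateField.restrictScalars_injective k).eq_iff,
    IntermediateField.restrictScalars_top, eq_top_iff, ← hx, IntermediateField.adjoin_le_iff]
  rintro _ ⟨n, rfl⟩
  by_contra hn
  have hns : n ∉ S := fun h ↦ hn (le_restrictScalars_separableClosure _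
    (IntermediateField.subset_adjoin _ _ ⟨n, h, rfl⟩))
  have ⟨i, hi₁, hi₂⟩ := exists_isTranscendenceBasis_and_isSeparable_of_linearIndepOn_pow'
    p hp.out (a := x) H S n hS hns
  refine not_lt_iff_le_imp_ge.mpr (hmax hi₁) (SetLike.lt_iff_le_and_exists.mpr ⟨?_, x n, ?_, hn⟩)
  · beta_reduce
    rw [separableClosure_le_separableClosure_iff, IntermediateField.adjoin_le_iff]
    rintro _ ⟨j, hj, rfl⟩
    obtain rfl | ne := eq_or_ne j i
    exacts [hi₂, le_restrictScalars_separableClosure _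
      (IntermediateField.subset_adjoin _ _ ⟨j, ⟨.inr hj, ne⟩, rfl⟩)]
  · obtain rfl | ne := eq_or_ne n i
    exacts [hi₂, le_restrictScalars_separableClosure _
      (IntermediateField.subset_adjoin _ _ ⟨n, ⟨.inl rfl, ne⟩, rfl⟩)]

theorem exists_algHom_lift_of_isSeparable {k K C ι : Type} [Field k] [Field K] [Algebra k K]
    [CommRing C] [Algebra k C] (x : ι → K) (S : Set ι)
    (hS : AlgebraicIndependent k (fun i : S => x i))
    (hsep : Algebra.IsSeparable (IntermediateField.adjoin k (x '' S)) K)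
    (π : C →ₐ[k] K) (hπ : Function.Surjective π) (hnil : IsNilpotent (RingHom.ker π))
    (y : ι → C) (hy : ∀ i ∈ S, π (y i) = x i) :
    ∃ Φ : K →ₐ[k] C, (∀ a, π (Φ a) = a) ∧ ∀ i ∈ S, Φ (x i) = y i := by
  have himg : x '' S = Set.range (fun i : S => x i) := by ext; simp
  rw [himg] at hsep
  have hunit : ∀ c : C, π c ≠ 0 → IsUnit c := by
    intro c hc
    obtain ⟨b, hb⟩ := hπ (π c)⁻¹
    have h1 : c * b - 1 ∈ RingHom.ker π := by
      simp [RingHom.mem_ker, hb, mul_inv_cancel₀ hc]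
    obtain ⟨m, hm⟩ := hnil
    have h2 : IsNilpotent (c * b - 1) := ⟨m, by
      have := Ideal.pow_mem_pow h1 m
      rwa [hm, Ideal.zero_eq_bot, Ideal.mem_bot] at this⟩
    have h3 := h2.isUnit_add_one
    rw [sub_add_cancel] at h3
    exact isUnit_of_mul_isUnit_left h3
  let F := IntermediateField.adjoin k (Set.range (fun i : S => x i))
  let e := hS.aevalEquivField
  let α : MvPolynomial S k →ₐ[k] C := MvPolynomial.aeval (fun i : S => y i)
  have hα : ∀ p, π (α p) = MvPolynomial.aeval (fun i : S => x i) p := by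
    intro p
    have : π.comp α = MvPolynomial.aeval (fun i : S => x i) := by
      ext i; simp [α, hy i i.2]
    exact DFunLike.congr_fun this p
  have hαu : ∀ p : nonZeroDivisors (MvPolynomial S k), IsUnit (α p) := fun p =>
    hunit _ (by
      rw [hα]
      intro h
      exact nonZeroDivisors.ne_zero p.2 (hS.eq_zero_of_aeval_eq_zero _ h))
  let β : FractionRing (MvPolynomial S k) →ₐ[k] C :=
    IsLocalization.liftAlgHom (M := nonZeroDivisors (MvPolynomial S k)) (f := α) hαu
  let γ : F →ₐ[k] C := β.comp e.symm.toAlgHom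
  have hγx : ∀ i : S, γ ⟨x i, IntermediateField.subset_adjoin _ _ ⟨i, rfl⟩⟩ = y i := by
    intro i
    have h1 : e (algebraMap (MvPolynomial S k) _ (MvPolynomial.X i)) =
        ⟨x i, IntermediateField.subset_adjoin _ _ ⟨i, rfl⟩⟩ := by
      apply Subtype.ext
      simp [e]
    rw [← h1]
    simp [γ, β, α]
  have hγ : ∀ a : F, π (γ a) = a := by
    have : (π.comp γ).comp e.toAlgHom = (IntermediateField.val F).comp e.toAlgHom := by
      apply IsLocalization.algHom_ext (nonZeroDivisors (MvPolynomial S k))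
      ext i
      have h1 : e (algebraMap (MvPolynomial S k) _ (MvPolynomial.X i)) =
        ⟨x i, IntermediateField.subset_adjoin _ _ ⟨i, rfl⟩⟩ := by
        apply Subtype.ext
        simp [e]
      change π (γ (e (algebraMap (MvPolynomial S k) _ (MvPolynomial.X i)))) =
        ((e (algebraMap (MvPolynomial S k) _ (MvPolynomial.X i)) : F) : K)
      rw [h1, hγx, hy _ i.2]
    intro a
    obtain ⟨b, rfl⟩ := e.surjective a
    exact DFunLike.congr_fun this b
  algebraize [γ.toRingHom]
  let πF : C →ₐ[F] K := { π with commutes' := fun a => hγ a }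
  have hsm : Algebra.FormallySmooth F K :=
    have := Algebra.FormallyEtale.of_isSeparable F K
    inferInstance
  have hker : IsNilpotent (RingHom.ker (πF : C →+* K)) := hnil
  let Ψ : K →ₐ[F] C := Algebra.FormallySmooth.liftOfSurjective (AlgHom.id F K) πF hπ hker
  have hΨ : ∀ a, πF (Ψ a) = a := fun a =>
    Algebra.FormallySmooth.liftOfSurjective_apply (AlgHom.id F K) πF hπ hker a
  refine ⟨{ Ψ with commutes' := fun r => ?_ }, hΨ, fun i hi => ?_⟩
  · have h1 := Ψ.commutes (algebraMap k F r)
    have h2 : γ (algebraMap k F r) = algebraMap k C r := γ.commutes r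
    exact h1.trans h2
  · have h1 := Ψ.commutes ⟨x i, IntermediateField.subset_adjoin _ _ ⟨⟨i, hi⟩, rfl⟩⟩
    exact h1.trans (hγx ⟨i, hi⟩)

theorem homogeneousComponent_add_mul_of_totalDegree_le {σ R : Type*} [CommRing R]
    {p q : MvPolynomial σ R} {a b : ℕ} (hp : p.totalDegree ≤ a) (hq : q.totalDegree ≤ b) :
    homogeneousComponent (a + b) (p * q) = homogeneousComponent a p * homogeneousComponent b q := by
  have key : ∀ (p : MvPolynomial σ R) (a : ℕ), p.totalDegree ≤ a →
      p = ∑ i ∈ Finset.range (a + 1), homogeneousComponent i p := by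
    intro p a hp
    conv_lhs => rw [← sum_homogeneousComponent p]
    refine Finset.sum_subset (Finset.range_mono (by omega)) fun i _ hi => ?_
    exact homogeneousComponent_eq_zero _ _ (by simpa using hi)
  conv_lhs => rw [key p a hp, key q b hq, Finset.sum_mul_sum]
  simp only [map_sum]
  have h1 : ∀ i ∈ Finset.range (a + 1), ∀ j ∈ Finset.range (b + 1),
      homogeneousComponent (a + b) (homogeneousComponent i p * homogeneousComponent j q) =
      if i = a then (if j = b then homogeneousComponent a p * homogeneousComponent b q else 0)
        else 0 := by
    intro i hi j hj
    rw [Finset.mem_range] at hi hj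
    have := homogeneousComponent_of_mem (m := a + b)
      ((homogeneousComponent_isHomogeneous i p).mul (homogeneousComponent_isHomogeneous j q))
    rw [this]
    split_ifs with h1 h2 h3 h2 h3
    · rw [h2, h3]
    all_goals first | rfl | omega
  rw [Finset.sum_congr rfl fun i hi => Finset.sum_congr rfl (h1 i hi)]
  simp

theorem homogeneousComponent_aeval_C_add_X {σ k κ : Type*} [CommRing k] [CommRing κ]
    [Algebra k κ] [Nontrivial κ] (x : σ → κ) {p : MvPolynomial σ k} {e : ℕ}
    (hp : p.IsHomogeneous e) :
    (aeval (fun i => C (x i) + X i : σ → MvPolynomial σ κ) p).totalDegree ≤ e ∧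
    homogeneousComponent e (aeval (fun i => C (x i) + X i : σ → MvPolynomial σ κ) p) =
      map (algebraMap k κ) p := by
  classical
  have hM : ∀ s : σ →₀ ℕ,
      (aeval (fun i => C (x i) + X i : σ → MvPolynomial σ κ) (monomial s (1 : k))).totalDegree
        ≤ s.degree ∧
      homogeneousComponent s.degree
        (aeval (fun i => C (x i) + X i : σ → MvPolynomial σ κ) (monomial s (1 : k))) =
        monomial s 1 := by
    intro s
    have hadd : ∀ s t : σ →₀ ℕ, _ → _ → _ := fun s t
      (hs : (aeval (fun i => C (x i) + X i : σ → MvPolynomial σ κ) (monomial s (1 : k))).totalDegree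
        ≤ s.degree ∧
      homogeneousComponent s.degree
        (aeval (fun i => C (x i) + X i : σ → MvPolynomial σ κ) (monomial s (1 : k))) =
        monomial s 1)
      (ht : (aeval (fun i => C (x i) + X i : σ → MvPolynomial σ κ) (monomial t (1 : k))).totalDegree
        ≤ t.degree ∧
      homogeneousComponent t.degree
        (aeval (fun i => C (x i) + X i : σ → MvPolynomial σ κ) (monomial t (1 : k))) =
        monomial t 1) => show
        (aeval (fun i => C (x i) + X i : σ → MvPolynomial σ κ)
          (monomial (s + t) (1 : k))).totalDegree ≤ (s + t).degree ∧
        homogeneousComponent (s + t).degree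
          (aeval (fun i => C (x i) + X i : σ → MvPolynomial σ κ) (monomial (s + t) (1 : k))) =
          monomial (s + t) 1 by
      have h1 : (monomial (s + t) (1 : k)) = monomial s 1 * monomial t 1 := by
        simp [monomial_mul]
      rw [h1, map_mul, map_add]
      refine ⟨(totalDegree_mul _ _).trans (add_le_add hs.1 ht.1), ?_⟩
      rw [homogeneousComponent_add_mul_of_totalDegree_le hs.1 ht.1, hs.2, ht.2]
      simp [monomial_mul]
    induction s using Finsupp.induction_linear with
    | zero =>
      simp only [monomial_zero', map_one, totalDegree_one, map_zero, le_refl, true_and]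
      simp
    | add s t hs ht => exact hadd s t hs ht
    | single i n =>
      induction n with
      | zero =>
        simp only [Finsupp.single_zero, monomial_zero', map_one, totalDegree_one,
          map_zero, le_refl, true_and]
        simp
      | succ n ih =>
        rw [Finsupp.single_add]
        refine hadd _ _ ih ?_
        have : (monomial (Finsupp.single i 1) (1 : k)) = X i := rfl
        rw [this, aeval_X, Finsupp.degree_single]
        refine ⟨(totalDegree_add _ _).trans (by simp), ?_⟩
        rw [map_add, homogeneousComponent_eq_self (isHomogeneous_X κ i),
          homogeneousComponent_eq_zero _ _ (by simp), zero_add]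
        rfl
  have hdec : aeval (fun i => C (x i) + X i : σ → MvPolynomial σ κ) p =
      ∑ s ∈ p.support, C (algebraMap k κ (p.coeff s)) *
        aeval (fun i => C (x i) + X i : σ → MvPolynomial σ κ) (monomial s (1 : k)) := by
    conv_lhs => rw [p.as_sum, map_sum]
    refine Finset.sum_congr rfl fun s _ => ?_
    have : monomial s (p.coeff s) = C (p.coeff s) * monomial s 1 := by simp [C_mul_monomial]
    rw [this, map_mul]
    simp
  have hdeg : ∀ s ∈ p.support, s.degree = e := fun s hs =>
    (hp.degree_eq_sum_deg_support hs).symm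
  constructor
  · rw [hdec]
    refine totalDegree_finsetSum_le fun s hs => (totalDegree_mul _ _).trans ?_
    rw [totalDegree_C, zero_add, ← hdeg s hs]
    exact (hM s).1
  · rw [hdec, map_sum]
    conv_rhs => rw [p.as_sum, map_sum]
    refine Finset.sum_congr rfl fun s hs => ?_
    rw [homogeneousComponent_C_mul, ← hdeg s hs, (hM s).2, map_monomial, C_mul_monomial, mul_one]

theorem homogeneousComponent_eq_zero_of_mem_pow_idealOfVars {σ R : Type*} [CommRing R]
    {p : MvPolynomial σ R} {a m : ℕ} (hp : p ∈ idealOfVars σ R ^ a) (hm : m < a) :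
    homogeneousComponent m p = 0 := by
  classical
  ext s
  rw [coeff_homogeneousComponent, coeff_zero]
  split_ifs with h
  · exact (mem_pow_idealOfVars_iff' _ _).1 hp s (by omega)
  · rfl

theorem homogeneousComponent_mem_pow_idealOfVars {σ R : Type*} [CommRing R]
    (p : MvPolynomial σ R) (m : ℕ) :
    homogeneousComponent m p ∈ idealOfVars σ R ^ m := by
  classical
  refine (mem_pow_idealOfVars_iff' _ _).2 fun s hs => ?_
  rw [coeff_homogeneousComponent, if_neg (by omega)]

theorem mem_sup_pow_idealOfVars_of_homogeneousComponent_mem {σ R : Type*} [CommRing R]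
    {p : MvPolynomial σ R} {Q : Ideal (MvPolynomial σ R)} {a : ℕ}
    (h : ∀ m < a, homogeneousComponent m p ∈ Q) : p ∈ Q ⊔ idealOfVars σ R ^ a := by
  rw [← sum_homogeneousComponent p]
  refine Ideal.sum_mem _ fun m _ => ?_
  rcases lt_or_ge m a with hm | hm
  · exact Ideal.mem_sup_left (h m hm)
  · exact Ideal.mem_sup_right (Ideal.pow_le_pow_right hm
      (homogeneousComponent_mem_pow_idealOfVars p m))

theorem homogeneousComponent_mul_of_isHomogeneous {σ R : Type*} [CommRing R]
    {a q : MvPolynomial σ R} {m d : ℕ} (hq : q.IsHomogeneous m) (hm : m ≤ d) :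
    homogeneousComponent d (a * q) = homogeneousComponent (d - m) a * q := by
  conv_lhs => rw [← sum_homogeneousComponent a, Finset.sum_mul]
  have h1 : ∀ i, homogeneousComponent d (homogeneousComponent i a * q) =
      if i = d - m then homogeneousComponent (d - m) a * q else 0 := by
    intro i
    rw [homogeneousComponent_of_mem (m := d) ((homogeneousComponent_isHomogeneous i a).mul hq)]
    split_ifs with h1 h2 h2
    · rw [h2]
    all_goals first | rfl | omega
  rw [map_sum, Finset.sum_congr rfl fun i _ => h1 i, Finset.sum_ite_eq']
  split_ifs with h
  · rfl
  · rw [homogeneousComponent_eq_zero _ _ (by simp at h; omega), zero_mul]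

theorem exists_eq_sum_mul_of_mem_span_sup_pow_idealOfVars {σ R ι : Type*} [CommRing R] [Fintype ι]
    {q : ι → MvPolynomial σ R} {m : ι → ℕ} (hq : ∀ i, (q i).IsHomogeneous (m i)) {d : ℕ}
    (hm : ∀ i, m i ≤ d) {G : MvPolynomial σ R}
    (hG : G ∈ Ideal.span (Set.range q) ⊔ idealOfVars σ R ^ (d + 1)) :
    ∃ a : ι → MvPolynomial σ R, (∀ i, (a i).IsHomogeneous (d - m i)) ∧
      homogeneousComponent d G = ∑ i, a i * q i := by
  obtain ⟨y, hy, z, hz, rfl⟩ := Submodule.mem_sup.1 hG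
  obtain ⟨c, rfl⟩ := (Ideal.mem_span_range_iff_exists_fun).1 hy
  refine ⟨fun i => homogeneousComponent (d - m i) (c i),
    fun i => homogeneousComponent_isHomogeneous _ _, ?_⟩
  rw [map_add, homogeneousComponent_eq_zero_of_mem_pow_idealOfVars hz (by omega), add_zero, map_sum]
  exact Finset.sum_congr rfl fun i _ => homogeneousComponent_mul_of_isHomogeneous (hq i) (hm i)

theorem sum_X_mul_X_mul_pderiv_pderiv {k : Type*} [CommRing k] {n d : ℕ}
    {f : MvPolynomial (Fin n) k} (hhom : f.IsHomogeneous d) :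
    ∑ i, ∑ j, X i * (X j * pderiv i (pderiv j f)) =
      ((d * (d - 1) : ℕ) : MvPolynomial (Fin n) k) * f := by
  rw [Finset.sum_comm]
  have h1 : ∀ j, ∑ i, X i * (X j * pderiv i (pderiv j f)) =
      ((d - 1 : ℕ) : MvPolynomial (Fin n) k) * (X j * pderiv j f) := by
    intro j
    have := (hhom.pderiv (i := j)).sum_X_mul_pderiv
    rw [nsmul_eq_mul] at this
    rw [mul_left_comm, ← this, Finset.mul_sum]
    exact Finset.sum_congr rfl fun i _ => by ring
  rw [Finset.sum_congr rfl fun j _ => h1 j, ← Finset.mul_sum, hhom.sum_X_mul_pderiv, nsmul_eq_mul]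
  push_cast
  ring

theorem pderiv_pderiv_comm {σ R : Type*} [CommRing R] (i j : σ) (f : MvPolynomial σ R) :
    pderiv i (pderiv j f) = pderiv j (pderiv i f) := by
  classical
  have h : ⁅(pderiv i : Derivation R (MvPolynomial σ R) (MvPolynomial σ R)),
      (pderiv j : Derivation R (MvPolynomial σ R) (MvPolynomial σ R))⁆ = 0 := by
    apply MvPolynomial.derivation_ext
    intro l
    rw [Derivation.commutator_apply]
    simp [pderiv_X, Pi.single_apply, apply_ite]
  have := DFunLike.congr_fun h f
  rwa [Derivation.commutator_apply, Derivation.zero_apply, sub_eq_zero] at this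

theorem exists_map_eq_sum_mul {k κ : Type} [Field k] [Field κ] [Algebra k κ]
    {n d : ℕ} (hd : 3 ≤ d) (hchar : ((d * (d - 1) : ℕ) : κ) ≠ 0) {f : MvPolynomial (Fin n) k}
    (hhom : f.IsHomogeneous d) (x : Fin n → κ) (S : Finset (Fin n))
    (hS : AlgebraicIndependent k (fun i : (S : Set (Fin n)) => x i))
    (hsep : Algebra.IsSeparable (IntermediateField.adjoin k (x '' S)) κ)
    (J : Finset (Fin n)) (E : Matrix (Fin n) (Fin n) κ)
    (hE : ∀ i l, ∑ j, aeval x (pderiv i (pderiv j f)) * E j l = 0)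
    (hJ : ∀ i ∈ J, ∀ j, E i j = if i = j then 1 else 0) :
    ∃ (m : Fin (d - 2) × ({i // i ∉ S} ⊕ {i // i ∉ J}) → ℕ)
      (g h : Fin (d - 2) × ({i // i ∉ S} ⊕ {i // i ∉ J}) → (MvPolynomial (Fin n) κ)),
      (∀ i, 0 < m i ∧ m i < d) ∧ (∀ i, (g i).IsHomogeneous (d - m i)) ∧
      (∀ i, (h i).IsHomogeneous (m i)) ∧ map (algebraMap k κ) f = ∑ i, g i * h i := by
  classical
  let M : Ideal (MvPolynomial (Fin n) κ) := idealOfVars (Fin n) κ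
  have hXM : ∀ i, (X i : (MvPolynomial (Fin n) κ)) ∈ M := fun i => Ideal.subset_span ⟨i, rfl⟩
  have hMc : ∀ p : (MvPolynomial (Fin n) κ), p ∈ M ↔ constantCoeff p = 0 := by
    intro p
    have := mem_pow_idealOfVars_iff' 1 p
    rw [pow_one] at this
    rw [this]
    constructor
    · intro h; exact h 0 (by simp)
    · intro h s hs
      have : s = 0 := by
        rw [Nat.lt_one_iff] at hs
        exact (Finsupp.degree_eq_zero_iff s).1 hs
      rw [this]; exact h
  let C' := (MvPolynomial (Fin n) κ) ⧸ M ^ (d + 1)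
  let π : C' →ₐ[k] κ := Ideal.Quotient.liftₐ (M ^ (d + 1))
    ((aeval (0 : Fin n → κ) : (MvPolynomial (Fin n) κ) →ₐ[κ] κ).restrictScalars k) (by
      intro a ha
      have h1 : a ∈ M := Ideal.pow_le_self (by omega) ha
      have := (hMc a).1 h1
      change aeval (0 : Fin n → κ) a = 0
      simpa using this)
  have hπmk : ∀ p : (MvPolynomial (Fin n) κ), π (Ideal.Quotient.mk _ p) = constantCoeff p := by
    intro p
    change aeval (0 : Fin n → κ) p = _
    simp
  have hπs : Function.Surjective π := fun a => ⟨Ideal.Quotient.mk _ (C a), by simp [hπmk]⟩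
  have hnil : IsNilpotent (RingHom.ker π) := by
    refine ⟨d + 1, ?_⟩
    have h1 : RingHom.ker π ≤ M.map (Ideal.Quotient.mk (M ^ (d + 1))) := by
      intro a ha
      obtain ⟨p, rfl⟩ := Ideal.Quotient.mk_surjective a
      refine Ideal.mem_map_of_mem _ ((hMc p).2 ?_)
      rw [← hπmk]; exact ha
    rw [Ideal.zero_eq_bot, eq_bot_iff]
    refine (Ideal.pow_right_mono h1 _).trans ?_
    rw [← Ideal.map_pow, Ideal.map_quotient_self]
  obtain ⟨Φ, hΦπ, hΦS⟩ := exists_algHom_lift_of_isSeparable x (S : Set (Fin n)) hS hsep π hπs hnil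
    (fun i => Ideal.Quotient.mk _ (C (x i) + X i)) (by intro i _; simp [hπmk])
  choose L hL using fun a => Ideal.Quotient.mk_surjective (Φ a)
  have hLc : ∀ a, constantCoeff (L a) = a := fun a => by rw [← hπmk, hL, hΦπ]
  let xt : Fin n → (MvPolynomial (Fin n) κ) := fun i => if i ∈ S then C (x i) + X i else L (x i)
  have hxt : ∀ i, Ideal.Quotient.mk _ (xt i) = Φ (x i) := by
    intro i
    simp only [xt]
    split_ifs with h
    · exact (hΦS i h).symm
    · exact hL _
  let Et : Fin n → Fin n → (MvPolynomial (Fin n) κ) := fun i j =>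
    if i ∈ J then (if i = j then 1 else 0) else L (E i j)
  have hEt : ∀ i j, Ideal.Quotient.mk _ (Et i j) = Φ (E i j) := by
    intro i j
    simp only [Et]
    split_ifs with h h2
    · rw [hJ i h, if_pos h2]; simp
    · rw [hJ i h, if_neg h2]; simp
    · exact hL _
  have hEtc : ∀ i j, constantCoeff (Et i j) = E i j := fun i j => by rw [← hπmk, hEt, hΦπ]
  have hxtc : ∀ i, constantCoeff (xt i) = x i := fun i => by rw [← hπmk, hxt, hΦπ]
  let ht : Fin n → Fin n → (MvPolynomial (Fin n) κ) := fun i j => aeval xt (pderiv i (pderiv j f))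
  let h0 : Fin n → Fin n → (MvPolynomial (Fin n) κ) := fun i j =>
    C (aeval x (pderiv i (pderiv j f)))
  let hz : Fin n → Fin n → (MvPolynomial (Fin n) κ) := fun i j =>
    aeval (fun i => C (x i) + X i : Fin n → (MvPolynomial (Fin n) κ))
    (pderiv i (pderiv j f))
  have hht : ∀ i j, Ideal.Quotient.mk (M ^ (d + 1)) (ht i j) =
      Φ (aeval x (pderiv i (pderiv j f))) := by
    intro i j
    have h1 : ((Ideal.Quotient.mkₐ k (M ^ (d + 1))).comp (aeval xt)) = Φ.comp (aeval x) := by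
      ext l; simp [hxt]
    exact DFunLike.congr_fun h1 _
  have hker : ∀ i l, ∑ j, ht i j * Et j l ∈ M ^ (d + 1) := by
    intro i l
    rw [← Ideal.Quotient.eq_zero_iff_mem, map_sum]
    simp only [map_mul, hht, hEt]
    rw [← map_zero Φ, ← hE i l, map_sum]
    simp
  let ε : Fin n → (MvPolynomial (Fin n) κ) := fun i => xt i - (C (x i) + X i)
  let kt : Fin n → (MvPolynomial (Fin n) κ) := fun i => ∑ j, Et i j * X j
  let δ : Fin n → (MvPolynomial (Fin n) κ) := fun i => kt i - X i
  let u : Fin n → (MvPolynomial (Fin n) κ) := fun i => ∑ j, C (E i j) * X j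
  have hεM : ∀ i, ε i ∈ M := fun i => by simp [hMc, ε, hxtc]
  have hδM : ∀ i, δ i ∈ M := fun i => by simp [hMc, δ, kt]
  have huM : ∀ i, u i ∈ M := fun i => by simp [hMc, u]
  let q : Fin (d - 2) × ({i // i ∉ S} ⊕ {i // i ∉ J}) → (MvPolynomial (Fin n) κ) := fun a =>
    homogeneousComponent (a.1 + 1)
      (Sum.elim (fun i : {i // i ∉ S} => ε i) (fun i : {i // i ∉ J} => δ i) a.2)
  let Q : Ideal (MvPolynomial (Fin n) κ) := Ideal.span (Set.range q)
  have hεQ : ∀ i, ∀ m < d - 1, homogeneousComponent m (ε i) ∈ Q := by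
    intro i m hm
    by_cases hi : i ∈ S
    · have : ε i = 0 := by simp [ε, xt, hi]
      rw [this, map_zero]; exact Q.zero_mem
    rcases Nat.eq_zero_or_pos m with rfl | hm0
    · rw [homogeneousComponent_zero]
      have : coeff 0 (ε i) = 0 := (hMc _).1 (hεM i)
      simp [this]
    · refine Ideal.subset_span ⟨(⟨m - 1, by omega⟩, .inl ⟨i, hi⟩), ?_⟩
      simp only [q, Sum.elim_inl]
      rw [Nat.sub_add_cancel hm0]
  have hδQ : ∀ i, ∀ m < d - 1, homogeneousComponent m (δ i) ∈ Q := by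
    intro i m hm
    by_cases hi : i ∈ J
    · have : δ i = 0 := by simp [δ, kt, Et, hi]
      rw [this, map_zero]; exact Q.zero_mem
    rcases Nat.eq_zero_or_pos m with rfl | hm0
    · rw [homogeneousComponent_zero]
      have : coeff 0 (δ i) = 0 := (hMc _).1 (hδM i)
      simp [this]
    · refine Ideal.subset_span ⟨(⟨m - 1, by omega⟩, .inr ⟨i, hi⟩), ?_⟩
      simp only [q, Sum.elim_inr]
      rw [Nat.sub_add_cancel hm0]
  have hεI : ∀ i, ε i ∈ Q ⊔ M ^ (d - 1) := fun i =>
    mem_sup_pow_idealOfVars_of_homogeneousComponent_mem (hεQ i)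
  have hδI : ∀ i, δ i ∈ Q ⊔ M ^ (d - 1) := fun i =>
    mem_sup_pow_idealOfVars_of_homogeneousComponent_mem (hδQ i)
  have huQ : ∀ i, X i - u i ∈ Q := by
    intro i
    have h1 : kt i - u i ∈ M ^ 2 := by
      simp only [kt, u, ← Finset.sum_sub_distrib, ← sub_mul]
      refine Ideal.sum_mem _ fun j _ => ?_
      rw [pow_two]
      exact Ideal.mul_mem_mul ((hMc _).2 (by simp [hEtc])) (hXM j)
    have h2 : homogeneousComponent 1 (X i - u i) = X i - u i := by
      apply homogeneousComponent_eq_self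
      exact (isHomogeneous_X _ _).sub (IsHomogeneous.sum _ _ _ fun j _ => isHomogeneous_C_mul_X _ _)
    have h3 : X i - u i = - homogeneousComponent 1 (δ i) := by
      rw [← h2]
      have : X i - u i = - δ i + (kt i - u i) := by simp only [δ]; ring
      rw [this, map_add, map_neg, homogeneousComponent_eq_zero_of_mem_pow_idealOfVars h1 (by omega),
        add_zero]
    rw [h3]
    exact Q.neg_mem (hδQ i 1 (by omega))
  let I : Ideal (MvPolynomial (Fin n) κ) := Q ⊔ M ^ (d + 1)
  have hMI : ∀ a b c : (MvPolynomial (Fin n) κ), a ∈ M → b ∈ M → c ∈ Q ⊔ M ^ (d - 1) →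
      a * b * c ∈ I := by
    intro a b c ha hb hc
    obtain ⟨y, hy, z, hz, rfl⟩ := Submodule.mem_sup.1 hc
    rw [mul_add]
    refine I.add_mem (Ideal.mem_sup_left (Q.mul_mem_left _ hy)) (Ideal.mem_sup_right ?_)
    have : d + 1 = 2 + (d - 1) := by omega
    rw [this, pow_add, pow_two]
    exact Ideal.mul_mem_mul (Ideal.mul_mem_mul ha hb) hz
  have hdiff : ∀ (y y' : Fin n → (MvPolynomial (Fin n) κ)) (N : Ideal (MvPolynomial (Fin n) κ))
      (p : MvPolynomial (Fin n) k),
      (∀ i, y i - y' i ∈ N) → aeval y p - aeval y' p ∈ N := by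
    intro y y' N p hN
    rw [← Ideal.Quotient.eq]
    have h1 : ((Ideal.Quotient.mkₐ k N).comp (aeval y)) =
        (Ideal.Quotient.mkₐ k N).comp (aeval y') := by
      ext l; simpa using Ideal.Quotient.eq.2 (hN l)
    exact DFunLike.congr_fun h1 p
  have hd1 : ∀ i j, hz i j - ht i j ∈ Q ⊔ M ^ (d - 1) := fun i j =>
    hdiff _ _ _ _ fun l => by
      have := Ideal.neg_mem_iff (Q ⊔ M ^ (d - 1)) |>.2 (hεI l)
      simpa [ε] using this
  have hd2 : ∀ i j, ht i j - h0 i j ∈ M := fun i j => by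
    have h1 : (aeval (fun i => C (x i) : Fin n → (MvPolynomial (Fin n) κ)))
        (pderiv i (pderiv j f)) = h0 i j := by
      have : (aeval (fun i => C (x i) : Fin n → (MvPolynomial (Fin n) κ))) =
          (IsScalarTower.toAlgHom k κ (MvPolynomial (Fin n) κ)).comp (aeval x) := by
        ext l; simp [MvPolynomial.algebraMap_eq]
      exact DFunLike.congr_fun this _
    rw [← h1]
    exact hdiff _ _ _ _ fun l => by simp [hMc, hxtc]
  have hu0 : ∀ j, ∑ i, u i * h0 i j = 0 := by
    intro j
    have h1 : ∀ i, u i * h0 i j =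
        ∑ l, C (aeval x (pderiv j (pderiv i f)) * E i l) * X l := by
      intro i
      simp only [u, h0, Finset.sum_mul]
      refine Finset.sum_congr rfl fun l _ => ?_
      rw [pderiv_pderiv_comm i j, C_mul]; ring
    rw [Finset.sum_congr rfl fun i _ => h1 i, Finset.sum_comm]
    refine Finset.sum_eq_zero fun l _ => ?_
    rw [← Finset.sum_mul, ← map_sum, hE, map_zero, zero_mul]
  have hkt : ∀ i, ∑ j, ht i j * kt j ∈ M ^ (d + 1) := by
    intro i
    have h1 : ∑ j, ht i j * kt j = ∑ l, (∑ j, ht i j * Et j l) * X l := by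
      simp only [kt, Finset.mul_sum, Finset.sum_mul]
      rw [Finset.sum_comm]
      exact Finset.sum_congr rfl fun _ _ => Finset.sum_congr rfl fun _ _ => by ring
    rw [h1]
    exact Ideal.sum_mem _ fun l _ => Ideal.mul_mem_right _ _ (hker i l)
  let G : (MvPolynomial (Fin n) κ) := ∑ i, ∑ j, X i * (X j * hz i j)
  have hG : G ∈ I := by
    have h1 : G = ∑ i, ∑ j, ((X i - u i) * (X j * hz i j)) +
        ∑ i, ∑ j, (u i * X j * (hz i j - ht i j)) + ∑ i, u i * (∑ j, ht i j * kt j)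
        - ∑ i, ∑ j, (u i * (ht i j - h0 i j) * δ j) - ∑ j, (∑ i, u i * h0 i j) * δ j := by
      simp only [Finset.sum_mul, Finset.mul_sum]
      rw [Finset.sum_comm (f := fun j i => u i * h0 i j * δ j)]
      simp only [← Finset.sum_add_distrib, ← Finset.sum_sub_distrib, G]
      refine Finset.sum_congr rfl fun i _ => Finset.sum_congr rfl fun j _ => ?_
      simp only [δ]
      ring
    rw [h1]
    refine I.sub_mem (I.sub_mem (I.add_mem (I.add_mem ?_ ?_) ?_) ?_) ?_
    · exact I.sum_mem fun i _ => I.sum_mem fun j _ =>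
        Ideal.mem_sup_left (Q.mul_mem_right _ (huQ i))
    · exact I.sum_mem fun i _ => I.sum_mem fun j _ => hMI _ _ _ (huM i) (hXM j) (hd1 i j)
    · exact I.sum_mem fun i _ => I.mul_mem_left _ (Ideal.mem_sup_right (hkt i))
    · exact I.sum_mem fun i _ => I.sum_mem fun j _ => hMI _ _ _ (huM i) (hd2 i j) (hδI j)
    · exact I.sum_mem fun j _ => by rw [hu0, zero_mul]; exact I.zero_mem
  have hGd : homogeneousComponent d G = C ((d * (d - 1) : ℕ) : κ) * map (algebraMap k κ) f := by
    have h1 : ∀ i j, homogeneousComponent d (X i * (X j * hz i j)) =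
        map (algebraMap k κ) (X i * (X j * pderiv i (pderiv j f))) := by
      intro i j
      have h2 := (hhom.pderiv (i := j)).pderiv (i := i)
      obtain ⟨h3, h4⟩ := homogeneousComponent_aeval_C_add_X x h2
      have h5 : (X i * (X j * hz i j) : (MvPolynomial (Fin n) κ)) = hz i j * (X i * X j) := by ring
      rw [h5, homogeneousComponent_mul_of_isHomogeneous
        ((isHomogeneous_X _ _).mul (isHomogeneous_X _ _)) (by omega : 1 + 1 ≤ d)]
      have h6 : d - (1 + 1) = d - 1 - 1 := by omega
      rw [h6, h4]
      simp only [map_mul, map_X]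
      ring
    have h2 := congrArg (map (algebraMap k κ)) (sum_X_mul_X_mul_pderiv_pderiv hhom)
    simp only [map_sum] at h2
    simp only [G, map_sum, h1]
    rw [h2, map_mul]
    simp
  obtain ⟨a, ha, hsum⟩ := exists_eq_sum_mul_of_mem_span_sup_pow_idealOfVars (q := q)
    (m := fun a => a.1 + 1) (fun i => homogeneousComponent_isHomogeneous _ _) (d := d)
    (fun i => by omega) hG
  refine ⟨fun a => a.1 + 1, fun i => C ((d * (d - 1) : ℕ) : κ)⁻¹ * a i, q, fun i => ⟨by simp, by
    have := i.1.2; simp only; omega⟩, fun i => ?_, fun i => homogeneousComponent_isHomogeneous _ _,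
        ?_⟩
  · exact (ha i).C_mul _
  · simp only [mul_assoc, ← Finset.mul_sum]
    rw [← hsum, hGd, ← mul_assoc, ← C_mul, inv_mul_cancel₀ hchar, C_1, one_mul]

theorem exists_algHom_of_finiteType {k A : Type} [Field k] [IsAlgClosed k] [CommRing A]
    [Nontrivial A] [Algebra k A] [Algebra.FiniteType k A] : Nonempty (A →ₐ[k] k) := by
  obtain ⟨m, hm⟩ := Ideal.exists_maximal A
  let := Ideal.Quotient.field m
  have : Algebra.FiniteType k (A ⧸ m) := inferInstance
  have : Module.Finite k (A ⧸ m) := finite_of_finite_type_of_isJacobsonRing k (A ⧸ m)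
  have : Algebra.IsAlgebraic k (A ⧸ m) := inferInstance
  exact ⟨(IsAlgClosed.lift : (A ⧸ m) →ₐ[k] k).comp (Ideal.Quotient.mkₐ k m)⟩

theorem polySchmidtRank_le_of_map_eq {k κ ι : Type} [Field k] [IsAlgClosed k] [Field κ]
    [Algebra k κ] [Fintype ι] {n : ℕ} {f : MvPolynomial (Fin n) k} (a b : ι → ℕ)
    (ha : ∀ i, 0 < a i) (hb : ∀ i, 0 < b i) (g h : ι → MvPolynomial (Fin n) κ)
    (hg : ∀ i, (g i).IsHomogeneous (a i)) (hh : ∀ i, (h i).IsHomogeneous (b i))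
    (hf : map (algebraMap k κ) f = ∑ i, g i * h i) : polySchmidtRank f ≤ Fintype.card ι := by
  classical
  let s : Finset κ := Finset.univ.biUnion fun i => (g i).coeffs ∪ (h i).coeffs
  let A := Algebra.adjoin k (s : Set κ)
  have hs : ∀ p : MvPolynomial (Fin n) κ, (p.coeffs : Set κ) ⊆ s →
      ∃ p', map (algebraMap A κ) p' = p := by
    intro p hp
    refine mem_range_map_iff_coeffs_subset.2 fun c hc => ?_
    exact ⟨⟨c, Algebra.subset_adjoin (hp hc)⟩, rfl⟩
  have h1 : ∀ i, ((g i).coeffs : Set κ) ⊆ s := fun i c hc => by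
    simp only [s, Finset.coe_biUnion, Set.mem_iUnion]
    exact ⟨i, by simp, by simp [Finset.mem_coe.1 hc]⟩
  have h2 : ∀ i, ((h i).coeffs : Set κ) ⊆ s := fun i c hc => by
    simp only [s, Finset.coe_biUnion, Set.mem_iUnion]
    exact ⟨i, by simp, by simp [Finset.mem_coe.1 hc]⟩
  choose g' hg' using fun i => hs (g i) (h1 i)
  choose h' hh' using fun i => hs (h i) (h2 i)
  have hinj : Function.Injective (algebraMap A κ) := Subtype.val_injective
  have hft : Algebra.FiniteType k A := by
    rw [← Subalgebra.fg_iff_finiteType]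
    exact Subalgebra.fg_adjoin_finset s
  obtain ⟨φ⟩ := exists_algHom_of_finiteType (k := k) (A := A)
  have hf' : map (algebraMap k A) f = ∑ i, g' i * h' i := by
    apply map_injective _ hinj
    rw [map_map, ← IsScalarTower.algebraMap_eq, hf, map_sum]
    simp [hg', hh']
  have hf2 : f = ∑ i, map φ.toRingHom (g' i) * map φ.toRingHom (h' i) := by
    have := congrArg (map φ.toRingHom) hf'
    rw [map_map, map_sum] at this
    simp only [map_mul] at this
    rw [← this]
    have h3 : (φ.toRingHom.comp (algebraMap k A)) = RingHom.id k := by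
      ext c; exact φ.commutes c
    rw [h3, map_id]
  let e := (Fintype.equivFin ι).symm
  refine Nat.sInf_le ⟨fun i => map φ.toRingHom (g' (e i)), fun i => map φ.toRingHom (h' (e i)),
    fun i => ⟨a (e i), ha _, ?_⟩, fun i => ⟨b (e i), hb _, ?_⟩, ?_⟩
  · exact IsHomogeneous.map (IsHomogeneous.of_map hinj (by rw [hg']; exact hg _)) _
  · exact IsHomogeneous.map (IsHomogeneous.of_map hinj (by rw [hh']; exact hh _)) _
  · rw [Equiv.sum_comp e (fun i => map φ.toRingHom (g' i) * map φ.toRingHom (h' i))]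
    exact hf2

/-- The Hessian matrix of `f` evaluated at a point. -/
noncomputable def hessianAt {k κ : Type} [Field k] [Field κ] [Algebra k κ] {n : ℕ}
    (f : MvPolynomial (Fin n) k) (x : Fin n → κ) : Matrix (Fin n) (Fin n) κ :=
  Matrix.of fun i j => aeval x (pderiv i (pderiv j f))

theorem exists_projection_polySchmidtRank_le {k κ : Type} [Field k] [IsAlgClosed k] [Field κ]
    [Algebra k κ] {n d : ℕ} (hd : 3 ≤ d) (hchar : ¬ (ringChar k ∣ d * (d - 1)))
    {f : MvPolynomial (Fin n) k} (hhom : f.IsHomogeneous d) (x : Fin n → κ)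
    (hx : IntermediateField.adjoin k (Set.range x) = ⊤) :
    ∃ (S J : Finset (Fin n)) (E X : Matrix (Fin n) (Fin n) κ),
      IsTranscendenceBasis k (fun i : S => x i) ∧ 1 - E = X * hessianAt f x ∧
      (∀ i j, j ∉ J → E i j = 0) ∧
      polySchmidtRank f ≤ (d - 2) * ((n - S.card) + (n - J.card)) := by
  classical
  obtain ⟨S', hS', hsep⟩ := exists_isTranscendenceBasis_isSeparable_of_adjoin_range x hx
  obtain ⟨S, rfl⟩ := S'.toFinite.exists_finset_coe
  obtain ⟨J, E, X, hE, hX, hE0, hEJ⟩ := exists_kernel_projection (hessianAt f x)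
  have hchar' : ((d * (d - 1) : ℕ) : κ) ≠ 0 := by
    rw [← map_natCast (algebraMap k κ)]
    intro h
    exact hchar (ringChar.dvd ((map_eq_zero _).1 h))
  obtain ⟨m, g, h, hm, hg, hh, hsum⟩ := exists_map_eq_sum_mul hd hchar' hhom x S hS'.1 hsep J E
    (fun i l => congrFun (congrFun hE i) l) hEJ
  refine ⟨S, J, E, X, hS', hX, hE0, ?_⟩
  refine (polySchmidtRank_le_of_map_eq _ _ (fun i => Nat.sub_pos_of_lt (hm i).2)
    (fun i => (hm i).1) g h hg hh hsum).trans (le_of_eq ?_)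
  simp [Fintype.card_subtype_compl]

open IntermediateField.algebraAdjoinAdjoin in
theorem AlgebraicIndependent.natCard_le_of_algebraicallyClosed {k K ι γ : Type} [Field k] [Field K]
    [Algebra k K] [Finite γ] {y : ι → K} (hy : AlgebraicIndependent k y) (G : γ → K)
    (h : ∀ L : IntermediateField k K, (∀ g, G g ∈ L) → (∀ a : K, IsAlgebraic L a → a ∈ L) →
      ∀ i, y i ∈ L) : Nat.card ι ≤ Nat.card γ := by
  let F := IntermediateField.adjoin k (Set.range G)
  let L : IntermediateField k K := (algebraicClosure F K).restrictScalars k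
  have hL : ∀ i, y i ∈ L := by
    refine h L (fun g => ?_) (fun a ha => ?_)
    · change G g ∈ algebraicClosure F K
      rw [mem_algebraicClosure_iff]
      exact isAlgebraic_algebraMap (A := K)
        (⟨G g, IntermediateField.subset_adjoin _ _ ⟨g, rfl⟩⟩ : F)
    · change a ∈ algebraicClosure F K
      rw [mem_algebraicClosure_iff]
      have ha' : IsAlgebraic (algebraicClosure F K) a := ha
      exact ha'.restrictScalars F
  have hcl : Set.range y ⊆ (AlgebraicIndependent.matroid k K).closure (Set.range G) := by
    rw [AlgebraicIndependent.matroid_closure_eq]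
    rintro _ ⟨i, rfl⟩
    have h1 : IsAlgebraic F (y i) := mem_algebraicClosure_iff.1 (hL i)
    change IsAlgebraic (Algebra.adjoin k (Set.range G)) (y i)
    exact (IsFractionRing.isAlgebraic_iff (Algebra.adjoin k (Set.range G))
      (IntermediateField.adjoin k (Set.range G)) K).2 h1
  have hind : (AlgebraicIndependent.matroid k K).Indep (Set.range y) := by
    rw [AlgebraicIndependent.matroid_indep_iff]
    exact hy.coe_range
  have h1 := hind.encard_le_eRk_of_subset hcl
  rw [Matroid.eRk_closure_eq] at h1
  have h2 := h1.trans (Matroid.eRk_le_encard _ _)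
  have hinj : Function.Injective y := hy.injective
  have h3 : (Set.range y).encard = ENat.card ι := by
    rw [← Set.image_univ, hinj.encard_image, Set.encard_univ]
  have h4 : (Set.range G).encard ≤ ENat.card γ := by
    rw [← Set.image_univ, ← Set.encard_univ]; exact Set.encard_image_le _ _
  rw [h3] at h2
  have h5 := h2.trans h4
  have : Finite ι := by
    rw [← ENat.card_lt_top]
    exact h5.trans_lt (by rw [ENat.card_lt_top]; infer_instance)
  rw [ENat.card_eq_coe_natCard, ENat.card_eq_coe_natCard] at h5
  exact_mod_cast h5

theorem IntermediateField.adjoin_range_codRestrict_eq_top {k K ι : Type*} [Field k] [Field K]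
    [Algebra k K] (x : ι → K) :
    IntermediateField.adjoin k (Set.range fun i => (⟨x i, IntermediateField.subset_adjoin _ _ ⟨i,
        rfl⟩⟩ :
      IntermediateField.adjoin k (Set.range x))) = ⊤ := by
  apply IntermediateField.lift_injective
  rw [IntermediateField.lift_top, IntermediateField.lift_adjoin, ← Set.range_comp]
  rfl

theorem hessianAt_isSymm {k κ : Type} [Field k] [Field κ] [Algebra k κ] {n : ℕ}
    (f : MvPolynomial (Fin n) k) (x : Fin n → κ) : (hessianAt f x).transpose = hessianAt f x := by
  ext i j
  simp only [hessianAt, Matrix.transpose_apply, Matrix.of_apply]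
  rw [pderiv_pderiv_comm]

theorem exists_card_add_le_of_vecMul_eq_zero {k K : Type} [Field k] [IsAlgClosed k] [Field K]
    [Algebra k K] {n d s : ℕ} (hd : 3 ≤ d) (hchar : ¬ (ringChar k ∣ d * (d - 1)))
    {f : MvPolynomial (Fin n) k} (hhom : f.IsHomogeneous d) (V : Fin s → Fin n → K) (x : Fin n → K)
    (T : Finset (Fin n)) (hind : AlgebraicIndependent k
      (Sum.elim (fun i : T => x i) (fun q : Fin s × Fin n => V q.1 q.2)))
    (c : Fin s → K) (hc : c ≠ 0) (hcV : Matrix.vecMul c (Matrix.of V * hessianAt f x) = 0) :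
    ∃ a, polySchmidtRank f ≤ (d - 2) * a ∧ T.card + a + 1 ≤ n + s := by
  classical
  obtain ⟨i₀, hi₀⟩ : ∃ i, c i ≠ 0 := Function.ne_iff.1 hc
  obtain ⟨S, J, E, X, hS, hE, hEJ, hrk⟩ := exists_projection_polySchmidtRank_le hd hchar hhom
    (fun i => (⟨x i, IntermediateField.subset_adjoin _ _ ⟨i, rfl⟩⟩ :
      IntermediateField.adjoin k (Set.range x)))
          (IntermediateField.adjoin_range_codRestrict_eq_top x)
  refine ⟨_, hrk, ?_⟩
  set b : Fin s → K := (c i₀)⁻¹ • c with hb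
  have hb0 : b i₀ = 1 := by simp [hb, hi₀]
  set w : Fin n → K := Matrix.vecMul b (Matrix.of V) with hw
  have hwH : Matrix.mulVec (hessianAt f x) w = 0 := by
    rw [← Matrix.vecMul_transpose, hessianAt_isSymm, hw, Matrix.vecMul_vecMul, hb,
      Matrix.smul_vecMul, hcV, smul_zero]
  have hmap : (hessianAt f (fun i => (⟨x i, IntermediateField.subset_adjoin _ _ ⟨i, rfl⟩⟩ :
      IntermediateField.adjoin k (Set.range x)))).map (algebraMap _ K) = hessianAt f x := by
    ext i j
    simp only [hessianAt, Matrix.map_apply, Matrix.of_apply, ← aeval_algebraMap_apply]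
    rfl
  have hEw : ∀ i, w i = ∑ j ∈ J, (E i j : K) * w j := by
    have h1 := congrArg (fun M => Matrix.mulVec (M.map (algebraMap _ K)) w) hE
    simp only [Matrix.map_mul, hmap] at h1
    rw [← Matrix.mulVec_mulVec, hwH, Matrix.mulVec_zero, Matrix.map_sub _ (by simp),
      Matrix.map_one _ (by simp) (by simp), Matrix.sub_mulVec, Matrix.one_mulVec, sub_eq_zero] at h1
    intro i
    conv_lhs => rw [h1]
    simp only [Matrix.mulVec, dotProduct, Matrix.map_apply]
    symm
    apply Finset.sum_subset (Finset.subset_univ _)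
    intro j _ hj
    rw [hEJ i j hj]; simp
  have hVi₀ : ∀ j, V i₀ j = w j - ∑ i ∈ Finset.univ.erase i₀, b i * V i j := by
    intro j
    rw [eq_sub_iff_add_eq, hw]
    simp only [Matrix.vecMul, dotProduct, Matrix.of_apply]
    rw [← Finset.add_sum_erase _ _ (Finset.mem_univ i₀), hb0, one_mul]
  let G : (S ⊕ J) ⊕ ({i : Fin s // i ≠ i₀} ⊕ {i : Fin s // i ≠ i₀} × Fin n) → K :=
    Sum.elim (Sum.elim (fun i => x i) (fun j => w j)) (Sum.elim (fun i => b i) (fun q => V q.1 q.2))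
  have hcard := AlgebraicIndependent.natCard_le_of_algebraicallyClosed hind G (by
    intro L hGL hL
    have hxS : ∀ i ∈ S, x i ∈ L := fun i hi => hGL (.inl (.inl ⟨i, hi⟩))
    have hwJ : ∀ i ∈ J, w i ∈ L := fun i hi => hGL (.inl (.inr ⟨i, hi⟩))
    have hbL : ∀ i, i ≠ i₀ → b i ∈ L := fun i hi => hGL (.inr (.inl ⟨i, hi⟩))
    have hVL : ∀ i, i ≠ i₀ → ∀ j, V i j ∈ L := fun i hi j => hGL (.inr (.inr (⟨i, hi⟩, j)))
    have hκ : ∀ a : IntermediateField.adjoin k (Set.range x), (a : K) ∈ L := by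
      intro a
      apply hL
      have h1 := (hS.isAlgebraic).isAlgebraic a
      have h2 : ∀ z : Algebra.adjoin k (Set.range fun i : S =>
          (⟨x i, IntermediateField.subset_adjoin _ _ ⟨(i : Fin n), rfl⟩⟩ :
            IntermediateField.adjoin k (Set.range x))),
                ((z : IntermediateField.adjoin k (Set.range x)) : K) ∈ L := by
        rintro ⟨z, hz⟩
        change z ∈ L.toSubalgebra.comap (IntermediateField.adjoin k (Set.range x)).val
        refine Algebra.adjoin_le (S := L.toSubalgebra.comap _) ?_ hz
        rintro _ ⟨i, rfl⟩
        exact hxS i i.2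
      exact h1.ringHom_of_comp_eq
        (RingHom.codRestrict ((IntermediateField.adjoin k (Set.range x)).val.toRingHom.comp
          (Subalgebra.val _).toRingHom) L h2)
        ((IntermediateField.adjoin k (Set.range x)).val.toRingHom)
        (fun a b hab => Subtype.ext (Subtype.ext (congrArg (fun z : L => (z : K)) hab))) rfl
    have hwL : ∀ i, w i ∈ L := fun i => by
      rw [hEw]
      exact sum_mem fun j hj => mul_mem (hκ _) (hwJ j hj)
    have hV : ∀ i j, V i j ∈ L := by
      intro i j
      by_cases hi : i = i₀
      · subst hi
        rw [hVi₀]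
        exact sub_mem (hwL j) (sum_mem fun l hl =>
          mul_mem (hbL l (Finset.ne_of_mem_erase hl)) (hVL l (Finset.ne_of_mem_erase hl) j))
      · exact hVL i hi j
    rintro (i | q)
    · exact hκ ⟨x i, IntermediateField.subset_adjoin _ _ ⟨i, rfl⟩⟩
    · exact hV _ _)
  have hs : 0 < s := i₀.pos
  have hcs : Fintype.card {i : Fin s // i ≠ i₀} = s - 1 := by
    simp [Fintype.card_subtype_compl]
  simp only [Nat.card_eq_fintype_card, Fintype.card_sum, Fintype.card_prod, Fintype.card_fin,
    Fintype.card_coe, hcs] at hcard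
  obtain ⟨t, rfl⟩ : ∃ t, s = t + 1 := ⟨s - 1, by omega⟩
  have hSn : S.card ≤ n := by simpa using S.card_le_univ
  have hJn : J.card ≤ n := by simpa using J.card_le_univ
  simp only [Nat.add_sub_cancel, add_mul, one_mul] at hcard
  omega

theorem exists_generic_card_le {k : Type} [Field k] [IsAlgClosed k]
    {n d s : ℕ} (hd : 3 ≤ d) (hchar : ¬ (ringChar k ∣ d * (d - 1)))
    {f : MvPolynomial (Fin n) k} (hhom : f.IsHomogeneous d) (c₀ : ℕ)
    (hc₀ : ∀ a, polySchmidtRank f ≤ (d - 2) * a → c₀ ≤ a) :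
    ∃ h : MvPolynomial (Fin s × Fin n) k, h ≠ 0 ∧ ∀ v : Fin s → Fin n → k,
      eval (fun q => v q.1 q.2) h ≠ 0 → ∀ (K : Type) [Field K] [Algebra k K] (x : Fin n → K)
        (c : Fin s → K), c ≠ 0 →
        Matrix.vecMul c (Matrix.of (fun i j => algebraMap k K (v i j)) * hessianAt f x) = 0 →
        ∀ T : Finset (Fin n), AlgebraicIndependent k (fun i : T => x i) →
          T.card + c₀ + 1 ≤ n + s := by
  classical
  let M : Matrix (Fin s) (Fin n) (MvPolynomial (Fin n ⊕ (Fin s × Fin n)) k) :=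
    (Matrix.of (fun i j => X (Sum.inr (i, j))) : Matrix (Fin s) (Fin n)
        (MvPolynomial (Fin n ⊕ (Fin s × Fin n)) k)) *
      (Matrix.of (fun i j => rename Sum.inl (pderiv i (pderiv j f))) :
        Matrix (Fin n) (Fin n) (MvPolynomial (Fin n ⊕ (Fin s × Fin n)) k))
  let I : Ideal (MvPolynomial (Fin n ⊕ (Fin s × Fin n)) k) :=
    Ideal.span (Set.range fun e : Fin s → Fin n => (M.submatrix id e).det)
  have hM : ∀ (K : Type) [Field K] [Algebra k K] (V : Fin s → Fin n → K) (x : Fin n → K),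
      M.map (aeval (Sum.elim x (fun q => V q.1 q.2))) = Matrix.of V * hessianAt f x := by
    intro K _ _ V x
    ext i j
    simp only [M]
    rw [Matrix.map_apply, Matrix.mul_apply, Matrix.mul_apply, map_sum]
    simp only [Matrix.of_apply, map_mul, hessianAt, aeval_rename, aeval_X, Sum.elim_comp_inl,
      Sum.elim_inr]
  have hmin : ∀ (K : Type) [Field K] [Algebra k K] (V : Fin s → Fin n → K) (x : Fin n → K)
      (e : Fin s → Fin n), aeval (Sum.elim x (fun q => V q.1 q.2)) (M.submatrix id e).det =
        ((Matrix.of V * hessianAt f x).submatrix id e).det := by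
    intro K _ _ V x e
    rw [AlgHom.map_det, ← hM]
    rfl
  have key : ∀ T : Finset (Fin n), ∃ h : MvPolynomial (Fin s × Fin n) k, h ≠ 0 ∧
      ∀ v : Fin s → Fin n → k, eval (fun q => v q.1 q.2) h ≠ 0 →
        ∀ (K : Type) [Field K] [Algebra k K] (x : Fin n → K) (c : Fin s → K), c ≠ 0 →
        Matrix.vecMul c (Matrix.of (fun i j => algebraMap k K (v i j)) * hessianAt f x) = 0 →
        AlgebraicIndependent k (fun i : T => x i) → T.card + c₀ + 1 ≤ n + s := by
    intro T
    by_cases hp : ∃ p : MvPolynomial (T ⊕ (Fin s × Fin n)) k, p ≠ 0 ∧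
        rename (Sum.map Subtype.val id) p ∈ I
    · obtain ⟨p, hp0, hpI⟩ := hp
      have h1 : sumAlgEquiv k T (Fin s × Fin n) p ≠ 0 := by simpa using hp0
      obtain ⟨m, hm⟩ := ne_zero_iff.1 h1
      refine ⟨_, hm, fun v hv K _ _ x c hc hcv hx => ?_⟩
      exfalso
      have h2 : map (eval (fun q => v q.1 q.2)) (sumAlgEquiv k T (Fin s × Fin n) p) ≠ 0 :=
        ne_zero_iff.2 ⟨m, by rwa [coeff_map]⟩
      apply h2
      apply hx
      rw [map_zero]
      have h3 : ∀ g ∈ I, aeval (Sum.elim x (fun q : Fin s × Fin n =>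
          algebraMap k K (v q.1 q.2))) g = 0 := by
        intro g hg
        change g ∈ RingHom.ker (aeval (Sum.elim x (fun q : Fin s × Fin n =>
            algebraMap k K (v q.1 q.2))))
        revert g
        change I ≤ _
        rw [Ideal.span_le]
        rintro _ ⟨e, rfl⟩
        change aeval _ _ = 0
        rw [hmin K (fun i j => algebraMap k K (v i j)) x e, ← Matrix.exists_vecMul_eq_zero_iff]
        refine ⟨c, hc, ?_⟩
        ext j
        exact congrFun hcv (e j)
      have h4 := h3 _ hpI
      rw [aeval_rename] at h4
      rw [← h4]
      have : ((aeval fun i : T => x i).toRingHom.comp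
          (map (eval fun q : Fin s × Fin n => v q.1 q.2))).comp
          (sumAlgEquiv k T (Fin s × Fin n)).toAlgHom.toRingHom =
          (aeval (R := k) ((Sum.elim x fun q => (algebraMap k K) (v q.1 q.2)) ∘ Sum.map Subtype.val
              id)).toRingHom := by
        apply ringHom_ext
        · intro r
          simp
        · rintro (i | i) <;> simp
      exact RingHom.congr_fun this p
    · push Not at hp
      refine ⟨1, one_ne_zero, fun v _ K _ _ x c hc hcv hx => ?_⟩
      let φ : MvPolynomial (T ⊕ (Fin s × Fin n)) k →ₐ[k] MvPolynomial (Fin n ⊕ (Fin s × Fin n)) k :=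
        rename (Sum.map Subtype.val id)
      have hdis : Disjoint (I : Set (MvPolynomial (Fin n ⊕ (Fin s × Fin n)) k))
          ((nonZeroDivisors _).map φ : Submonoid _) := by
        rw [Set.disjoint_right]
        rintro _ ⟨p, hp', rfl⟩ hpI
        exact hp p (nonZeroDivisors.ne_zero hp') hpI
      obtain ⟨Q, hQ, hIQ, hQd⟩ := Ideal.exists_le_prime_disjoint I _ hdis
      let L := FractionRing (MvPolynomial (Fin n ⊕ (Fin s × Fin n)) k ⧸ Q)
      let ev : MvPolynomial (Fin n ⊕ (Fin s × Fin n)) k →ₐ[k] L :=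
        (IsScalarTower.toAlgHom k (MvPolynomial (Fin n ⊕ (Fin s × Fin n)) k ⧸ Q) L).comp
          (Ideal.Quotient.mkₐ k Q)
      have hev : ∀ g, ev g = 0 ↔ g ∈ Q := by
        intro g
        change algebraMap _ L (Ideal.Quotient.mk Q g) = 0 ↔ _
        rw [FaithfulSMul.algebraMap_eq_zero_iff, Ideal.Quotient.eq_zero_iff_mem]
      let y : Fin n → L := fun i => ev (X (Sum.inl i))
      let V : Fin s → Fin n → L := fun i j => ev (X (Sum.inr (i, j)))
      have hev' : ev = aeval (Sum.elim y (fun q => V q.1 q.2)) := by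
        apply algHom_ext
        rintro (i | i) <;> simp [y, V]
      have hind : AlgebraicIndependent k
          (Sum.elim (fun i : T => y i) (fun q : Fin s × Fin n => V q.1 q.2)) := by
        rw [algebraicIndependent_iff]
        intro p hp0
        by_contra hne
        refine Set.disjoint_right.1 hQd ⟨p, mem_nonZeroDivisors_of_ne_zero hne, rfl⟩ ?_
        change φ p ∈ Q
        rw [← hev, hev', aeval_rename, ← hp0]
        congr 2
        ext (i | i) <;> rfl
      obtain ⟨c', hc', hcV⟩ := exists_vecMul_eq_zero_of_minors (Matrix.of V * hessianAt f y) (by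
        intro e
        rw [← hmin L V y e, ← hev', hev]
        exact hIQ (Ideal.subset_span ⟨e, rfl⟩))
      obtain ⟨a, ha, hT⟩ := exists_card_add_le_of_vecMul_eq_zero hd hchar hhom V y T hind c' hc' hcV
      have := hc₀ a ha
      omega
  choose h hh0 hh using key
  refine ⟨∏ T, h T, Finset.prod_ne_zero_iff.2 fun T _ => hh0 T, fun v hv K _ _ x c hc hcv T hT =>
      ?_⟩
  refine hh T v ?_ K x c hc hcv hT
  rw [map_prod] at hv
  exact Finset.prod_ne_zero_iff.1 hv T (Finset.mem_univ _)

/-- The transcendence degree of the coordinate ring modulo a prime ideal. -/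
noncomputable def coordTrdeg {k : Type} [Field k] {n : ℕ}
    (P : Ideal (MvPolynomial (Fin n) k)) : ℕ :=
  Cardinal.toNat (Algebra.trdeg k (MvPolynomial (Fin n) k ⧸ P))

theorem cast_coordTrdeg {k : Type} [Field k] {n : ℕ} (P : Ideal (MvPolynomial (Fin n) k)) :
    (coordTrdeg P : Cardinal) = Algebra.trdeg k (MvPolynomial (Fin n) k ⧸ P) :=
  Cardinal.cast_toNat_of_lt_aleph0 _root_.trdeg_lt_aleph0_of_finiteType

theorem coordTrdeg_anti {k : Type} [Field k] {n : ℕ} {P Q : Ideal (MvPolynomial (Fin n) k)}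
    (h : P ≤ Q) : coordTrdeg Q ≤ coordTrdeg P := by
  have : (coordTrdeg Q : Cardinal) ≤ coordTrdeg P := by
    rw [cast_coordTrdeg, cast_coordTrdeg]
    exact _root_.trdeg_le_of_surjective (Ideal.Quotient.factorₐ k h)
      (Ideal.Quotient.factor_surjective h)
  exact_mod_cast this

theorem coordTrdeg_lt {k : Type} [Field k] {n : ℕ} {P Q : Ideal (MvPolynomial (Fin n) k)}
    [P.IsPrime] [Q.IsPrime] (h : P < Q) : coordTrdeg Q < coordTrdeg P := by
  refine lt_of_le_of_ne (coordTrdeg_anti h.le) fun heq => ?_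
  have heq' : Algebra.trdeg k (MvPolynomial (Fin n) k ⧸ Q) =
      Algebra.trdeg k (MvPolynomial (Fin n) k ⧸ P) := by
    rw [← cast_coordTrdeg, ← cast_coordTrdeg, heq]
  obtain ⟨t, ht⟩ := exists_isTranscendenceBasis k (MvPolynomial (Fin n) k ⧸ Q)
  have hfin : Finite t := by
    rw [← Cardinal.mk_lt_aleph0_iff, ht.cardinalMk_eq_trdeg]
    exact _root_.trdeg_lt_aleph0_of_finiteType
  obtain ⟨p, hpQ, hpP⟩ := Set.exists_of_ssubset h
  have hsurj := Ideal.Quotient.factor_surjective h.le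
  choose g hg using hsurj
  let y : t → MvPolynomial (Fin n) k ⧸ P := fun i => g i
  have hy' : ∀ q : MvPolynomial t k,
      Ideal.Quotient.factorₐ k h.le (aeval y q) = aeval (fun i : t =>
          (i : MvPolynomial (Fin n) k ⧸ Q)) q := by
    intro q
    rw [← AlgHom.comp_apply, comp_aeval]
    congr 2
    ext i
    exact hg i
  have hy : AlgebraicIndependent k y := by
    refine AlgebraicIndependent.of_comp (Ideal.Quotient.factorₐ k h.le) ?_
    have : (Ideal.Quotient.factorₐ k h.le) ∘ y = fun i : t => (i : MvPolynomial (Fin n) k ⧸ Q) :=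
      funext fun i => hg i
    rw [this]
    exact ht.1
  have hbasis : IsTranscendenceBasis k y :=
    hy.isTranscendenceBasis_of_trdeg_le_of_finite (by rw [← heq', ht.cardinalMk_eq_trdeg])
  have halg := hbasis.isAlgebraic.isAlgebraic (Ideal.Quotient.mk P p)
  have h0 : Ideal.Quotient.mk P p ≠ 0 := by rwa [Ne, Ideal.Quotient.eq_zero_iff_mem]
  have hne := Ideal.comap_ne_bot_of_algebraic_mem (I := RingHom.ker (Ideal.Quotient.factor h.le)) h0
    (by
      change Ideal.Quotient.factor h.le (Ideal.Quotient.mk P p) = 0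
      rw [Ideal.Quotient.factor_mk, Ideal.Quotient.eq_zero_iff_mem]
      exact hpQ) halg
  obtain ⟨c, hc, hc0⟩ := Submodule.exists_mem_ne_zero_of_ne_bot hne
  obtain ⟨c, hcA⟩ := c
  obtain ⟨q, rfl⟩ : ∃ q, aeval y q = c := by
    have := hcA
    rwa [Algebra.adjoin_range_eq_range_aeval] at this
  apply hc0
  have hc' : Ideal.Quotient.factorₐ k h.le (aeval y q) = 0 := hc
  rw [hy'] at hc'
  have hq : q = 0 := (algebraicIndependent_iff.1 ht.1) q hc'
  ext
  simp [hq]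

theorem ringKrullDim_le_of_forall_coordTrdeg_le {k B : Type} [Field k] [CommRing B] {n : ℕ}
    (φ : MvPolynomial (Fin n) k →+* B) (hφ : ∀ b : B, ∃ p q, IsUnit (φ q) ∧ b * φ q = φ p) (m : ℕ)
    (hm : ∀ P : Ideal B, P.IsPrime → coordTrdeg (P.comap φ) ≤ m) : ringKrullDim B ≤ m := by
  have hinj : ∀ P Q : Ideal B, P.comap φ ≤ Q.comap φ → P ≤ Q := by
    intro P Q h b hb
    obtain ⟨p, q, hq, hbq⟩ := hφ b
    have : p ∈ P.comap φ := by rw [Ideal.mem_comap, ← hbq]; exact Ideal.mul_mem_right _ _ hb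
    have h2 := h this
    rw [Ideal.mem_comap, ← hbq] at h2
    exact (Ideal.mul_unit_mem_iff_mem _ hq).1 h2
  let g : PrimeSpectrum B → (Fin (m + 1))ᵒᵈ := fun P =>
    OrderDual.toDual ⟨coordTrdeg (P.asIdeal.comap φ), Nat.lt_succ_of_le (hm _ P.2)⟩
  have hg : StrictMono g := by
    intro P Q hPQ
    rw [OrderDual.toDual_lt_toDual, Fin.mk_lt_mk]
    apply coordTrdeg_lt
    exact lt_of_le_not_ge (Ideal.comap_mono hPQ.le) fun h => hPQ.not_ge (hinj _ _ h)
  refine (Order.krullDim_le_of_strictMono g hg).trans ?_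
  rw [Order.krullDim_orderDual]
  refine iSup_le fun p => ?_
  have := p.length_lt_card
  rw [Fintype.card_fin] at this
  exact_mod_cast Nat.le_of_lt_succ this

theorem coordTrdeg_ker_eq {k κ : Type} [Field k] [Field κ] [Algebra k κ] {n : ℕ}
    (ψ : MvPolynomial (Fin n) k →ₐ[k] κ) (T : Finset (Fin n))
    (hT : IsTranscendenceBasis k (fun i : T => ψ (X i))) :
    coordTrdeg (RingHom.ker ψ) = T.card := by
  apply le_antisymm
  · have : (coordTrdeg (RingHom.ker ψ) : Cardinal) ≤ T.card := by
      rw [cast_coordTrdeg]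
      refine (_root_.trdeg_le_of_injective (Ideal.kerLiftAlg ψ)
          (Ideal.kerLiftAlg_injective ψ)).trans ?_
      rw [← hT.cardinalMk_eq_trdeg]
      simp
    exact_mod_cast this
  · have : (T.card : Cardinal) ≤ coordTrdeg (RingHom.ker ψ) := by
      rw [cast_coordTrdeg]
      have h1 : AlgebraicIndependent k (fun i : T => Ideal.Quotient.mk (RingHom.ker ψ)
          (X (i : Fin n))) :=
        AlgebraicIndependent.of_comp (Ideal.kerLiftAlg ψ) hT.1
      simpa using h1.cardinalMk_le_trdeg
    exact_mod_cast this

/-- `P` is an associated prime of the quotient of the ring by the ideal `I`. -/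
def Ideal.IsAssociatedTo {A : Type*} [CommRing A] (P I : Ideal A) : Prop :=
  P.IsPrime ∧ ∃ m, ∀ a, a ∈ P ↔ a * m ∈ I

/-- `x` is a non-zero-divisor modulo the ideal `I`. -/
def Ideal.IsRegularMod {A : Type*} [CommRing A] (I : Ideal A) (x : A) : Prop :=
  ∀ a, x * a ∈ I → a ∈ I

theorem Ideal.isAssociatedTo_iff {A : Type*} [CommRing A] [IsNoetherianRing A] {P I : Ideal A} :
    P.IsAssociatedTo I ↔ P ∈ associatedPrimes A (A ⧸ I) := by
  rw [AssociatedPrimes.mem_iff, isAssociatedPrime_iff, Ideal.IsAssociatedTo]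
  refine and_congr_right fun _ => ?_
  have key : ∀ m : A, (P = (⊥ : Submodule A (A ⧸ I)).colon {Ideal.Quotient.mk I m}) ↔
      ∀ a, a ∈ P ↔ a * m ∈ I := by
    intro m
    rw [SetLike.ext_iff]
    refine forall_congr' fun a => ?_
    rw [Submodule.mem_colon_singleton, Submodule.mem_bot, Algebra.smul_def,
      Ideal.Quotient.algebraMap_eq, ← map_mul, Ideal.Quotient.eq_zero_iff_mem]
  constructor
  · rintro ⟨m, hm⟩
    exact ⟨_, (key m).2 hm⟩
  · rintro ⟨x, hx⟩
    obtain ⟨m, rfl⟩ := Ideal.Quotient.mk_surjective x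
    exact ⟨m, (key m).1 hx⟩

theorem Ideal.IsAssociatedTo.le {A : Type*} [CommRing A] {P I : Ideal A}
    (h : P.IsAssociatedTo I) : I ≤ P := by
  obtain ⟨_, m, hm⟩ := h
  exact fun a ha => (hm a).2 (I.mul_mem_right m ha)

theorem Ideal.exists_isAssociatedTo {A : Type*} [CommRing A] [IsNoetherianRing A] {I : Ideal A}
    {m : A} (hm : m ∉ I) : ∃ P : Ideal A, P.IsAssociatedTo I ∧ ∀ a, a * m ∈ I → a ∈ P := by
  obtain ⟨P, hP, hle⟩ := exists_le_isAssociatedPrime_of_isNoetherianRing A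
    (Ideal.Quotient.mk I m) (by rwa [Ne, Ideal.Quotient.eq_zero_iff_mem])
  refine ⟨P, Ideal.isAssociatedTo_iff.2 hP, fun a ha => hle ?_⟩
  rwa [Submodule.mem_colon_singleton, Submodule.mem_bot, Algebra.smul_def,
      Ideal.Quotient.algebraMap_eq, ← map_mul, Ideal.Quotient.eq_zero_iff_mem]

theorem Ideal.IsRegularMod.notMem_of_isAssociatedTo {A : Type*} [CommRing A] {P I : Ideal A}
    {x : A} (hx : I.IsRegularMod x) (h : P.IsAssociatedTo I) : x ∉ P := by
  obtain ⟨hP, m, hm⟩ := h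
  intro hxP
  have := hx m ((hm x).1 hxP)
  exact hP.ne_top ((Ideal.eq_top_iff_one _).2 ((hm 1).2 (by rwa [one_mul])))

theorem Ideal.exists_isAssociatedTo_of_not_isRegularMod {A : Type*} [CommRing A]
    [IsNoetherianRing A] {I : Ideal A} {x : A} (hx : ¬ I.IsRegularMod x) :
    ∃ P : Ideal A, P.IsAssociatedTo I ∧ x ∈ P := by
  simp only [Ideal.IsRegularMod, not_forall] at hx
  obtain ⟨m, hm, hmI⟩ := hx
  obtain ⟨P, hP, h⟩ := Ideal.exists_isAssociatedTo hmI
  exact ⟨P, hP, h x hm⟩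

/-- Prime avoidance: an ideal contained in no associated prime of finitely many given ideals
contains an element regular modulo all of them. -/
theorem Ideal.exists_isRegularMod {A : Type*} [CommRing A] [IsNoetherianRing A] (J : Ideal A)
    {ι : Type*} [Finite ι] (I : ι → Ideal A)
    (h : ∀ i, ∀ P : Ideal A, P.IsAssociatedTo (I i) → ¬ J ≤ P) :
    ∃ z ∈ J, ∀ i, (I i).IsRegularMod z := by
  have hfin : (⋃ i, associatedPrimes A (A ⧸ I i)).Finite :=
    Set.finite_iUnion fun i => associatedPrimes.finite A _
  by_contra hcon
  push Not at hcon
  have hsub : (J : Set A) ⊆ ⋃ P ∈ (hfin.toFinset : Set (Ideal A)), (P : Set A) := by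
    intro z hz
    obtain ⟨i, hi⟩ := hcon z hz
    obtain ⟨P, hP, hzP⟩ := Ideal.exists_isAssociatedTo_of_not_isRegularMod hi
    simp only [Set.Finite.coe_toFinset, Set.mem_iUnion]
    exact ⟨P, ⟨i, Ideal.isAssociatedTo_iff.1 hP⟩, hzP⟩
  obtain ⟨P, hP, hle⟩ := (Ideal.subset_union_prime (f := fun P : Ideal A => P) ⊤ ⊤ (by
    intro P hP _ _
    simp only [Set.Finite.mem_toFinset, Set.mem_iUnion] at hP
    obtain ⟨i, hi⟩ := hP
    exact hi.1)).1 hsub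
  simp only [Set.Finite.mem_toFinset, Set.mem_iUnion] at hP
  obtain ⟨i, hi⟩ := hP
  exact h i P (Ideal.isAssociatedTo_iff.2 hi) hle

/-- The quotient of a local ring by `I` admits a regular sequence of length `r`. -/
def Ideal.HasDepth {A : Type*} [CommRing A] [IsLocalRing A] : ℕ → Ideal A → Prop
  | 0, _ => True
  | r + 1, I => ∃ x ∈ IsLocalRing.maximalIdeal A, I.IsRegularMod x ∧
      Ideal.HasDepth r (I ⊔ Ideal.span {x})

theorem Ideal.mem_sup_span_singleton' {A : Type*} [CommRing A] {I : Ideal A} {x a : A} :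
    a ∈ I ⊔ Ideal.span {x} ↔ ∃ c, a - c * x ∈ I := by
  constructor
  · intro h
    obtain ⟨i, hi, y, hy, rfl⟩ := Submodule.mem_sup.1 h
    obtain ⟨c, rfl⟩ := Ideal.mem_span_singleton'.1 hy
    exact ⟨c, by simpa using hi⟩
  · rintro ⟨c, hc⟩
    have := (I ⊔ Ideal.span {x}).add_mem (Ideal.mem_sup_left hc)
      (Ideal.mem_sup_right (Ideal.mem_span_singleton'.2 ⟨c, rfl⟩))
    simpa using this

/-- Depth bounds the dimension of every associated prime. -/
theorem Ideal.HasDepth.le_ringKrullDim {A : Type*} [CommRing A] [IsNoetherianRing A]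
    [IsLocalRing A] {r : ℕ} {I P : Ideal A} (h : I.HasDepth r) (hP : P.IsAssociatedTo I) :
    (r : WithBot ℕ∞) ≤ ringKrullDim (A ⧸ P) := by
  induction r generalizing I P with
  | zero =>
    have := hP.1
    simpa using ringKrullDim_nonneg_of_nontrivial
  | succ r ih =>
    obtain ⟨x, hxm, hx, hd⟩ := h
    have hxP := hx.notMem_of_isAssociatedTo hP
    obtain ⟨hPp, m, hm⟩ := hP
    -- an element annihilated by `P` modulo `I` that survives modulo `I + (x)`
    obtain ⟨b, hb, hbI⟩ : ∃ b, (∀ a ∈ P, a * b ∈ I) ∧ b ∉ I ⊔ Ideal.span {x} := by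
      by_contra hcon
      push Not at hcon
      let N : Ideal A :=
        { carrier := {b | ∀ a ∈ P, a * b ∈ I}
          add_mem' := fun {u w} hu hw a ha => by
            rw [mul_add]; exact I.add_mem (hu a ha) (hw a ha)
          zero_mem' := fun a _ => by simp
          smul_mem' := fun c w hw a ha => by
            rw [smul_eq_mul, mul_left_comm]; exact I.mul_mem_left _ (hw a ha) }
      have hN : N ≤ I ⊔ IsLocalRing.maximalIdeal A • N := by
        intro b hb
        obtain ⟨c, hc⟩ := Ideal.mem_sup_span_singleton'.1 (hcon b hb)
        have hcN : c ∈ N := by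
          intro a ha
          refine hx _ ?_
          have h1 := I.sub_mem (hb a ha) (I.mul_mem_left a hc)
          convert h1 using 1
          ring
        have : b = (b - c * x) + x • c := by rw [smul_eq_mul]; ring
        rw [this]
        exact Submodule.add_mem_sup hc (Submodule.smul_mem_smul hxm hcN)
      have hNI : N ≤ I :=
        Submodule.le_of_le_smul_of_le_jacobson_bot (IsNoetherian.noetherian N)
          (IsLocalRing.maximalIdeal_le_jacobson _) hN
      have : m ∈ I := hNI fun a ha => (hm a).1 ha
      exact hPp.ne_top ((Ideal.eq_top_iff_one _).2 ((hm 1).2 (by rwa [one_mul])))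
    obtain ⟨Q, hQ, hQb⟩ := Ideal.exists_isAssociatedTo hbI
    have hPQ : P ≤ Q := fun a ha => hQb a (Ideal.mem_sup_left (hb a ha))
    have hxQ : x ∈ Q := hQ.le (Ideal.mem_sup_right (Ideal.mem_span_singleton_self x))
    have h1 := ih hd hQ
    have h2 : ringKrullDim (A ⧸ Q) + 1 ≤ ringKrullDim (A ⧸ P) :=
      ringKrullDim_succ_le_of_surjective (Ideal.Quotient.factor hPQ)
        (Ideal.Quotient.factor_surjective hPQ) (r := Ideal.Quotient.mk P x)
        (mem_nonZeroDivisors_of_ne_zero (by rwa [Ne, Ideal.Quotient.eq_zero_iff_mem]))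
        (by rwa [Ideal.Quotient.factor_mk, Ideal.Quotient.eq_zero_iff_mem])
    push_cast
    exact (add_le_add_left h1 1).trans h2

theorem Ideal.IsRegularMod.symm {A : Type*} [CommRing A] {I : Ideal A} {y z : A}
    (hy : I.IsRegularMod y) (hzy : (I ⊔ Ideal.span {y}).IsRegularMod z) :
    (I ⊔ Ideal.span {z}).IsRegularMod y := by
  intro a ha
  obtain ⟨b, hb⟩ := Ideal.mem_sup_span_singleton'.1 ha
  have hb' : b ∈ I ⊔ Ideal.span {y} := hzy b (Ideal.mem_sup_span_singleton'.2 ⟨a, by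
    convert I.neg_mem hb using 1; ring⟩)
  obtain ⟨c, hc⟩ := Ideal.mem_sup_span_singleton'.1 hb'
  refine Ideal.mem_sup_span_singleton'.2 ⟨c, hy _ ?_⟩
  convert I.add_mem hb (I.mul_mem_left z hc) using 1
  ring

theorem Ideal.not_isAssociatedTo_of_isRegularMod {A : Type*} [CommRing A] [IsLocalRing A]
    {I : Ideal A} {x : A} (hx : I.IsRegularMod x) (hxm : x ∈ IsLocalRing.maximalIdeal A) :
    ¬ (IsLocalRing.maximalIdeal A).IsAssociatedTo I :=
  fun h => hx.notMem_of_isAssociatedTo h hxm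

/-- The depth drops by at most one modulo a regular element. -/
theorem Ideal.HasDepth.sup_span_singleton {A : Type*} [CommRing A] [IsNoetherianRing A]
    [IsLocalRing A] {r : ℕ} {I : Ideal A} (h : I.HasDepth (r + 1)) {x : A}
    (hxm : x ∈ IsLocalRing.maximalIdeal A) (hx : I.IsRegularMod x) :
    (I ⊔ Ideal.span {x}).HasDepth r := by
  induction r generalizing I x with
  | zero => trivial
  | succ r ih =>
    obtain ⟨y, hym, hy, hd⟩ := h
    have hmy : ¬ (IsLocalRing.maximalIdeal A).IsAssociatedTo (I ⊔ Ideal.span {y}) := by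
      obtain ⟨w, hwm, hw, -⟩ := hd
      exact Ideal.not_isAssociatedTo_of_isRegularMod hw hwm
    have hmx : ¬ (IsLocalRing.maximalIdeal A).IsAssociatedTo (I ⊔ Ideal.span {x}) := by
      rintro ⟨-, a, ha⟩
      obtain ⟨b, hb⟩ := Ideal.mem_sup_span_singleton'.1 ((ha y).1 hym)
      refine hmy ⟨IsLocalRing.maximalIdeal.isMaximal A |>.isPrime, b, fun w => ⟨fun hw => ?_,
          fun hw => ?_⟩⟩
      · obtain ⟨c, hc⟩ := Ideal.mem_sup_span_singleton'.1 ((ha w).1 hw)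
        refine Ideal.mem_sup_span_singleton'.2 ⟨c, hx _ ?_⟩
        convert I.sub_mem (I.mul_mem_left y hc) (I.mul_mem_left w hb) using 1
        ring
      · by_contra hwm
        obtain ⟨u, rfl⟩ : IsUnit w := by
          simpa [IsLocalRing.mem_maximalIdeal, mem_nonunits_iff] using hwm
        have hb2 : b ∈ I ⊔ Ideal.span {y} := by
          simpa using (I ⊔ Ideal.span {y}).mul_mem_left (↑u⁻¹ : A) hw
        obtain ⟨c, hc⟩ := Ideal.mem_sup_span_singleton'.1 hb2
        have hax : a ∈ I ⊔ Ideal.span {x} := by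
          refine Ideal.mem_sup_span_singleton'.2 ⟨c, hy _ ?_⟩
          convert I.add_mem hb (I.mul_mem_left x hc) using 1
          ring
        exact (Ideal.ne_top_iff_one _).1 (IsLocalRing.maximalIdeal.isMaximal A).ne_top
          ((ha 1).2 (by rwa [one_mul]))
    obtain ⟨z, hzm, hz⟩ := Ideal.exists_isRegularMod (IsLocalRing.maximalIdeal A)
      ![I ⊔ Ideal.span {x}, I ⊔ Ideal.span {y}] (by
        intro i P hP hle
        obtain rfl := (IsLocalRing.maximalIdeal.isMaximal A).eq_of_le hP.1.ne_top hle
        revert hP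
        fin_cases i
        · exact hmx
        · exact hmy)
    have hz1 : (I ⊔ Ideal.span {x}).IsRegularMod z := hz 0
    have hz2 : (I ⊔ Ideal.span {y}).IsRegularMod z := hz 1
    have h1 := ih hd hzm hz2
    rw [sup_right_comm] at h1
    have h2 : (I ⊔ Ideal.span {z}).HasDepth (r + 1) := ⟨y, hym, hy.symm hz2, h1⟩
    have h3 := ih h2 hxm (hx.symm hz1)
    rw [sup_right_comm] at h3
    exact ⟨z, hzm, hz1, h3⟩

theorem Ideal.HasDepth.sup_span_range {A : Type*} [CommRing A] [IsNoetherianRing A]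
    [IsLocalRing A] {r s : ℕ} {I : Ideal A} (h : I.HasDepth (r + s)) (F : Fin s → A)
    (hF : ∀ i, F i ∈ IsLocalRing.maximalIdeal A)
    (hdim : ringKrullDim (A ⧸ I ⊔ Ideal.span (Set.range F)) ≤ r) :
    (I ⊔ Ideal.span (Set.range F)).HasDepth r := by
  induction s generalizing I with
  | zero =>
    rwa [Set.range_eq_empty, Ideal.span_empty, sup_bot_eq]
  | succ s ih =>
    have hsplit : I ⊔ Ideal.span (Set.range F) =
        I ⊔ Ideal.span {F 0} ⊔ Ideal.span (Set.range fun i : Fin s => F i.succ) := by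
      rw [sup_assoc, ← Ideal.span_union]
      congr 2
      ext a
      simp only [Set.mem_range, Fin.exists_fin_succ, Set.singleton_union, Set.mem_insert_iff]
      rw [eq_comm]
    rw [hsplit] at hdim ⊢
    refine ih (Ideal.HasDepth.sup_span_singleton (r := r + s) h (hF 0) ?_) _ (fun i => hF _) hdim
    by_contra hreg
    obtain ⟨P, hP, h0⟩ := Ideal.exists_isAssociatedTo_of_not_isRegularMod hreg
    have h1 := h.le_ringKrullDim hP
    have hPp := hP.1
    classical
    have h2 := ringKrullDim_le_ringKrullDim_quotient_add_card
      (R := A ⧸ P) (Finset.univ.image fun i : Fin s => Ideal.Quotient.mk P (F i.succ)) (by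
        intro y hy
        simp only [Finset.coe_image, Set.mem_image] at hy
        obtain ⟨i, -, rfl⟩ := hy
        have : Nontrivial (A ⧸ P) := Ideal.Quotient.nontrivial_iff.2 hPp.ne_top
        have := IsLocalRing.of_surjective' (Ideal.Quotient.mk P) Ideal.Quotient.mk_surjective
        rw [SetLike.mem_coe, IsLocalRing.ringJacobson_eq_maximalIdeal]
        have hloc : IsLocalHom (Ideal.Quotient.mk P) :=
          IsLocalHom.of_surjective _ Ideal.Quotient.mk_surjective
        exact (map_mem_nonunits_iff _ _).2 (hF _))
    have h3 : ringKrullDim ((A ⧸ P) ⧸ Ideal.span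
        ((Finset.univ.image fun i : Fin s => Ideal.Quotient.mk P (F i.succ) : Finset (A ⧸ P)) :
            Set (A ⧸ P)))
        ≤ r := by
      refine le_trans ?_ hdim
      have hJ : Ideal.span
        ((Finset.univ.image fun i : Fin s => Ideal.Quotient.mk P (F i.succ) : Finset (A ⧸ P)) :
            Set (A ⧸ P))
        = (Ideal.span (Set.range fun i : Fin s => F i.succ)).map (Ideal.Quotient.mk P) := by
        rw [Ideal.map_span, Finset.coe_image, Finset.coe_univ, Set.image_univ, ← Set.range_comp]
        rfl
      rw [hJ, ringKrullDim_eq_of_ringEquiv (DoubleQuot.quotQuotEquivQuotSup _ _)]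
      refine ringKrullDim_le_of_surjective (Ideal.Quotient.factor ?_)
          (Ideal.Quotient.factor_surjective ?_)
      all_goals
        refine sup_le_sup_right (sup_le hP.le ?_) _
        rw [Ideal.span_le]
        simpa using h0
    have h4 : (Finset.univ.image fun i : Fin s => Ideal.Quotient.mk P (F i.succ)).card ≤ s :=
      Finset.card_image_le.trans (by simp)
    have h5 : ((r + (s + 1) : ℕ) : WithBot ℕ∞) ≤ ((r + s : ℕ) : WithBot ℕ∞) := by
      refine h1.trans (h2.trans ?_)
      push_cast
      exact add_le_add h3 (by exact_mod_cast h4)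
    have : r + (s + 1) ≤ r + s := by exact_mod_cast h5
    omega

theorem span_X_sub_C_eq_ker {k : Type} [Field k] {n : ℕ} (a : Fin n → k)
    (S : Finset (Fin n)) :
    Ideal.span ((fun j => X j - C (a j)) '' (S : Set (Fin n))) =
      RingHom.ker (aeval (fun j => if j ∈ S then C (a j) else X j) :
        MvPolynomial (Fin n) k →ₐ[k] MvPolynomial (Fin n) k) := by
  apply le_antisymm
  · rw [Ideal.span_le]
    rintro _ ⟨j, hj, rfl⟩
    have hj' : j ∈ S := hj
    simp [RingHom.mem_ker, hj', algebraMap_eq]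
  · intro p hp
    have hcomp : (Ideal.Quotient.mkₐ k
        (Ideal.span ((fun j => X j - C (a j)) '' (S : Set (Fin n)))) :
          MvPolynomial (Fin n) k →ₐ[k] _).comp
        (aeval (fun j => if j ∈ S then C (a j) else X j)) = Ideal.Quotient.mkₐ k _ := by
      refine algHom_ext fun j => ?_
      rw [AlgHom.comp_apply, aeval_X]
      split_ifs with hj
      · rw [eq_comm, Ideal.Quotient.mkₐ_eq_mk, Ideal.Quotient.eq]
        exact Ideal.subset_span ⟨j, hj, rfl⟩
      · rfl
    have := DFunLike.congr_fun hcomp p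
    rw [AlgHom.comp_apply, (RingHom.mem_ker).1 hp, map_zero, Ideal.Quotient.mkₐ_eq_mk] at this
    exact Ideal.Quotient.eq_zero_iff_mem.1 this.symm

/-- The local rings of affine space at closed points have depth at least `n`. -/
theorem hasDepth_bot_localization {k : Type} [Field k] [IsAlgClosed k] {n : ℕ}
    (M : Ideal (MvPolynomial (Fin n) k)) [hM : M.IsMaximal] :
    (⊥ : Ideal (Localization.AtPrime M)).HasDepth n := by
  obtain ⟨a, ha⟩ := isMaximal_iff_eq_vanishingIdeal_singleton.1 hM
  have hmemM : ∀ j, (X j - C (a j) : MvPolynomial (Fin n) k) ∈ M := by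
    intro j
    rw [ha, mem_vanishingIdeal_singleton_iff]
    simp
  have key : ∀ (r : ℕ) (S : Finset (Fin n)), S.card + r = n →
      ((Ideal.span ((fun j => X j - C (a j)) '' (S : Set (Fin n)))).map
        (algebraMap (MvPolynomial (Fin n) k) (Localization.AtPrime M))).HasDepth r := by
    intro r
    induction r with
    | zero => intro S _; trivial
    | succ r ih =>
      intro S hS
      obtain ⟨i, hi⟩ : ∃ i, i ∉ S := by
        by_contra hcon
        push Not at hcon
        have : S.card = n := by rw [Finset.eq_univ_iff_forall.2 hcon]; simp
        omega
      have hprime : (Ideal.span ((fun j => (X j - C (a j) : MvPolynomial (Fin n) k)) ''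
          (S : Set (Fin n)))).IsPrime := by
        rw [span_X_sub_C_eq_ker]
        exact RingHom.ker_isPrime _
      have hle : Ideal.span ((fun j => (X j - C (a j) : MvPolynomial (Fin n) k)) ''
          (S : Set (Fin n))) ≤ M := by
        rw [Ideal.span_le]
        rintro _ ⟨j, -, rfl⟩
        exact hmemM j
      have hdisj : Disjoint (M.primeCompl : Set (MvPolynomial (Fin n) k))
          (Ideal.span ((fun j => (X j - C (a j) : MvPolynomial (Fin n) k)) '' (S : Set (Fin n))) :
              Set (MvPolynomial (Fin n) k)) :=
        Set.disjoint_left.2 fun x hx hx' => hx (hle hx')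
      refine ⟨algebraMap _ _ (X i - C (a i)), ?_, ?_, ?_⟩
      · exact (IsLocalization.AtPrime.to_map_mem_maximal_iff _ M _).2 (hmemM i)
      · have hp' := IsLocalization.isPrime_of_isPrime_disjoint M.primeCompl
          (Localization.AtPrime M) _ hprime hdisj
        intro b hb
        refine (hp'.mem_or_mem hb).resolve_left fun hcon => ?_
        have h1 : (X i - C (a i) : MvPolynomial (Fin n) k) ∈ Ideal.span ((fun j => (X j - C (a j) :
            MvPolynomial (Fin n) k)) '' (S : Set (Fin n))) := by
          rw [← IsLocalization.under_map_of_isPrime_disjoint M.primeCompl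
            (Localization.AtPrime M) hprime hdisj]
          exact hcon
        rw [span_X_sub_C_eq_ker, RingHom.mem_ker] at h1
        simp only [map_sub, aeval_X, hi, if_false, aeval_C, algebraMap_eq] at h1
        have h2 := congrArg (coeff (Finsupp.single i 1)) h1
        have h3 : (0 : Fin n →₀ ℕ) ≠ Finsupp.single i 1 := by
          intro h
          have := DFunLike.congr_fun h i
          simp at this
        simp [coeff_C, coeff_X, h3] at h2
      · have := ih (insert i S) (by rw [Finset.card_insert_of_notMem hi]; omega)
        rwa [Finset.coe_insert, Set.image_insert_eq, Ideal.span_insert, Ideal.map_sup,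
          Ideal.map_span, Set.image_singleton, sup_comm] at this
  have := key n ∅ (by simp)
  simpa using this

theorem exists_isUnit_mul_eq_of_isLocalization {R : Type*} [CommRing R] (M : Ideal R) [M.IsPrime]
    (J : Ideal (Localization.AtPrime M)) (b : Localization.AtPrime M ⧸ J) :
    ∃ p q, IsUnit ((Ideal.Quotient.mk J).comp (algebraMap R (Localization.AtPrime M)) q) ∧
      b * (Ideal.Quotient.mk J).comp (algebraMap R (Localization.AtPrime M)) q =
        (Ideal.Quotient.mk J).comp (algebraMap R (Localization.AtPrime M)) p := by
  obtain ⟨b, rfl⟩ := Ideal.Quotient.mk_surjective b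
  obtain ⟨⟨p, q⟩, h⟩ := IsLocalization.surj M.primeCompl b
  refine ⟨p, q, ?_, ?_⟩
  · exact (IsLocalization.map_units (Localization.AtPrime M) q).map (Ideal.Quotient.mk J)
  · rw [RingHom.comp_apply, RingHom.comp_apply, ← map_mul, h]

theorem ringKrullDim_le_of_exists_isUnit_mul_eq {R B : Type*} [CommRing R] [CommRing B]
    (φ : R →+* B) (hφ : ∀ b, ∃ p q, IsUnit (φ q) ∧ b * φ q = φ p) :
    ringKrullDim B ≤ ringKrullDim R := by
  refine Order.krullDim_le_of_strictMono (PrimeSpectrum.comap φ) ?_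
  have hinj : Function.Injective (PrimeSpectrum.comap φ) := by
    have key : ∀ P Q : PrimeSpectrum B, PrimeSpectrum.comap φ P = PrimeSpectrum.comap φ Q →
        P.asIdeal ≤ Q.asIdeal := by
      intro P Q h b hb
      obtain ⟨p, q, hu, hpq⟩ := hφ b
      have h1 : p ∈ (PrimeSpectrum.comap φ P).asIdeal := by
        change φ p ∈ P.asIdeal
        rw [← hpq]
        exact P.asIdeal.mul_mem_right _ hb
      rw [h] at h1
      have h2 : φ p ∈ Q.asIdeal := h1
      rw [← hpq] at h2
      refine (Q.isPrime.mem_or_mem h2).resolve_right fun h3 => ?_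
      exact Q.isPrime.ne_top (Ideal.eq_top_of_isUnit_mem _ h3 hu)
    exact fun P Q h => PrimeSpectrum.ext (le_antisymm (key P Q h) (key Q P h.symm))
  refine Monotone.strictMono_of_injective (fun P Q h => ?_) hinj
  exact Ideal.comap_mono h

theorem ringKrullDim_localization_quotient_le {k : Type} [Field k] {n : ℕ}
    (M : Ideal (MvPolynomial (Fin n) k)) [M.IsPrime] (J : Ideal (Localization.AtPrime M)) (m : ℕ)
    (hm : ∀ P : Ideal (MvPolynomial (Fin n) k), P.IsPrime → J.comap (algebraMap _ _) ≤ P →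
      coordTrdeg P ≤ m) :
    ringKrullDim (Localization.AtPrime M ⧸ J) ≤ m := by
  refine ringKrullDim_le_of_forall_coordTrdeg_le _
    (exists_isUnit_mul_eq_of_isLocalization M J) m fun P hP => hm _ (hP.comap _) ?_
  rw [← Ideal.comap_comap]
  refine Ideal.comap_mono fun a ha => ?_
  rw [Ideal.mem_comap, Ideal.Quotient.eq_zero_iff_mem.2 ha]
  exact P.zero_mem

theorem hasDepth_map_span_range {k : Type} [Field k] [IsAlgClosed k] {n s r : ℕ} (hr : r + s = n)
    (F : Fin s → MvPolynomial (Fin n) k)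
    (hF : ∀ q : Ideal (MvPolynomial (Fin n) k), q.IsPrime → Ideal.span (Set.range F) ≤ q →
      coordTrdeg q ≤ r)
    (M : Ideal (MvPolynomial (Fin n) k)) [hM : M.IsMaximal] (hFM : ∀ i, F i ∈ M) :
    ((Ideal.span (Set.range F)).map
      (algebraMap (MvPolynomial (Fin n) k) (Localization.AtPrime M))).HasDepth r := by
  have hmap : (Ideal.span (Set.range F)).map (algebraMap (MvPolynomial (Fin n) k)
      (Localization.AtPrime M)) =
      Ideal.span (Set.range fun i => algebraMap _ (Localization.AtPrime M) (F i)) := by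
    rw [Ideal.map_span, ← Set.range_comp]
    rfl
  have h := hasDepth_bot_localization M
  have h' : (⊥ : Ideal (Localization.AtPrime M)).HasDepth (r + s) := by rwa [hr]
  have h2 := h'.sup_span_range (fun i => algebraMap _ (Localization.AtPrime M) (F i))
    (fun i => (IsLocalization.AtPrime.to_map_mem_maximal_iff _ M _).2 (hFM i)) (by
      rw [bot_sup_eq, ← hmap]
      refine ringKrullDim_localization_quotient_le M _ r fun P hP hle => hF P hP ?_
      exact Ideal.le_comap_map.trans hle)
  rwa [bot_sup_eq, ← hmap] at h2

theorem le_coordTrdeg_of_isAssociatedTo {k : Type} [Field k] [IsAlgClosed k] {n s r : ℕ}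
    (hr : r + s = n)
    (F : Fin s → MvPolynomial (Fin n) k)
    (hF : ∀ q : Ideal (MvPolynomial (Fin n) k), q.IsPrime → Ideal.span (Set.range F) ≤ q →
      coordTrdeg q ≤ r)
    (M : Ideal (MvPolynomial (Fin n) k)) [hM : M.IsMaximal] (hFM : ∀ i, F i ∈ M)
    {P : Ideal (Localization.AtPrime M)}
    (hP : P.IsAssociatedTo ((Ideal.span (Set.range F)).map
      (algebraMap (MvPolynomial (Fin n) k) (Localization.AtPrime M)))) :
    r ≤ coordTrdeg (P.comap (algebraMap (MvPolynomial (Fin n) k) (Localization.AtPrime M))) := by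
  have h1 := (hasDepth_map_span_range hr F hF M hFM).le_ringKrullDim hP
  have h2 := ringKrullDim_localization_quotient_le M P _ fun Q _ hQ => coordTrdeg_anti hQ
  exact_mod_cast h1.trans h2

theorem le_coordTrdeg_add_one_of_isAssociatedTo {k : Type} [Field k] [IsAlgClosed k] {n s r : ℕ}
    (hr : r + s = n)
    (F : Fin s → MvPolynomial (Fin n) k)
    (hF : ∀ q : Ideal (MvPolynomial (Fin n) k), q.IsPrime → Ideal.span (Set.range F) ≤ q →
      coordTrdeg q ≤ r)
    (M : Ideal (MvPolynomial (Fin n) k)) [hM : M.IsMaximal] (hFM : ∀ i, F i ∈ M)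
    {g : Localization.AtPrime M}
    (hgM : g ∈ IsLocalRing.maximalIdeal (Localization.AtPrime M))
    (hg : ((Ideal.span (Set.range F)).map
      (algebraMap (MvPolynomial (Fin n) k) (Localization.AtPrime M))).IsRegularMod g)
    {P : Ideal (Localization.AtPrime M)}
    (hP : P.IsAssociatedTo ((Ideal.span (Set.range F)).map
      (algebraMap (MvPolynomial (Fin n) k) (Localization.AtPrime M)) ⊔ Ideal.span {g})) :
    r ≤ coordTrdeg
      (P.comap (algebraMap (MvPolynomial (Fin n) k) (Localization.AtPrime M))) + 1 := by
  have h0 := hasDepth_map_span_range hr F hF M hFM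
  rcases r with _ | r
  · omega
  · have h1 := (h0.sup_span_singleton hgM hg).le_ringKrullDim hP
    have h2 := ringKrullDim_localization_quotient_le M P _ fun Q _ hQ => coordTrdeg_anti hQ
    have : r ≤ coordTrdeg
        (P.comap (algebraMap (MvPolynomial (Fin n) k) (Localization.AtPrime M))) := by
      exact_mod_cast h1.trans h2
    omega

theorem ringKrullDim_quotient_eq {k : Type} [Field k] [IsAlgClosed k] {n s r : ℕ} (hr : r + s = n)
    (F : Fin s → MvPolynomial (Fin n) k)
    (hF : ∀ q : Ideal (MvPolynomial (Fin n) k), q.IsPrime → Ideal.span (Set.range F) ≤ q →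
      coordTrdeg q ≤ r)
    (M : Ideal (MvPolynomial (Fin n) k)) [hM : M.IsMaximal] (hFM : ∀ i, F i ∈ M) :
    ringKrullDim (MvPolynomial (Fin n) k ⧸ Ideal.span (Set.range F)) = r := by
  apply le_antisymm
  · refine ringKrullDim_le_of_forall_coordTrdeg_le (Ideal.Quotient.mk _)
      (fun b => ?_) r fun P hP => hF _ (hP.comap _) ?_
    · obtain ⟨p, rfl⟩ := Ideal.Quotient.mk_surjective b
      exact ⟨p, 1, by simp, by simp⟩
    · intro a ha
      rw [Ideal.mem_comap, Ideal.Quotient.eq_zero_iff_mem.2 ha]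
      exact P.zero_mem
  · have hne : (1 : Localization.AtPrime M) ∉ (Ideal.span (Set.range F)).map
      (algebraMap (MvPolynomial (Fin n) k) (Localization.AtPrime M)) := by
      rw [← Ideal.ne_top_iff_one]
      refine ne_top_of_le_ne_top (IsLocalRing.maximalIdeal.isMaximal _).ne_top
        (Ideal.map_le_iff_le_comap.2 (Ideal.span_le.2 ?_))
      rintro _ ⟨i, rfl⟩
      exact (IsLocalization.AtPrime.to_map_mem_maximal_iff _ M _).2 (hFM i)
    obtain ⟨P, hP, -⟩ := Ideal.exists_isAssociatedTo hne
    refine ((hasDepth_map_span_range hr F hF M hFM).le_ringKrullDim hP).trans ?_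
    have hle : ∀ a ∈ Ideal.span (Set.range F),
        (Ideal.Quotient.mk P).comp (algebraMap (MvPolynomial (Fin n) k)
            (Localization.AtPrime M)) a = 0 := by
      intro a ha
      rw [RingHom.comp_apply, Ideal.Quotient.eq_zero_iff_mem]
      exact hP.le (Ideal.mem_map_of_mem _ ha)
    refine ringKrullDim_le_of_exists_isUnit_mul_eq (Ideal.Quotient.lift _ _ hle) fun b => ?_
    obtain ⟨p, q, h1, h2⟩ := exists_isUnit_mul_eq_of_isLocalization M P b
    exact ⟨Ideal.Quotient.mk _ p, Ideal.Quotient.mk _ q, h1, h2⟩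

theorem aeval_add_eq_of_mul_eq_zero {k C σ : Type*} [CommRing k] [CommRing C] [Algebra k C]
    [Fintype σ] (u η : σ → C) (hη : ∀ i j, η i * η j = 0) (p : MvPolynomial σ k) :
    aeval (fun i => u i + η i) p = aeval u p + ∑ i, aeval u (pderiv i p) * η i := by
  classical
  induction p using MvPolynomial.induction_on with
  | C a => simp
  | add p q hp hq =>
    simp only [map_add, hp, hq, add_mul, Finset.sum_add_distrib]
    ring
  | mul_X p j hp =>
    have h0 : (∑ i, aeval u (pderiv i p) * η i) * η j = 0 := by
      rw [Finset.sum_mul]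
      exact Finset.sum_eq_zero fun i _ => by rw [mul_assoc, hη, mul_zero]
    have h1 : ∑ i, aeval u (pderiv i (p * X j)) * η i =
        (∑ i, aeval u (pderiv i p) * η i) * u j + aeval u p * η j := by
      have h2 : ∀ i, aeval u (pderiv i (p * X j)) * η i =
          aeval u (pderiv i p) * η i * u j + if i = j then aeval u p * η j else 0 := by
        intro i
        rw [Derivation.leibniz, pderiv_X]
        by_cases hij : i = j
        · subst hij
          simp
          ring
        · simp [hij, Ne.symm hij]
          ring
      rw [Finset.sum_congr rfl fun i _ => h2 i, Finset.sum_add_distrib, Finset.sum_mul]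
      simp
    rw [map_mul, aeval_X, hp, h1, map_mul, aeval_X]
    linear_combination h0

/-- At a separating transcendence basis, the relations of a point cannot be combined into a
relation among the differentials of the basis. -/
theorem vecMul_eq_zero_of_forall_notMem {k κ : Type} [Field k] [Field κ] [Algebra k κ] {n s : ℕ}
    (x : Fin n → κ) (S : Set (Fin n)) (hS : AlgebraicIndependent k (fun i : S => x i))
    (hsep : Algebra.IsSeparable (IntermediateField.adjoin k (x '' S)) κ)
    (F : Fin s → MvPolynomial (Fin n) k) (hF : ∀ j, aeval x (F j) = 0) (c : Fin s → κ)
    (hc : ∀ i ∉ S, ∑ j, c j * aeval x (pderiv i (F j)) = 0) (i : Fin n) :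
    ∑ j, c j * aeval x (pderiv i (F j)) = 0 := by
  classical
  by_cases hi : i ∈ S
  swap
  · exact hc i hi
  let π : DualNumber κ →ₐ[k] κ := TrivSqZeroExt.fstHom k κ κ
  have hnil : IsNilpotent (RingHom.ker π) := by
    refine ⟨2, ?_⟩
    refine (pow_two (RingHom.ker π)).trans (eq_bot_iff.2 (Ideal.mul_le.2 ?_))
    intro a ha b hb
    have ha' : TrivSqZeroExt.fst a = 0 := ha
    have hb' : TrivSqZeroExt.fst b = 0 := hb
    rw [Ideal.mem_bot]
    ext <;> simp [ha', hb']
  obtain ⟨Φ, hΦ, hΦS⟩ := exists_algHom_lift_of_isSeparable x S hS hsep π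
    (fun a => ⟨TrivSqZeroExt.inl a, rfl⟩) hnil
    (fun l => TrivSqZeroExt.inl (x l) + TrivSqZeroExt.inr (if l = i then 1 else 0))
    (fun l _ => by simp only [π]; split_ifs <;> simp)
  let D : Fin n → κ := fun l => TrivSqZeroExt.snd (Φ (x l))
  have hΦx : ∀ l, Φ (x l) = TrivSqZeroExt.inl (x l) + TrivSqZeroExt.inr (D l) := by
    intro l
    have : TrivSqZeroExt.fst (Φ (x l)) = x l := hΦ (x l)
    ext <;> simp [D, this]
  have hD : ∀ l ∈ S, D l = if l = i then 1 else 0 := by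
    intro l hl
    simp only [D, hΦS l hl]
    split_ifs <;> simp
  have hrel : ∀ j, ∑ l, aeval x (pderiv l (F j)) * D l = 0 := by
    intro j
    have h1 : Φ (aeval x (F j)) = 0 := by rw [hF, map_zero]
    rw [← AlgHom.comp_apply, comp_aeval] at h1
    have h2 : (fun l => Φ (x l)) = fun l =>
        (TrivSqZeroExt.inl (x l) : DualNumber κ) + TrivSqZeroExt.inr (D l) := funext hΦx
    have h3 : ∀ p : MvPolynomial (Fin n) k, aeval (fun l => (TrivSqZeroExt.inl (x l) :
        DualNumber κ)) p =
        TrivSqZeroExt.inl (aeval x p) := by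
      intro p
      have := AlgHom.comp_apply (TrivSqZeroExt.inlAlgHom k κ κ) (aeval x) p
      rw [comp_aeval] at this
      exact this
    have h4 := aeval_add_eq_of_mul_eq_zero (k := k) (fun l => (TrivSqZeroExt.inl (x l) :
        DualNumber κ))
      (fun l => TrivSqZeroExt.inr (D l)) (fun l m => TrivSqZeroExt.inr_mul_inr _ _ _) (F j)
    have h5 : aeval (fun l => (TrivSqZeroExt.inl (x l) : DualNumber κ) + TrivSqZeroExt.inr (D l))
        (F j) = 0 := by
      rw [← h2]
      exact h1
    rw [h5] at h4
    have h6 := congrArg TrivSqZeroExt.snd h4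
    simp only [h3] at h6
    simpa [TrivSqZeroExt.snd_sum, mul_comm] using h6.symm
  have htot : ∑ l, (∑ j, c j * aeval x (pderiv l (F j))) * D l = 0 := by
    simp_rw [Finset.sum_mul]
    rw [Finset.sum_comm]
    refine Finset.sum_eq_zero fun j _ => ?_
    simp_rw [mul_assoc]
    rw [← Finset.mul_sum, hrel, mul_zero]
  rw [Finset.sum_eq_single i] at htot
  · rwa [hD i hi, if_pos rfl, mul_one] at htot
  · intro l _ hl
    by_cases hlS : l ∈ S
    · rw [hD l hlS, if_neg hl, mul_zero]
    · rw [hc l hlS, zero_mul]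
  · simp

theorem adjoin_range_residue_eq_top {k L : Type} [Field k] [CommRing L]
    [IsLocalRing L] [Algebra k L] {n : ℕ} (ψ : MvPolynomial (Fin n) k →ₐ[k] L)
    (hψ : ∀ l, ∃ p q, IsUnit (ψ q) ∧ l * ψ q = ψ p) :
    IntermediateField.adjoin k (Set.range fun i => IsLocalRing.residue L (ψ (X i))) = ⊤ := by
  let x : Fin n → IsLocalRing.ResidueField L := fun i => IsLocalRing.residue L (ψ (X i))
  let ρ : L →ₐ[k] IsLocalRing.ResidueField L := IsScalarTower.toAlgHom k L _
  have hρ : ∀ l, ρ l = IsLocalRing.residue L l := fun l => rfl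
  have haeval : ∀ p : MvPolynomial (Fin n) k, aeval x p = ρ (ψ p) := by
    intro p
    have h : aeval x = ρ.comp ψ := algHom_ext fun i => by simp [x, hρ]
    rw [h]; rfl
  rw [eq_top_iff]
  intro a _
  obtain ⟨l, rfl⟩ := IsLocalRing.residue_surjective a
  obtain ⟨p, q, hu, hpq⟩ := hψ l
  have hmem : ∀ p : MvPolynomial (Fin n) k, ρ (ψ p) ∈ IntermediateField.adjoin k (Set.range x) := by
    intro p
    rw [← haeval]
    exact IntermediateField.algebra_adjoin_le_adjoin k _ (by
      rw [← MvPolynomial.aeval_range]; exact ⟨p, rfl⟩)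
  have hne : ρ (ψ q) ≠ 0 := (hu.map ρ).ne_zero
  have : IsLocalRing.residue L l = ρ (ψ p) / ρ (ψ q) := by
    rw [eq_div_iff hne, ← hpq, map_mul]; rfl
  rw [this]
  exact div_mem (hmem p) (hmem q)

/-- Jacobian criterion: the cotangent space of a local ring essentially of finite type over a
perfect field is bounded by the number of independent differentials of its equations. -/
theorem exists_finrank_cotangentSpace_add_le {k L : Type} [Field k] [PerfectField k] [CommRing L]
    [IsLocalRing L] [Algebra k L] {n s : ℕ} (ψ : MvPolynomial (Fin n) k →ₐ[k] L)
    (hψ : ∀ l, ∃ p q, IsUnit (ψ q) ∧ l * ψ q = ψ p)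
    (F : Fin s → MvPolynomial (Fin n) k) (hF : ∀ j, ψ (F j) = 0)
    (hJ : ∀ c : Fin s → IsLocalRing.ResidueField L, Matrix.vecMul c (Matrix.of fun j l =>
      aeval (fun i => IsLocalRing.residue L (ψ (X i))) (pderiv l (F j))) = 0 → c = 0) :
    ∃ T : Finset (Fin n),
      IsTranscendenceBasis k (fun i : T => IsLocalRing.residue L (ψ (X (i : Fin n)))) ∧
      Module.finrank (IsLocalRing.ResidueField L) (IsLocalRing.CotangentSpace L) + T.card + s ≤
        n := by
  classical
  let x : Fin n → IsLocalRing.ResidueField L := fun i => IsLocalRing.residue L (ψ (X i))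
  let 𝔫 := IsLocalRing.maximalIdeal L
  let ρ : L →ₐ[k] IsLocalRing.ResidueField L := IsScalarTower.toAlgHom k L _
  have hρ : ∀ l, ρ l = IsLocalRing.residue L l := fun l => rfl
  have haeval : ∀ p : MvPolynomial (Fin n) k, aeval x p = ρ (ψ p) := by
    intro p
    have h : aeval x = ρ.comp ψ := algHom_ext fun i => by simp [x, hρ]
    rw [h]; rfl
  have hadj : IntermediateField.adjoin k (Set.range x) = ⊤ := adjoin_range_residue_eq_top ψ hψ
  obtain ⟨S, hS, hsep⟩ := exists_isTranscendenceBasis_isSeparable_of_adjoin_range x hadj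
  have hmemker : ∀ a ∈ 𝔫 ^ 2, ρ a = 0 := fun a ha =>
    (IsLocalRing.residue_eq_zero_iff a).2 (Ideal.pow_le_self two_ne_zero ha)
  let π : (L ⧸ 𝔫 ^ 2) →ₐ[k] IsLocalRing.ResidueField L := Ideal.Quotient.liftₐ (𝔫 ^ 2) ρ hmemker
  have hπ : ∀ l, π (Ideal.Quotient.mk _ l) = ρ l := fun l => rfl
  have hkermul : ∀ a b, π a = 0 → π b = 0 → a * b = 0 := by
    intro a b ha hb
    obtain ⟨a, rfl⟩ := Ideal.Quotient.mk_surjective a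
    obtain ⟨b, rfl⟩ := Ideal.Quotient.mk_surjective b
    rw [← map_mul, Ideal.Quotient.eq_zero_iff_mem, pow_two]
    exact Ideal.mul_mem_mul ((IsLocalRing.residue_eq_zero_iff a).1 ha)
      ((IsLocalRing.residue_eq_zero_iff b).1 hb)
  have hnil : IsNilpotent (RingHom.ker π) :=
    ⟨2, (pow_two (RingHom.ker π)).trans (eq_bot_iff.2 (Ideal.mul_le.2 fun a ha b hb =>
      Ideal.mem_bot.2 (hkermul a b ha hb)))⟩
  obtain ⟨Φ, hΦ, hΦS⟩ := exists_algHom_lift_of_isSeparable x S hS.1 hsep π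
    (fun a => by
      obtain ⟨l, rfl⟩ := IsLocalRing.residue_surjective a
      exact ⟨Ideal.Quotient.mk _ l, rfl⟩) hnil
    (fun l => Ideal.Quotient.mk _ (ψ (X l))) (fun l _ => rfl)
  let ι := Ideal.cotangentToQuotientSquare 𝔫
  have hι : Function.Injective ι := Ideal.cotangentToQuotientSquare_injective 𝔫
  have hιmem : ∀ y, π (ι y) = 0 := by
    intro y
    obtain ⟨y, rfl⟩ := Ideal.toCotangent_surjective _ y
    exact (IsLocalRing.residue_eq_zero_iff _).2 y.2
  have hιsurj : ∀ a, π a = 0 → ∃ y, ι y = a := by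
    intro a ha
    obtain ⟨a, rfl⟩ := Ideal.Quotient.mk_surjective a
    exact ⟨Ideal.toCotangent 𝔫 ⟨a, (IsLocalRing.residue_eq_zero_iff a).1 ha⟩, rfl⟩
  have hιsmul : ∀ (c : IsLocalRing.ResidueField L) (y : IsLocalRing.CotangentSpace L),
      ι (c • y) = Φ c * ι y := by
    intro c y
    obtain ⟨l, rfl⟩ := IsLocalRing.residue_surjective c
    have h1 : ι (IsLocalRing.residue L l • y) = Ideal.Quotient.mk _ l * ι y := by
      have : IsLocalRing.residue L l • y = l • y := rfl
      rw [this, map_smul, Algebra.smul_def]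
      rfl
    rw [h1, ← sub_eq_zero, ← sub_mul]
    refine hkermul _ _ ?_ (hιmem y)
    rw [map_sub, hΦ, hπ, hρ, sub_self]
  have hη : ∀ i, ∃ y, ι y = Ideal.Quotient.mk _ (ψ (X i)) - Φ (x i) := fun i =>
    hιsurj _ (by rw [map_sub, hΦ, hπ, hρ, sub_self])
  choose y hy using hη
  have hyS : ∀ i ∈ S, y i = 0 := fun i hi => hι (by rw [hy, hΦS i hi, sub_self, map_zero])
  have htaylor : ∀ p : MvPolynomial (Fin n) k, (Ideal.Quotient.mk (𝔫 ^ 2) (ψ p)) =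
      Φ (aeval x p) + ι (∑ i, aeval x (pderiv i p) • y i) := by
    intro p
    have h1 := aeval_add_eq_of_mul_eq_zero (k := k) (fun i => Φ (x i)) (fun i => ι (y i))
      (fun i j => hkermul _ _ (hιmem _) (hιmem _)) p
    have h2 : (fun i => Φ (x i) + ι (y i)) = fun i => Ideal.Quotient.mk _ (ψ (X i)) :=
      funext fun i => by rw [hy]; ring
    have h3 : ∀ p : MvPolynomial (Fin n) k, aeval (fun i => Φ (x i)) p = Φ (aeval x p) := by
      intro p
      rw [← AlgHom.comp_apply, comp_aeval]
    have h4 : aeval (fun i => Ideal.Quotient.mk (𝔫 ^ 2) (ψ (X i))) p =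
        Ideal.Quotient.mk (𝔫 ^ 2) (ψ p) := by
      have h : aeval (fun i => Ideal.Quotient.mk (𝔫 ^ 2) (ψ (X i))) =
        (Ideal.Quotient.mkₐ k (𝔫 ^ 2)).comp ψ := algHom_ext fun i => by simp
      rw [h]; rfl
    simp only [h2, h3, h4] at h1
    rw [h1, map_sum]
    simp_rw [hιsmul]
  let Λ : (Fin n → IsLocalRing.ResidueField L) →ₗ[IsLocalRing.ResidueField L]
    IsLocalRing.CotangentSpace L := Fintype.linearCombination _ y
  have hΛ : ∀ c, Λ c = ∑ i, c i • y i := fun c => Fintype.linearCombination_apply _ _ _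
  have hsurj : Function.Surjective Λ := by
    intro w
    obtain ⟨⟨l, hl⟩, rfl⟩ := Ideal.toCotangent_surjective _ w
    obtain ⟨p, q, hu, hpq⟩ := hψ l
    have hl0 : ρ l = 0 := (IsLocalRing.residue_eq_zero_iff l).2 hl
    have hp0 : aeval x p = 0 := by rw [haeval, ← hpq, map_mul, hl0, zero_mul]
    have hne : ρ (ψ q) ≠ 0 := (hu.map ρ).ne_zero
    have h1 : ρ (ψ q) • (Ideal.toCotangent 𝔫 ⟨l, hl⟩ : IsLocalRing.CotangentSpace L) =
        Λ fun i => aeval x (pderiv i p) := by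
      apply hι
      rw [hΛ]
      have h2 := htaylor p
      rw [hp0, map_zero, zero_add] at h2
      rw [← h2, ← hpq]
      have h3 : (ρ (ψ q) • (Ideal.toCotangent 𝔫 ⟨l, hl⟩ : IsLocalRing.CotangentSpace L)) =
        (ψ q) • (Ideal.toCotangent 𝔫 ⟨l, hl⟩ : 𝔫.Cotangent) := rfl
      rw [h3, map_smul, Algebra.smul_def, mul_comm, map_mul]
      rfl
    refine ⟨(ρ (ψ q))⁻¹ • fun i => aeval x (pderiv i p), ?_⟩
    rw [map_smul, ← h1, smul_smul, inv_mul_cancel₀ hne, one_smul]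
  let w : Fin s ⊕ S → (Fin n → IsLocalRing.ResidueField L) :=
    Sum.elim (fun j l => aeval x (pderiv l (F j))) (fun i => Pi.single (i : Fin n) 1)
  have hwker : ∀ t, w t ∈ LinearMap.ker Λ := by
    rintro (j | i)
    · rw [LinearMap.mem_ker, hΛ]
      apply hι
      have h1 := htaylor (F j)
      rw [haeval, hF, map_zero, map_zero, map_zero, zero_add] at h1
      rw [map_zero]
      exact h1.symm
    · rw [LinearMap.mem_ker, hΛ, Finset.sum_eq_single (i : Fin n)]
      · rw [hyS i i.2, smul_zero]
      · intro l _ hl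
        simp [w, hl]
      · simp
  have hwli : LinearIndependent (IsLocalRing.ResidueField L) w := by
    rw [Fintype.linearIndependent_iff]
    intro g hg
    rw [Fintype.sum_sum_type] at hg
    have hcoord : ∀ l : Fin n, ∑ j, g (.inl j) * aeval x (pderiv l (F j)) +
        ∑ i : S, g (.inr i) * (Pi.single (i : Fin n) 1 : Fin n → IsLocalRing.ResidueField L) l =
            0 := by
      intro l
      have := congrFun hg l
      simpa [w, Finset.sum_apply] using this
    have hzero : (fun j => g (.inl j)) = 0 := by
      apply hJ
      funext l
      have := vecMul_eq_zero_of_forall_notMem x S hS.1 hsep F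
        (fun j => by rw [haeval, hF, map_zero]) (fun j => g (.inl j)) (fun i hi => by
          have h1 := hcoord i
          rw [Finset.sum_eq_zero (s := Finset.univ (α := S)), add_zero] at h1
          · exact h1
          · intro j _
            have hne : i ≠ (j : Fin n) := fun h => hi (h ▸ j.2)
            simp [hne]) l
      simpa [Matrix.vecMul, dotProduct] using this
    rintro (j | i)
    · exact congrFun hzero j
    · have h1 := hcoord i
      have h2 : ∀ j, g (.inl j) = 0 := fun j => congrFun hzero j
      simpa [h2, Pi.single_apply, Subtype.coe_inj] using h1
  refine ⟨S.toFinset, ?_, ?_⟩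
  · have := hS.comp_equiv (Equiv.subtypeEquivRight (fun i => Set.mem_toFinset (s := S) (a := i)))
    exact this
  · have h1 := LinearMap.finrank_range_add_finrank_ker Λ
    rw [LinearMap.range_eq_top.2 hsurj, finrank_top, Module.finrank_fin_fun] at h1
    have hli' : LinearIndependent (IsLocalRing.ResidueField L)
        (fun t => (⟨w t, hwker t⟩ : LinearMap.ker Λ)) :=
      LinearIndependent.of_comp (LinearMap.ker Λ).subtype hwli
    have h2 := hli'.fintype_card_le_finrank
    rw [Fintype.card_sum, Fintype.card_fin, ← Set.toFinset_card] at h2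
    omega

/-- Elementary form of: an element integral over a regular element `g` is divisible by `g`,
provided the local rings at the primes associated to `(g)` have principal maximal ideals. -/
theorem dvd_of_integral_relation {O : Type*} [CommRing O] [IsNoetherianRing O] {g : O}
    (hg : ∀ a, g * a = 0 → a = 0)
    (h : ∀ P : Ideal O, P.IsAssociatedTo (Ideal.span {g}) →
      ∃ t ∈ P, ∀ x ∈ P, ∃ u ∉ P, ∃ c, u * x = c * t)
    {a : O} {m : ℕ} {c : ℕ → O}
    (ha : a ^ m + ∑ i ∈ Finset.range m, c i * g ^ (m - i) * a ^ i = 0) : g ∣ a := by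
  by_contra hdvd
  -- pass to a multiple `b * a` whose conductor into `(g)` is a prime `P`
  have h1 : (1 : O) ∉ (Submodule.comap (LinearMap.mulRight O a) (Ideal.span {g}) : Ideal O) := by
    change ¬ (1 * a ∈ Ideal.span {g})
    rwa [one_mul, Ideal.mem_span_singleton]
  obtain ⟨P, ⟨hP, b, hb⟩, -⟩ := Ideal.exists_isAssociatedTo h1
  have hPg : ∀ x, x ∈ P ↔ g ∣ x * (b * a) := by
    intro x
    rw [hb x, ← Ideal.mem_span_singleton, ← mul_assoc]
    rfl
  have hPass : P.IsAssociatedTo (Ideal.span {g}) :=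
    ⟨hP, b * a, fun x => by rw [hPg, Ideal.mem_span_singleton]⟩
  have hba : (b * a) ^ m + ∑ i ∈ Finset.range m, (c i * b ^ (m - i)) * g ^ (m - i) * (b * a) ^ i =
      0 := by
    have := congrArg (fun z => b ^ m * z) ha
    simp only [mul_add, mul_zero, Finset.mul_sum] at this
    rw [← this, mul_pow]
    congr 1
    refine Finset.sum_congr rfl fun i hi => ?_
    have : b ^ m = b ^ (m - i) * b ^ i := by
      rw [← pow_add, Nat.sub_add_cancel (Finset.mem_range.1 hi).le]
    rw [this, mul_pow]
    ring
  have hgm : ∀ (j : ℕ) (z : O), g ^ j * z = 0 → z = 0 := by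
    intro j
    induction j with
    | zero => intro z hz; simpa using hz
    | succ j ih =>
      intro z hz
      refine ih z (hg _ ?_)
      rw [← hz]; ring
  -- the fraction `b * a / g` maps `P` into itself
  have hstable : ∀ x ∈ P, ∀ y, x * (b * a) = g * y → y ∈ P := by
    intro x hx y hxy
    have h2 : y ^ m + ∑ i ∈ Finset.range m, (c i * b ^ (m - i)) * x ^ (m - i) * y ^ i = 0 := by
      apply hgm m
      have := congrArg (fun z => x ^ m * z) hba
      simp only [mul_add, mul_zero, Finset.mul_sum] at this
      rw [← this, mul_add, Finset.mul_sum, ← mul_pow, ← mul_pow, hxy]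
      congr 1
      refine Finset.sum_congr rfl fun i hi => ?_
      have e1 : g ^ m = g ^ (m - i) * g ^ i := by
        rw [← pow_add, Nat.sub_add_cancel (Finset.mem_range.1 hi).le]
      have e2 : x ^ m = x ^ (m - i) * x ^ i := by
        rw [← pow_add, Nat.sub_add_cancel (Finset.mem_range.1 hi).le]
      have e3 : x ^ i * (b * a) ^ i = g ^ i * y ^ i := by rw [← mul_pow, hxy, mul_pow]
      rw [e1, e2]
      linear_combination (-(c i * b ^ (m - i) * g ^ (m - i) * x ^ (m - i))) * e3
    have h3 : y ^ m ∈ P := by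
      rw [eq_neg_of_add_eq_zero_left h2]
      refine P.neg_mem (P.sum_mem fun i hi => P.mul_mem_right _ (P.mul_mem_left _ ?_))
      exact P.pow_mem_of_mem hx _ (Nat.sub_pos_of_lt (Finset.mem_range.1 hi))
    exact hP.mem_of_pow_mem m h3
  obtain ⟨t, ht, htP⟩ := h P hPass
  obtain ⟨y, hy⟩ := (hPg t).1 ht
  obtain ⟨u, hu, e, hue⟩ := htP y (hstable t ht y hy)
  obtain ⟨w, hw, f, hwf⟩ := htP g (hPass.le (Ideal.mem_span_singleton_self g))
  have h4 : w * (u * (b * a) - g * e) = 0 := by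
    apply hg
    linear_combination (u * (b * a) - g * e) * hwf + f * u * hy + f * g * hue
  have h5 : w * u ∈ P := (hPg _).2 ⟨w * e, by linear_combination h4⟩
  exact (hP.mem_or_mem h5).elim hw hu

/-- Serre's criterion for normality of a Noetherian local ring, in an elementary form. -/
theorem isDomain_and_isIntegrallyClosed_of_serre {O : Type*} [CommRing O] [IsNoetherianRing O]
    [IsLocalRing O]
    (h0 : ∀ P : Ideal O, P.IsAssociatedTo ⊥ → ∀ x ∈ P, ∃ u ∉ P, u * x = 0)
    (h1 : ∀ g ∈ IsLocalRing.maximalIdeal O, (∀ a, g * a = 0 → a = 0) →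
      ∀ P : Ideal O, P.IsAssociatedTo (Ideal.span {g}) →
        ∃ t ∈ P, ∀ x ∈ P, ∃ u ∉ P, ∃ c, u * x = c * t) :
    IsDomain O ∧ IsIntegrallyClosed O := by
  have hdvd : ∀ g : O, (∀ a, g * a = 0 → a = 0) → ∀ (a : O) (m : ℕ) (c : ℕ → O),
      a ^ m + ∑ i ∈ Finset.range m, c i * g ^ (m - i) * a ^ i = 0 → g ∣ a := by
    intro g hg a m c ha
    by_cases hgm : g ∈ IsLocalRing.maximalIdeal O
    · exact dvd_of_integral_relation hg (h1 g hgm hg) ha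
    · have : IsUnit g := by simpa [IsLocalRing.mem_maximalIdeal, mem_nonunits_iff] using hgm
      exact this.dvd
  have hred : ∀ x : O, x * x = 0 → x = 0 := by
    intro x hx
    by_contra hne
    obtain ⟨P, hP, hxP⟩ := Ideal.exists_isAssociatedTo (I := (⊥ : Ideal O)) (m := x)
        (by simpa using hne)
    obtain ⟨u, hu, hux⟩ := h0 P hP x (hxP x (by simpa using hx))
    exact hu (hxP u (by simpa using hux))
  have hdom : IsDomain O := by
    have : NoZeroDivisors O := by
      refine ⟨fun {x z} hxz => ?_⟩
      by_contra hcon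
      push Not at hcon
      let I : Ideal O := LinearMap.ker (LinearMap.mulRight O x)
      have hI : ∀ a, a ∈ I ↔ a * x = 0 := fun a => Iff.rfl
      let J : Ideal O := Submodule.annihilator I
      have hJ : ∀ b, b ∈ J ↔ ∀ a ∈ I, b * a = 0 := fun b => Submodule.mem_annihilator
      obtain ⟨g, hgIJ, hg⟩ := Ideal.exists_isRegularMod (I ⊔ J) (fun _ : Unit => (⊥ : Ideal O)) (by
        intro _ P hP hle
        obtain ⟨hPp, m, hm⟩ := hP
        have hmJ : m ∈ J := (hJ m).2 fun a ha => by
          have := (hm a).1 (hle (Ideal.mem_sup_left ha))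
          rwa [mul_comm]
        have hmP : m * m = 0 := (hm m).1 (hle (Ideal.mem_sup_right hmJ))
        have hm0 := hred m hmP
        exact hPp.ne_top ((Ideal.eq_top_iff_one _).2 ((hm 1).2 (by simp [hm0]))))
      have hg' : ∀ a, g * a = 0 → a = 0 := fun a ha => hg () a ha
      obtain ⟨a, ha, b, hb, rfl⟩ := Submodule.mem_sup.1 hgIJ
      have hba : b * a = 0 := (hJ b).1 hb a ha
      obtain ⟨e, he⟩ := hdvd (a + b) hg' a 2 (fun i => if i = 1 then -1 else 0) (by
        simp
        linear_combination -hba)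
      have hee : e * (1 - e) = 0 := by
        apply hg'
        apply hg'
        have : (a + b) * e * ((a + b) - (a + b) * e) = 0 := by
          rw [← he]
          linear_combination hba
        linear_combination this
      have hzI : z ∈ I := (hI z).2 (by rwa [mul_comm])
      rcases IsLocalRing.isUnit_or_isUnit_of_isUnit_add (a := e) (b := 1 - e) (by simp) with hu | hu
      · have he1 : e = 1 := by
          have := (hu.mul_right_eq_zero).1 hee
          linear_combination -this
        rw [he1, mul_one] at he
        apply hcon.1
        apply hg'
        rw [← he]
        exact (hI a).1 ha
      · have he0 : e = 0 := (hu.mul_left_eq_zero).1 hee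
        rw [he0, mul_zero] at he
        apply hcon.2
        apply hg'
        rw [he, zero_add]
        exact (hJ b).1 hb z hzI
    exact NoZeroDivisors.to_isDomain O
  refine ⟨hdom, (isIntegrallyClosed_iff (FractionRing O)).2 fun {x} hx => ?_⟩
  obtain ⟨p, hp, hpx⟩ := hx
  obtain ⟨a, g, rfl⟩ := IsLocalization.exists_mk'_eq (nonZeroDivisors O) x
  have hpx' : Polynomial.aeval (IsLocalization.mk' (FractionRing O) a g) p = 0 := hpx
  have h2 := scaleRoots_aeval_eq_zero_of_aeval_mk'_eq_zero (A := O) (M := nonZeroDivisors O)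
    (S := FractionRing O) hpx'
  rw [Polynomial.aeval_algebraMap_apply, FaithfulSMul.algebraMap_eq_zero_iff,
      Polynomial.coe_aeval_eq_eval,
    Polynomial.eval_eq_sum_range, Polynomial.natDegree_scaleRoots, Finset.sum_range_succ] at h2
  simp only [Polynomial.coeff_scaleRoots, hp.coeff_natDegree, Nat.sub_self, pow_zero, one_mul] at h2
  obtain ⟨e, he⟩ := hdvd g (fun b hb => (mul_eq_zero.1 hb).resolve_left
      (nonZeroDivisors.ne_zero g.2))
    a p.natDegree p.coeff (by rw [← h2]; ring)
  refine ⟨e, ?_⟩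
  rw [eq_comm, IsLocalization.mk'_eq_iff_eq_mul, he, ← map_mul, mul_comm]

theorem coordTrdeg_comap_add_le_or {k L : Type} [Field k] [PerfectField k] [CommRing L]
    [IsLocalRing L] [Algebra k L] {n s r e : ℕ} (ψ : MvPolynomial (Fin n) k →ₐ[k] L)
    (hψ : ∀ l, ∃ p q, IsUnit (ψ q) ∧ l * ψ q = ψ p)
    (F : Fin s → MvPolynomial (Fin n) k) (hF : ∀ j, ψ (F j) = 0)
    (hbad : ∀ c : Fin s → IsLocalRing.ResidueField L, c ≠ 0 → Matrix.vecMul c (Matrix.of fun j l =>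
      aeval (fun i => IsLocalRing.residue L (ψ (X i))) (pderiv l (F j))) = 0 →
      ∀ T : Finset (Fin n), AlgebraicIndependent k
        (fun i : T => IsLocalRing.residue L (ψ (X (i : Fin n)))) → T.card + e ≤ r) :
    coordTrdeg ((IsLocalRing.maximalIdeal L).comap ψ) + e ≤ r ∨
      Module.finrank (IsLocalRing.ResidueField L) (IsLocalRing.CotangentSpace L) +
        coordTrdeg ((IsLocalRing.maximalIdeal L).comap ψ) + s ≤ n := by
  let ρ : MvPolynomial (Fin n) k →ₐ[k] IsLocalRing.ResidueField L :=
    (IsScalarTower.toAlgHom k L (IsLocalRing.ResidueField L)).comp ψ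
  have hker : (IsLocalRing.maximalIdeal L).comap ψ = RingHom.ker ρ := by
    ext p
    rw [Ideal.mem_comap, ← IsLocalRing.residue_eq_zero_iff, RingHom.mem_ker]
    rfl
  rw [hker]
  by_cases hJ : ∀ c : Fin s → IsLocalRing.ResidueField L, Matrix.vecMul c (Matrix.of fun j l =>
      aeval (fun i => IsLocalRing.residue L (ψ (X i))) (pderiv l (F j))) = 0 → c = 0
  · right
    obtain ⟨T, hT, hle⟩ := exists_finrank_cotangentSpace_add_le ψ hψ F hF hJ
    rwa [coordTrdeg_ker_eq ρ T hT]
  · left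
    push Not at hJ
    obtain ⟨c, hc, hc0⟩ := hJ
    obtain ⟨S, hS, -⟩ := exists_isTranscendenceBasis_isSeparable_of_adjoin_range _
      (adjoin_range_residue_eq_top ψ hψ)
    classical
    obtain ⟨T, rfl⟩ : ∃ T : Finset (Fin n), S = T := ⟨S.toFinset, by simp⟩
    rw [coordTrdeg_ker_eq ρ T hS]
    exact hbad c hc0 hc T hS.1

theorem exists_notMem_mul_eq_zero_of_finrank_cotangentSpace {O : Type*} [CommRing O]
    [IsNoetherianRing O] (P : Ideal O) [P.IsPrime]
    (h : Module.finrank (IsLocalRing.ResidueField (Localization.AtPrime P))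
      (IsLocalRing.CotangentSpace (Localization.AtPrime P)) = 0) :
    ∀ x ∈ P, ∃ u ∉ P, u * x = 0 := by
  have : IsNoetherianRing (Localization.AtPrime P) :=
    IsLocalization.isNoetherianRing P.primeCompl _ inferInstance
  rw [IsLocalRing.finrank_cotangentSpace_eq_zero_iff] at h
  intro x hx
  have h0 : algebraMap O (Localization.AtPrime P) x = 0 := by
    have := (IsLocalization.AtPrime.to_map_mem_maximal_iff (Localization.AtPrime P) P x).2 hx
    rwa [IsLocalRing.isField_iff_maximalIdeal_eq.1 h] at this
  rw [← map_zero (algebraMap O (Localization.AtPrime P)),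
    IsLocalization.eq_iff_exists P.primeCompl] at h0
  obtain ⟨u, hu⟩ := h0
  exact ⟨u, u.2, by simpa using hu⟩

theorem exists_mem_forall_exists_notMem_mul_eq {O : Type*} [CommRing O]
    [IsNoetherianRing O] (P : Ideal O) [P.IsPrime]
    (h : Module.finrank (IsLocalRing.ResidueField (Localization.AtPrime P))
      (IsLocalRing.CotangentSpace (Localization.AtPrime P)) ≤ 1) :
    ∃ t ∈ P, ∀ x ∈ P, ∃ u ∉ P, ∃ c, u * x = c * t := by
  have : IsNoetherianRing (Localization.AtPrime P) :=
    IsLocalization.isNoetherianRing P.primeCompl _ inferInstance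
  rw [IsLocalRing.finrank_cotangentSpace_le_one_iff] at h
  obtain ⟨⟨γ, hγ⟩⟩ := h
  obtain ⟨⟨t, w⟩, htw⟩ := IsLocalization.surj P.primeCompl γ
  have hmem : ∀ x, x ∈ P ↔ γ ∣ algebraMap O (Localization.AtPrime P) x := by
    intro x
    rw [← IsLocalization.AtPrime.to_map_mem_maximal_iff (Localization.AtPrime P) P x, hγ]
    exact Ideal.mem_span_singleton
  refine ⟨t, (hmem t).2 ⟨_, htw.symm⟩, fun x hx => ?_⟩
  obtain ⟨y, hy⟩ := (hmem x).1 hx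
  obtain ⟨⟨a, b⟩, hab⟩ := IsLocalization.surj P.primeCompl y
  have h1 : algebraMap O (Localization.AtPrime P) (b * w * x) =
      algebraMap O (Localization.AtPrime P) (a * t) := by
    simp only [map_mul, hy]
    simp only at hab htw
    rw [← hab, ← htw]; ring
  obtain ⟨u, hu⟩ := (IsLocalization.eq_iff_exists P.primeCompl _).1 h1
  exact ⟨u * (b * w), (u * (b * w)).2, u * a, by
    rw [mul_assoc, hu, mul_assoc]⟩

theorem isDomain_and_isIntegrallyClosed_of_isLocalization_le {R O : Type*} [CommRing R] [CommRing O]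
    [Algebra R O] (S : Submonoid R) [IsLocalization S O] [IsDomain O] [IsIntegrallyClosed O]
    (q : Ideal R) [q.IsPrime] (hle : S ≤ q.primeCompl) :
    IsDomain (Localization.AtPrime q) ∧ IsIntegrallyClosed (Localization.AtPrime q) := by
  let := IsLocalization.localizationAlgebraOfSubmonoidLe O (Localization.AtPrime q) S
    q.primeCompl hle
  have := IsLocalization.localization_isScalarTower_of_submonoid_le O
    (Localization.AtPrime q) S q.primeCompl hle
  have hloc := IsLocalization.isLocalization_of_submonoid_le O (Localization.AtPrime q) S
    q.primeCompl hle
  have hnz : q.primeCompl.map (algebraMap R O) ≤ nonZeroDivisors O := by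
    refine le_nonZeroDivisors_of_noZeroDivisors fun h0 => ?_
    have := IsLocalization.map_units (Localization.AtPrime q)
      (⟨0, h0⟩ : q.primeCompl.map (algebraMap R O))
    simp at this
  exact ⟨IsLocalization.isDomain_of_le_nonZeroDivisors (Localization.AtPrime q) hnz,
    isIntegrallyClosed_of_isLocalization _ _ hnz⟩

/-- The Jacobian criterion at a prime of a localized quotient of a polynomial ring. -/
theorem coordTrdeg_comap_add_le_or_of_isPrime {k O : Type} [Field k] [PerfectField k] [CommRing O]
    [Algebra k O] {n s r e : ℕ} (φ : MvPolynomial (Fin n) k →ₐ[k] O)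
    (hφ : ∀ l, ∃ p q, IsUnit (φ q) ∧ l * φ q = φ p)
    (F : Fin s → MvPolynomial (Fin n) k) (hF : ∀ j, φ (F j) = 0)
    (hbad : ∀ (K : Type) [Field K] [Algebra k K] (x : Fin n → K) (c : Fin s → K), c ≠ 0 →
      Matrix.vecMul c (Matrix.of fun j l => aeval x (pderiv l (F j))) = 0 →
      ∀ T : Finset (Fin n), AlgebraicIndependent k (fun i : T => x i) → T.card + e ≤ r)
    (P : Ideal O) [P.IsPrime] :
    coordTrdeg (P.comap φ) + e ≤ r ∨
      Module.finrank (IsLocalRing.ResidueField (Localization.AtPrime P))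
        (IsLocalRing.CotangentSpace (Localization.AtPrime P)) +
      coordTrdeg (P.comap φ) + s ≤ n := by
  let ψ : MvPolynomial (Fin n) k →ₐ[k] Localization.AtPrime P :=
    (IsScalarTower.toAlgHom k O (Localization.AtPrime P)).comp φ
  have hψ' : ∀ p, ψ p = algebraMap _ (Localization.AtPrime P) (φ p) := fun p => rfl
  have hcomap : (IsLocalRing.maximalIdeal (Localization.AtPrime P)).comap ψ = P.comap φ := by
    ext p
    rw [Ideal.mem_comap, hψ',
      IsLocalization.AtPrime.to_map_mem_maximal_iff (Localization.AtPrime P) P (φ p)]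
    rfl
  rw [← hcomap]
  refine coordTrdeg_comap_add_le_or ψ ?_ F ?_ (fun c hc h T hT => hbad _ _ c hc h T hT)
  · intro l
    obtain ⟨⟨a, b⟩, hab⟩ := IsLocalization.surj P.primeCompl l
    obtain ⟨p₁, q₁, hu₁, h₁⟩ := hφ a
    obtain ⟨p₂, q₂, hu₂, h₂⟩ := hφ b
    have hu₁' : IsUnit (ψ q₁) := hu₁.map (algebraMap _ (Localization.AtPrime P))
    have hu₂' : IsUnit (ψ q₂) := hu₂.map (algebraMap _ (Localization.AtPrime P))
    have hb : IsUnit (algebraMap _ (Localization.AtPrime P) b.1) :=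
      IsLocalization.map_units (Localization.AtPrime P) b
    have e₁ : algebraMap _ (Localization.AtPrime P) a * ψ q₁ = ψ p₁ := by
      rw [hψ', hψ', ← map_mul, h₁]
    have e₂ : algebraMap _ (Localization.AtPrime P) b.1 * ψ q₂ = ψ p₂ := by
      rw [hψ', hψ', ← map_mul, h₂]
    refine ⟨p₁ * q₂, p₂ * q₁, ?_, ?_⟩
    · rw [map_mul, ← e₂]
      exact (hb.mul hu₂').mul hu₁'
    · simp only at hab
      rw [map_mul, map_mul, ← e₁, ← e₂, ← hab]
      ring
  · intro j
    rw [hψ', hF, map_zero]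

theorem isDomain_and_isIntegrallyClosed_of_surjective {k O : Type} [Field k] [IsAlgClosed k]
    [CommRing O] [Algebra k O] {n s r : ℕ} (hr : r + s = n) (F : Fin s → MvPolynomial (Fin n) k)
    (hF : ∀ q : Ideal (MvPolynomial (Fin n) k), q.IsPrime → Ideal.span (Set.range F) ≤ q →
      coordTrdeg q ≤ r)
    (hbad : ∀ (K : Type) [Field K] [Algebra k K] (x : Fin n → K) (c : Fin s → K), c ≠ 0 →
      Matrix.vecMul c (Matrix.of fun j l => aeval x (pderiv l (F j))) = 0 →
      ∀ T : Finset (Fin n), AlgebraicIndependent k (fun i : T => x i) → T.card + 2 ≤ r)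
    (M : Ideal (MvPolynomial (Fin n) k)) [hM : M.IsMaximal] (hFM : ∀ i, F i ∈ M)
    (Ω : Localization.AtPrime M →+* O) (hsurj : Function.Surjective Ω)
    (halg : ∀ c, Ω (algebraMap (MvPolynomial (Fin n) k) (Localization.AtPrime M) (C c)) =
      algebraMap k O c)
    (hker : ∀ a, Ω a = 0 ↔ a ∈ (Ideal.span (Set.range F)).map
        (algebraMap (MvPolynomial (Fin n) k) (Localization.AtPrime M))) :
    IsDomain O ∧ IsIntegrallyClosed O := by
  have hA : IsNoetherianRing (Localization.AtPrime M) :=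
    IsLocalization.isNoetherianRing M.primeCompl _ inferInstance
  have hO : IsNoetherianRing O := isNoetherianRing_of_surjective _ _ Ω hsurj
  have hJle : (Ideal.span (Set.range F)).map
      (algebraMap (MvPolynomial (Fin n) k) (Localization.AtPrime M)) ≤
        IsLocalRing.maximalIdeal (Localization.AtPrime M) := by
    rw [Ideal.map_le_iff_le_comap, Ideal.span_le]
    rintro _ ⟨i, rfl⟩
    exact (IsLocalization.AtPrime.to_map_mem_maximal_iff (Localization.AtPrime M) M (F i)).2 (hFM i)
  have : Nontrivial O := by
    refine ⟨1, 0, fun h => ?_⟩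
    have h1 := hJle ((hker 1).1 (by rw [map_one, h]))
    exact (IsLocalRing.maximalIdeal.isMaximal (Localization.AtPrime M)).ne_top
      ((Ideal.eq_top_iff_one _).2 h1)
  have : IsLocalRing O := IsLocalRing.of_surjective' Ω hsurj
  let φ : MvPolynomial (Fin n) k →ₐ[k] O :=
    { Ω.comp (algebraMap (MvPolynomial (Fin n) k) (Localization.AtPrime M)) with commutes' := halg }
  have hφ : ∀ p, φ p = Ω (algebraMap _ _ p) := fun p => rfl
  -- the Jacobian alternative at a prime of the local ring of the zero locus
  have key := fun (P : Ideal O) (hP : P.IsPrime) =>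
    coordTrdeg_comap_add_le_or_of_isPrime φ (fun l => by
      obtain ⟨a, rfl⟩ := hsurj l
      obtain ⟨⟨p, q⟩, h⟩ := IsLocalization.surj M.primeCompl a
      refine ⟨p, q, ?_, ?_⟩
      · exact (IsLocalization.map_units (Localization.AtPrime M) q).map Ω
      · rw [hφ, hφ, ← map_mul, h]) F (fun j => (hker _).2
        (Ideal.mem_map_of_mem _ (Ideal.subset_span ⟨j, rfl⟩))) hbad P
  have hcomap : ∀ P : Ideal O, P.comap φ = (P.comap Ω).comap
    (algebraMap (MvPolynomial (Fin n) k) (Localization.AtPrime M)) := fun P => rfl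
  apply isDomain_and_isIntegrallyClosed_of_serre
  · rintro P ⟨hP, m, hm⟩
    obtain ⟨m, rfl⟩ := hsurj m
    have hass : (P.comap Ω).IsAssociatedTo ((Ideal.span (Set.range F)).map
        (algebraMap (MvPolynomial (Fin n) k) (Localization.AtPrime M))) :=
      ⟨hP.comap _, m, fun a => by rw [Ideal.mem_comap, hm, ← map_mul, Ideal.mem_bot, hker]⟩
    have h1 := le_coordTrdeg_of_isAssociatedTo hr F hF M hFM hass
    rw [← hcomap] at h1
    exact exists_notMem_mul_eq_zero_of_finrank_cotangentSpace P (by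
      rcases key P hP with h | h <;> omega)
  · rintro g hgm hg P ⟨hP, m, hm⟩
    obtain ⟨m, rfl⟩ := hsurj m
    obtain ⟨g, rfl⟩ := hsurj g
    have hass : (P.comap Ω).IsAssociatedTo ((Ideal.span (Set.range F)).map
        (algebraMap (MvPolynomial (Fin n) k) (Localization.AtPrime M)) ⊔ Ideal.span {g}) :=
      ⟨hP.comap _, m, fun a => by
        rw [Ideal.mem_comap, hm, ← map_mul, Ideal.mem_span_singleton',
            Ideal.mem_sup_span_singleton']
        constructor
        · rintro ⟨c, hc⟩
          obtain ⟨c, rfl⟩ := hsurj c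
          exact ⟨c, by rw [← hker, map_sub, ← hc, map_mul, sub_self]⟩
        · rintro ⟨c, hc⟩
          refine ⟨Ω c, ?_⟩
          rw [← hker, map_sub, sub_eq_zero] at hc
          rw [hc, map_mul]⟩
    have hgM : g ∈ IsLocalRing.maximalIdeal (Localization.AtPrime M) := by
      rw [IsLocalRing.mem_maximalIdeal, mem_nonunits_iff] at hgm ⊢
      exact fun h => hgm (h.map _)
    have hreg : ((Ideal.span (Set.range F)).map
        (algebraMap (MvPolynomial (Fin n) k) (Localization.AtPrime M))).IsRegularMod g :=
        fun a ha => by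
      rw [← hker] at ha ⊢
      exact hg _ (by rwa [map_mul] at ha)
    have h1 := le_coordTrdeg_add_one_of_isAssociatedTo hr F hF M hFM hgM hreg hass
    rw [← hcomap] at h1
    exact exists_mem_forall_exists_notMem_mul_eq P (by
      rcases key P hP with h | h <;> omega)

theorem isNormalZeroLocus_of_forall_isMaximal {k : Type} [Field k] {n : ℕ}
    (I : Ideal (MvPolynomial (Fin n) k))
    (h : ∀ (M : Ideal (MvPolynomial (Fin n) k)) [M.IsMaximal], I ≤ M →
      IsDomain (Localization.AtPrime M ⧸ I.map
        (algebraMap (MvPolynomial (Fin n) k) (Localization.AtPrime M))) ∧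
      IsIntegrallyClosed (Localization.AtPrime M ⧸ I.map
        (algebraMap (MvPolynomial (Fin n) k) (Localization.AtPrime M)))) :
    IsNormalZeroLocus I := by
  intro q
  obtain ⟨M, hM, hqM⟩ := Ideal.exists_le_maximal
    (q.asIdeal.comap (Ideal.Quotient.mk I)) (q.2.comap _).ne_top
  have hIM : I ≤ M := fun a ha => hqM (by
    rw [Ideal.mem_comap, Ideal.Quotient.eq_zero_iff_mem.2 ha]; exact q.asIdeal.zero_mem)
  obtain ⟨h1, h2⟩ := h M hIM
  have hle : Algebra.algebraMapSubmonoid (MvPolynomial (Fin n) k ⧸ I) M.primeCompl ≤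
      q.asIdeal.primeCompl := by
    rintro _ ⟨a, ha, rfl⟩ hq
    exact ha (hqM hq)
  exact isDomain_and_isIntegrallyClosed_of_isLocalization_le
    (O := Localization.AtPrime M ⧸ I.map
      (algebraMap (MvPolynomial (Fin n) k) (Localization.AtPrime M)))
    (Algebra.algebraMapSubmonoid (MvPolynomial (Fin n) k ⧸ I) M.primeCompl)
    q.asIdeal hle

theorem isNormalZeroLocus_span_range {k : Type} [Field k] [IsAlgClosed k]
    {n s r : ℕ} (hr : r + s = n) (F : Fin s → MvPolynomial (Fin n) k)
    (hF : ∀ q : Ideal (MvPolynomial (Fin n) k), q.IsPrime → Ideal.span (Set.range F) ≤ q →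
      coordTrdeg q ≤ r)
    (hbad : ∀ (K : Type) [Field K] [Algebra k K] (x : Fin n → K) (c : Fin s → K), c ≠ 0 →
      Matrix.vecMul c (Matrix.of fun j l => aeval x (pderiv l (F j))) = 0 →
      ∀ T : Finset (Fin n), AlgebraicIndependent k (fun i : T => x i) → T.card + 2 ≤ r) :
    IsNormalZeroLocus (Ideal.span (Set.range F)) := by
  refine isNormalZeroLocus_of_forall_isMaximal _ fun M hM hIM => ?_
  have hFM : ∀ i, F i ∈ M := fun i => hIM (Ideal.subset_span ⟨i, rfl⟩)
  let J := ((Ideal.span (Set.range F)).map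
        (algebraMap (MvPolynomial (Fin n) k) (Localization.AtPrime M)))
  have h1 := isDomain_and_isIntegrallyClosed_of_surjective
    (O := Localization.AtPrime M ⧸ J) hr F hF hbad M hFM (Ideal.Quotient.mk J)

  exact h1 Ideal.Quotient.mk_surjective (fun c => rfl) (fun a => Ideal.Quotient.eq_zero_iff_mem)

theorem eval_zero_pderiv_eq_zero {k : Type} [Field k] {n d : ℕ} (hd : 2 ≤ d)
    {f : MvPolynomial (Fin n) k} (hhom : f.IsHomogeneous d) (j : Fin n) :
    eval 0 (pderiv j f) = 0 := by
  have h : (pderiv j f).IsHomogeneous (d - 1) := hhom.pderiv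
  rw [MvPolynomial.eval_zero, MvPolynomial.constantCoeff_eq]
  exact h.coeff_eq_zero (by simp; omega)

theorem vecMul_pderiv_dirDeriv_eq {k K : Type} [Field k] [Field K] [Algebra k K] {n s : ℕ}
    (f : MvPolynomial (Fin n) k) (v : Fin s → Fin n → k) (x : Fin n → K) :
    (Matrix.of fun i l => aeval x (pderiv l (∑ j, v i j • pderiv j f)) :
        Matrix (Fin s) (Fin n) K) =
      Matrix.of (fun i j => algebraMap k K (v i j)) * hessianAt f x := by
  ext i l
  simp only [Matrix.mul_apply, hessianAt, Matrix.of_apply, map_sum, Algebra.smul_def]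
  refine Finset.sum_congr rfl fun j _ => ?_
  simp [pderiv_pderiv_comm]

theorem coordTrdeg_le_of_span_range_le {k : Type} [Field k] [IsAlgClosed k] {n s r : ℕ}
    (hr : r + s = n) (F : Fin s → MvPolynomial (Fin n) k)
    (hbad : ∀ (K : Type) [Field K] [Algebra k K] (x : Fin n → K) (c : Fin s → K), c ≠ 0 →
      Matrix.vecMul c (Matrix.of fun j l => aeval x (pderiv l (F j))) = 0 →
      ∀ T : Finset (Fin n), AlgebraicIndependent k (fun i : T => x i) → T.card ≤ r)
    (q : Ideal (MvPolynomial (Fin n) k)) (hq : q.IsPrime) (hle : Ideal.span (Set.range F) ≤ q) :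
    coordTrdeg q ≤ r := by
  have h := coordTrdeg_comap_add_le_or_of_isPrime (e := 0) (Ideal.Quotient.mkₐ k q)
    (fun l => by
      obtain ⟨p, rfl⟩ := Ideal.Quotient.mk_surjective l
      exact ⟨p, 1, by simp, by simp⟩) F
    (fun j => Ideal.Quotient.eq_zero_iff_mem.2 (hle (Ideal.subset_span ⟨j, rfl⟩))) hbad ⊥
  have hcomap : (⊥ : Ideal (MvPolynomial (Fin n) k ⧸ q)).comap (Ideal.Quotient.mkₐ k q) = q := by
    ext a
    exact Ideal.Quotient.eq_zero_iff_mem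
  rw [hcomap] at h
  omega

theorem affineCodim_span_range_eq {k : Type} [Field k] [IsAlgClosed k] {n s r : ℕ}
    (hr : r + s = n) (F : Fin s → MvPolynomial (Fin n) k) (hF0 : ∀ i, eval 0 (F i) = 0)
    (hF : ∀ q : Ideal (MvPolynomial (Fin n) k), q.IsPrime → Ideal.span (Set.range F) ≤ q →
      coordTrdeg q ≤ r) :
    affineCodim k (Ideal.span (Set.range F)) = s := by
  have hmax : (RingHom.ker (eval (0 : Fin n → k))).IsMaximal :=
    RingHom.ker_isMaximal_of_surjective _ fun a => ⟨C a, eval_C a⟩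
  have h := ringKrullDim_quotient_eq hr F hF (RingHom.ker (eval (0 : Fin n → k))) hF0
  rw [affineCodim, affineDim, h, Fintype.card_fin]
  change ((n : ℕ∞) - (r : ℕ∞)) = s
  rw [← hr]
  norm_cast
  omega

/-- A bound for the transcendence degree of the points where the differentials of the directional
derivatives are dependent yields the required dimension data. -/
theorem exists_add_eq_and_coordTrdeg_le {k : Type} [Field k] [IsAlgClosed k] {n d s : ℕ}
    (hd : 3 ≤ d)
    {f : MvPolynomial (Fin n) k} (hhom : f.IsHomogeneous d) (v : Fin s → Fin n → k)
    (hbad : ∀ (K : Type) [Field K] [Algebra k K] (x : Fin n → K) (c : Fin s → K), c ≠ 0 →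
      Matrix.vecMul c (Matrix.of (fun i j => algebraMap k K (v i j)) * hessianAt f x) = 0 →
      ∀ T : Finset (Fin n), AlgebraicIndependent k (fun i : T => x i) → T.card + s ≤ n) :
    ∃ r, r + s = n ∧ ∀ q : Ideal (MvPolynomial (Fin n) k), q.IsPrime →
      Ideal.span (Set.range fun i => ∑ j, v i j • pderiv j f) ≤ q → coordTrdeg q ≤ r := by
  have hsn : s ≤ n := by
    rcases Nat.eq_zero_or_pos s with rfl | hs
    · exact Nat.zero_le n
    have hH : hessianAt f (0 : Fin n → k) = 0 := by
      ext i j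
      rw [hessianAt, Matrix.of_apply, Matrix.zero_apply]
      exact eval_zero_pderiv_eq_zero (d := d - 1) (by omega) hhom.pderiv i
    have hc : (fun _ => 1 : Fin s → k) ≠ 0 := fun h => one_ne_zero (congrFun h ⟨0, hs⟩)
    have := hbad k 0 (fun _ => 1) hc (by rw [hH, Matrix.mul_zero, Matrix.vecMul_zero]) ∅
      (algebraicIndependent_empty_type_iff.2 (FaithfulSMul.algebraMap_injective k k))
    simpa using this
  refine ⟨n - s, Nat.sub_add_cancel hsn, fun q hq hle => ?_⟩
  refine coordTrdeg_le_of_span_range_le (Nat.sub_add_cancel hsn) _ (fun K _ _ x c hc h T hT => ?_)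
    q hq hle
  rw [vecMul_pderiv_dirDeriv_eq] at h
  have := hbad K x c hc h T hT
  omega

theorem le_of_two_pow_mul_le {d b c R : ℕ} (hd : 3 ≤ d) (h : 2 ^ (d - 3) * c ≤ R)
    (hR : R ≤ (d - 2) * b) : c ≤ b := by
  have h1 : d - 2 ≤ 2 ^ (d - 3) := by
    have := Nat.lt_two_pow_self (n := d - 3)
    omega
  have h2 : 2 ^ (d - 3) * c ≤ 2 ^ (d - 3) * b :=
    h.trans (hR.trans (Nat.mul_le_mul_right _ h1))
  exact Nat.le_of_mul_le_mul_left h2 (by positivity)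

/-- Theorem 1.6(ii). Let `k` be algebraically closed with
`char k ∤ d(d-1)`, `d ≥ 3`, and `f` a nonzero homogeneous polynomial of degree `d` on `V`.
If `s ≤ 2^{2-d}·rk^S(f) + 1/2` (resp. `s ≤ 2^{2-d}·rk^S(f) - 1/2`) — equivalently, after
multiplying through by `2^{d-2}`, if `2^{d-2}·s ≤ rk^S(f) + 2^{d-3}` (resp.
`2^{d-2}·s + 2^{d-3} ≤ rk^S(f)`) — then for generic `(v 1, …, v s) ∈ V^s` (all tuples in a
nonempty Zariski open subset of `V^s`, i.e. where some nonzero polynomial `h` does not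
vanish) the directional derivatives `(∂_{v 1} f, …, ∂_{v s} f)` define a complete
intersection (resp. a normal complete intersection) of codimension `s` in `V`. -/
theorem dirDeriv_complete_intersection_generic {k : Type} [Field k] [IsAlgClosed k]
    {n d : ℕ} (hd : 3 ≤ d) (hchar : ¬ (ringChar k ∣ d * (d - 1)))
    (f : MvPolynomial (Fin n) k) (hf : f ≠ 0) (hhom : f.IsHomogeneous d) (s : ℕ) :
    (2 ^ (d - 2) * s ≤ polySchmidtRank f + 2 ^ (d - 3) →
        ∃ h : MvPolynomial (Fin s × Fin n) k, h ≠ 0 ∧ ∀ v : Fin s → Fin n → k,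
          eval (fun q => v q.1 q.2) h ≠ 0 →
            affineCodim k (Ideal.span (Set.range fun i => ∑ j, v i j • pderiv j f)) =
              (s : ℕ∞)) ∧
      (2 ^ (d - 2) * s + 2 ^ (d - 3) ≤ polySchmidtRank f →
        ∃ h : MvPolynomial (Fin s × Fin n) k, h ≠ 0 ∧ ∀ v : Fin s → Fin n → k,
          eval (fun q => v q.1 q.2) h ≠ 0 →
            affineCodim k (Ideal.span (Set.range fun i => ∑ j, v i j • pderiv j f)) =
                (s : ℕ∞) ∧
              IsNormalZeroLocus (Ideal.span (Set.range fun i => ∑ j, v i j • pderiv j f))) := by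
  have hpow : 2 ^ (d - 2) = 2 ^ (d - 3) * 2 := by
    rw [← pow_succ]; congr 1; omega
  have hF0 : ∀ (v : Fin s → Fin n → k) (i : Fin s),
      eval (0 : Fin n → k) (∑ j, v i j • pderiv j f) = 0 := by
    intro v i
    rw [map_sum]
    refine Finset.sum_eq_zero fun j _ => ?_
    rw [smul_eval, eval_zero_pderiv_eq_zero (by omega) hhom, mul_zero]
  constructor
  · intro hs
    obtain ⟨h, h0, hh⟩ := exists_generic_card_le (s := s) hd hchar hhom (2 * s - 1) fun a ha => by
      refine le_of_two_pow_mul_le hd ?_ ha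
      rw [hpow, mul_assoc] at hs
      rw [Nat.mul_sub]
      omega
    refine ⟨h, h0, fun v hv => ?_⟩
    obtain ⟨r, hr, hF⟩ := exists_add_eq_and_coordTrdeg_le hd hhom v
      fun K _ _ x c hc hcx T hT => by
        have hspos : 0 < s := by
          rcases Nat.eq_zero_or_pos s with rfl | h
          · exact absurd (Subsingleton.elim c 0) hc
          · exact h
        have := hh v hv K x c hc hcx T hT
        omega
    exact affineCodim_span_range_eq hr _ (hF0 v) hF
  · intro hs
    obtain ⟨h, h0, hh⟩ := exists_generic_card_le (s := s) hd hchar hhom (2 * s + 1) fun a ha => by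
      refine le_of_two_pow_mul_le hd ?_ ha
      rw [hpow, mul_assoc] at hs
      rw [Nat.mul_add]
      omega
    refine ⟨h, h0, fun v hv => ?_⟩
    obtain ⟨r, hr, hF⟩ := exists_add_eq_and_coordTrdeg_le hd hhom v
      fun K _ _ x c hc hcx T hT => by
        have := hh v hv K x c hc hcx T hT
        omega
    refine ⟨affineCodim_span_range_eq hr _ (hF0 v) hF, isNormalZeroLocus_span_range hr _ hF ?_⟩
    intro K _ _ x c hc hcx T hT
    rw [vecMul_pderiv_dirDeriv_eq] at hcx
    have := hh v hv K x c hc hcx T hT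
    omega
end

section
/- Let k be a field, V a finite-dimensional k-vector space, f a nonzero homogeneous polynomial of degree d on V, and s an integer with 1 ≤ s < dim V. Then there is a nonempty Zariski open subset of V^s such that for every (v_1,…,v_s) in it, c'(∂_{v_1}f,…,∂_{v_s}f) ≥ g_sym(f) − s + 1. -/
open MvPolynomial

/-- The ideal of `Z^sym_f ⊆ V × V`: in the coordinates `(v, x)` (with `v` the `Sum.inl`
variables and `x` the `Sum.inr` variables) it is generated, for `i : Fin n`, by
`∑ j, v j * (∂_i ∂_j f)(x)`, i.e. its zero locus is `{(v, x) | v ∈ ker H_f(x)}` where `H_f`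
is the Hessian form of `f`. -/
noncomputable def zSymIdeal {k : Type} [Field k] {n : ℕ} (f : MvPolynomial (Fin n) k) :
    Ideal (MvPolynomial (Fin n ⊕ Fin n) k) :=
  Ideal.span (Set.range fun i : Fin n =>
    ∑ j : Fin n, X (Sum.inl j) * rename Sum.inr (pderiv i (pderiv j f)))

/-- The ideal of the locus `S(f̄)` where the Jacobian matrix of `(f 1, …, f s)` has rank
`< s`: it is generated by all `s × s` minors of the Jacobian matrix. -/
noncomputable def jacIdeal {k : Type} [Field k] {n s : ℕ}
    (f : Fin s → MvPolynomial (Fin n) k) : Ideal (MvPolynomial (Fin n) k) :=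
  Ideal.span (Set.range fun c : Fin s → Fin n =>
    Matrix.det (Matrix.of fun i j : Fin s => pderiv (c j) (f i)))

section KrullDimension

/-- An injective integral extension does not lower the Krull dimension. -/
lemma ringKrullDim_le_of_isIntegral_of_injective {R S : Type*} [CommRing R] [CommRing S]
    [Algebra R S] [Algebra.IsIntegral R S] (hinj : Function.Injective (algebraMap R S)) :
    ringKrullDim R ≤ ringKrullDim S := by
  refine iSup_le fun l => ?_
  obtain ⟨Q, -, hQ, hQl⟩ := Ideal.exists_ideal_over_prime_of_isIntegral
    (S := S) l.head.asIdeal ⊥ (by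
      rw [← RingHom.ker_eq_comap_bot, (RingHom.injective_iff_ker_eq_bot _).1 hinj]
      exact bot_le)
  have : Q.LiesOver l.head.asIdeal := ⟨hQl.symm⟩
  obtain ⟨L, hL, -⟩ := Ideal.exists_ltSeries_of_hasGoingUp l Q
  rw [← hL]
  exact Order.LTSeries.length_le_krullDim L

/-- An integral extension does not raise the Krull dimension. -/
lemma ringKrullDim_le_of_isIntegral {R S : Type*} [CommRing R] [CommRing S]
    [Algebra R S] [Algebra.IsIntegral R S] : ringKrullDim S ≤ ringKrullDim R :=
  Order.krullDim_le_of_strictMono (PrimeSpectrum.comap (algebraMap R S))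
    fun _ _ h => Ideal.IsIntegral.comap_lt_comap h

/-- The Krull dimension of an affine domain is its transcendence degree. -/
lemma exists_trdeg_eq_ringKrullDim_eq (k A : Type) [Field k] [CommRing A] [IsDomain A]
    [Algebra k A] [Algebra.FiniteType k A] :
    ∃ q : ℕ, Algebra.trdeg k A = q ∧ ringKrullDim A = q := by
  obtain ⟨q, g, hg, hint⟩ := exists_integral_inj_algHom_of_fg k A
  refine ⟨q, ?_, ?_⟩
  · algebraize [g.toRingHom]
    have : Algebra.IsIntegral (MvPolynomial (Fin q) k) A := ⟨hint⟩
    have : FaithfulSMul (MvPolynomial (Fin q) k) A :=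
      (faithfulSMul_iff_algebraMap_injective _ _).2 hg
    have : IsScalarTower k (MvPolynomial (Fin q) k) A := .of_algebraMap_eq fun r =>
      (g.commutes r).symm
    have h := trdeg_add_eq k (MvPolynomial (Fin q) k) (A := A)
    rw [← h, trdeg_eq_zero (R := MvPolynomial (Fin q) k) (A := A)]
    simp
  · algebraize [g.toRingHom]
    have : Algebra.IsIntegral (MvPolynomial (Fin q) k) A := ⟨hint⟩
    have hq : ringKrullDim (MvPolynomial (Fin q) k) = q := by simp
    rw [← hq]
    exact le_antisymm ringKrullDim_le_of_isIntegral
      (ringKrullDim_le_of_isIntegral_of_injective hg)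

end KrullDimension

section Elimination

/-- If every coordinate subspace of dimension `m` carries a nonzero polynomial of the ideal `J`,
then the closed subscheme cut out by `J` has dimension less than `m`. -/
lemma ringKrullDim_quotient_lt_of_forall_rename_mem {k σ : Type} [Field k] [Fintype σ]
    (J : Ideal (MvPolynomial σ k)) (m : ℕ)
    (h : ∀ T : Finset σ, T.card = m → ∃ g : MvPolynomial T k, g ≠ 0 ∧ rename (↑) g ∈ J) :
    ringKrullDim (MvPolynomial σ k ⧸ J) < m := by
  classical
  rw [ringKrullDim_quotient, Order.krullDim_lt_coe_iff]
  intro l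
  by_contra! hl
  let P : Ideal (MvPolynomial σ k) := l.head.1.asIdeal
  have hJP : J ≤ P := l.head.2
  have hdim : (m : WithBot ℕ∞) ≤ ringKrullDim (MvPolynomial σ k ⧸ P) := by
    rw [ringKrullDim_quotient]
    let L : LTSeries (PrimeSpectrum.zeroLocus (P : Set (MvPolynomial σ k))) :=
      { length := l.length
        toFun := fun i => ⟨(l i).1, (show l.head ≤ l i from l.head_le i)⟩
        step := fun i => l.step i }
    exact le_trans (by exact_mod_cast hl) (Order.LTSeries.length_le_krullDim L)
  obtain ⟨q, hq, hqdim⟩ := exists_trdeg_eq_ringKrullDim_eq k (MvPolynomial σ k ⧸ P)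
  rw [hqdim] at hdim
  have hmq : m ≤ q := by exact_mod_cast hdim
  let y : σ → MvPolynomial σ k ⧸ P := fun i => Ideal.Quotient.mkₐ k P (X i)
  have hy : Algebra.adjoin k (Set.range y) = ⊤ := by
    rw [show Set.range y = Ideal.Quotient.mkₐ k P '' Set.range X by rw [← Set.range_comp]; rfl,
      Algebra.adjoin_image, adjoin_range_X, Algebra.map_top, AlgHom.range_eq_top]
    exact Ideal.Quotient.mkₐ_surjective k P
  have : Algebra.IsAlgebraic (Algebra.adjoin k (Set.range y)) (MvPolynomial σ k ⧸ P) := by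
    rw [hy]
    exact ⟨fun a => isAlgebraic_algebraMap (⟨a, trivial⟩ : (⊤ : Subalgebra k _))⟩
  obtain ⟨t, hts, ht⟩ := exists_isTranscendenceBasis_subset (R := k) (Set.range y)
  have htq : Cardinal.mk t = q := by rw [ht.cardinalMk_eq_trdeg, hq]
  obtain ⟨u, hu⟩ := Set.subset_range_iff_exists_image_eq.1 hts
  obtain ⟨w, hwu, hw⟩ := Set.SurjOn.exists_bijOn_subset (f := y) (s := u) (t := t) hu.ge
  have hwq : w.ncard = q := by
    rw [← hw.image_eq, Cardinal.mk_image_eq_of_injOn _ _ hw.injOn] at htq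
    rw [Set.ncard_def, Set.encard, ENat.card, htq]
    simp
  have hind : AlgebraicIndependent k (fun i : w => y i) :=
    ht.1.comp (fun i : w => (⟨y i, hw.mapsTo i.2⟩ : t)) fun i j hij =>
      Subtype.ext (hw.injOn i.2 j.2 (congrArg Subtype.val hij))
  obtain ⟨T, hTw, hT⟩ := Finset.exists_subset_card_eq (s := w.toFinset) (n := m)
    (by rwa [← Set.ncard_eq_toFinset_card', hwq])
  obtain ⟨g, hg0, hg⟩ := h T hT
  refine hg0 ((AlgebraicIndependent.comp hind
    (fun i : T => (⟨i, Set.mem_toFinset.1 (hTw i.2)⟩ : w)) fun i j hij =>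
      Subtype.ext (congrArg (fun z : w => (z : σ)) hij)).eq_zero_of_aeval_eq_zero g ?_)
  have h1 : Ideal.Quotient.mkₐ k P (rename (↑) g) = 0 := Ideal.Quotient.eq_zero_iff_mem.2 (hJP hg)
  rw [← h1, ← AlgHom.comp_apply]
  refine DFunLike.congr_fun (algHom_ext fun i => ?_) g
  simp [y]

/-- The transcendence rank of a point of an affine scheme is at most the dimension. -/
lemma eRk_range_le_ringKrullDim_quotient {k σ M : Type} [Field k] [Fintype σ] [Field M]
    [Algebra k M] (I : Ideal (MvPolynomial σ k)) (y : σ → M)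
    (hI : ∀ p ∈ I, aeval y p = 0) (d : ℕ) (hd : ringKrullDim (MvPolynomial σ k ⧸ I) ≤ d) :
    (AlgebraicIndependent.matroid k M).eRk (Set.range y) ≤ d := by
  rw [Matroid.eRk_le_iff]
  intro s hs hind
  rw [AlgebraicIndependent.matroid_indep_iff] at hind
  let B := (aeval (R := k) y).range
  have hB : ringKrullDim B ≤ d := by
    refine le_trans (ringKrullDim_le_of_surjective
      (Ideal.Quotient.lift I (aeval (R := k) y).rangeRestrict.toRingHom fun p hp =>
        Subtype.ext (hI p hp)) ?_) hd
    exact Ideal.Quotient.lift_surjective_of_surjective _ _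
      (aeval (R := k) y).rangeRestrict_surjective
  have : Algebra.FiniteType k B :=
    .of_surjective (aeval (R := k) y).rangeRestrict (aeval (R := k) y).rangeRestrict_surjective
  obtain ⟨q, hq, hqdim⟩ := exists_trdeg_eq_ringKrullDim_eq k B
  have hsB : ∀ a : s, (a : M) ∈ B := fun a => by
    obtain ⟨i, hi⟩ := hs a.2
    exact ⟨X i, by simpa using hi⟩
  have hind' : AlgebraicIndependent k (fun a : s => (⟨a, hsB a⟩ : B)) :=
    (AlgHom.algebraicIndependent_iff B.val Subtype.val_injective).1 hind
  have hc := hind'.cardinalMk_le_trdeg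
  rw [hq] at hc
  rw [hqdim] at hB
  have hqd : q ≤ d := by exact_mod_cast hB
  rw [Set.encard, ENat.card]
  refine le_trans (Cardinal.toENat_le_natCast.2 hc) (by exact_mod_cast hqd)

end Elimination

section LinearAlgebra

/-- A matrix over a field whose maximal minors all vanish has linearly dependent rows. -/
lemma exists_sum_mul_eq_zero_of_forall_det_eq_zero {K : Type*} [Field K] {s n : ℕ}
    (A : Matrix (Fin s) (Fin n) K)
    (h : ∀ c : Fin s → Fin n, Matrix.det (Matrix.of fun i j => A i (c j)) = 0) :
    ∃ (v : Fin s → K) (i : Fin s), v i ≠ 0 ∧ ∀ l, ∑ i, v i * A i l = 0 := by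
  by_contra! hA
  have hrow : LinearIndependent K A.row := by
    rw [Fintype.linearIndependent_iff]
    intro v hv i
    by_contra hi
    obtain ⟨l, hl⟩ := hA v i hi
    exact hl (by simpa [Matrix.row] using congrFun hv l)
  have hfin : Module.finrank K (Submodule.span K (Set.range A.col)) = s := by
    rw [← Matrix.rank_eq_finrank_span_cols, hrow.rank_matrix, Fintype.card_fin]
  obtain ⟨g, hg, -, hgi⟩ := Submodule.exists_fun_fin_finrank_span_eq K (Set.range A.col)
  choose c hc using hg
  have hcol : LinearIndependent K
      (Matrix.of fun i j => A i (c (finCongr hfin.symm j)) : Matrix (Fin s) (Fin s) K).col := by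
    have hcg : (Matrix.of fun i j => A i (c (finCongr hfin.symm j)) :
        Matrix (Fin s) (Fin s) K).col = g ∘ finCongr hfin.symm := funext fun j => hc _
    rw [hcg]
    exact hgi.comp _ (finCongr hfin.symm).injective
  rw [Matrix.linearIndependent_cols_iff_isUnit, Matrix.isUnit_iff_isUnit_det] at hcol
  exact hcol.ne_zero (h _)

end LinearAlgebra

/-- A nonzero polynomial in two groups of variables stays nonzero under generic specialization of
the second group. -/
lemma exists_forall_eval_ne_zero_aeval_sumElim_ne_zero {k α β : Type} [Field k]
    (g : MvPolynomial (β ⊕ α) k) (hg : g ≠ 0) :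
    ∃ h : MvPolynomial α k, h ≠ 0 ∧ ∀ v : α → k, eval v h ≠ 0 →
      aeval (Sum.elim X fun a => C (v a) : β ⊕ α → MvPolynomial β k) g ≠ 0 := by
  have hg' : sumAlgEquiv k β α g ≠ 0 := by simpa using hg
  obtain ⟨m, hm⟩ := ne_zero_iff.1 hg'
  refine ⟨_, hm, fun v hv h0 => hv ?_⟩
  have : aeval (Sum.elim X fun a => C (v a) : β ⊕ α → MvPolynomial β k) g =
      map (eval v) (sumAlgEquiv k β α g) := by
    rw [← coe_aeval_eq_eval]
    refine DFunLike.congr_fun (f := aeval _) (g := (mapAlgHom (aeval v)).comp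
      (sumAlgEquiv k β α).toAlgHom) (algHom_ext fun i => ?_) g
    rcases i with i | i <;> simp
  rw [← coeff_map, ← this, h0, coeff_zero]

/-- The ideal of maximal minors of the product of the Hessian of `f`, in the variables
`Sum.inl`, with a generic `s × n` matrix of variables `Sum.inr`. -/
noncomputable def genericJacIdeal {k : Type} [Field k] {n : ℕ} (s : ℕ)
    (f : MvPolynomial (Fin n) k) : Ideal (MvPolynomial (Fin n ⊕ Fin s × Fin n) k) :=
  Ideal.span (Set.range fun c : Fin s → Fin n =>
    Matrix.det (Matrix.of fun i j : Fin s =>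
      ∑ l, X (Sum.inr (i, l)) * rename Sum.inl (pderiv (c j) (pderiv l f))))

lemma zSymIdeal_ne_top {k : Type} [Field k] {n : ℕ} (f : MvPolynomial (Fin n) k) :
    zSymIdeal f ≠ ⊤ := by
  refine ne_top_of_le_ne_top (RingHom.ker_ne_top
    (aeval (fun _ => 0 : Fin n ⊕ Fin n → k) : MvPolynomial (Fin n ⊕ Fin n) k →ₐ[k] k)) ?_
  rw [zSymIdeal, Ideal.span_le]
  rintro _ ⟨i, rfl⟩
  simp [RingHom.mem_ker]

lemma aeval_eq_zero_of_mem_zSymIdeal {k M : Type} [Field k] [CommRing M] [Algebra k M] {n : ℕ}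
    {f : MvPolynomial (Fin n) k} {w x : Fin n → M}
    (h : ∀ l, ∑ j, w j * aeval x (pderiv l (pderiv j f)) = 0)
    {p : MvPolynomial (Fin n ⊕ Fin n) k} (hp : p ∈ zSymIdeal f) :
    aeval (Sum.elim w x) p = 0 := by
  suffices zSymIdeal f ≤ RingHom.ker (aeval (R := k) (Sum.elim w x)) from this hp
  rw [zSymIdeal, Ideal.span_le]
  rintro _ ⟨l, rfl⟩
  simpa [RingHom.mem_ker, aeval_rename, Function.comp_def] using h l

/-- The transcendence degree count behind the generic dimension bound: a kernel vector `c` of the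
matrix `a` times the Hessian of `f` at `x` gives the point `(c a, x)` of `Z^sym_f`, and `a` can be
recovered from it together with `c` and all but one row of `a`. -/
lemma card_add_le_of_algebraicIndependent {k M : Type} [Field k] [Field M] [Algebra k M]
    {n s d : ℕ} {f : MvPolynomial (Fin n) k}
    (hd : ringKrullDim (MvPolynomial (Fin n ⊕ Fin n) k ⧸ zSymIdeal f) ≤ d)
    {T : Finset (Fin n)} {x : Fin n → M} {a : Fin s × Fin n → M} {c : Fin s → M} {i₀ : Fin s}
    (hc : c i₀ ≠ 0)
    (h : ∀ l, ∑ i, c i * ∑ j, a (i, j) * aeval x (pderiv l (pderiv j f)) = 0)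
    (hind : AlgebraicIndependent k (Sum.elim (fun _ : Unit => c i₀)
      (Sum.elim (fun i : T => x i) a))) :
    T.card + n + 1 ≤ d + s := by
  classical
  let w : Fin n → M := fun j => ∑ i, c i * a (i, j)
  have hw : ∀ l, ∑ j, w j * aeval x (pderiv l (pderiv j f)) = 0 := fun l => by
    rw [← h l]
    simp only [w, Finset.sum_mul, Finset.mul_sum]
    rw [Finset.sum_comm]
    simp only [mul_assoc]
  let N := AlgebraicIndependent.matroid k M
  let Y : Set M := Set.range (Sum.elim w x)
  let Z : Set M := Set.range (Sum.elim c fun q : {i // i ≠ i₀} × Fin n => a (q.1, q.2))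
  have hY : N.eRk Y ≤ d := eRk_range_le_ringKrullDim_quotient (zSymIdeal f) _
    (fun p hp => aeval_eq_zero_of_mem_zSymIdeal hw hp) d hd
  have hZ : Z.encard ≤ (s + (s - 1) * n : ℕ) := by
    dsimp only [Z]
    rw [← Set.image_univ]
    refine (Set.encard_image_le _ _).trans_eq ?_
    rw [Set.encard_univ, ENat.card_eq_coe_fintype_card]
    simp [Fintype.card_subtype_compl]
  have hYZ : N.eRk (N.closure (Y ∪ Z)) ≤ (d + (s + (s - 1) * n) : ℕ) := by
    rw [Matroid.eRk_closure_eq, Nat.cast_add]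
    exact (N.eRk_union_le_eRk_add_encard Y Z).trans (add_le_add hY hZ)
  let S := Subalgebra.algebraicClosure (Algebra.adjoin k (Y ∪ Z)) M
  have hS : N.closure (Y ∪ Z) = (S : Set M) := AlgebraicIndependent.matroid_closure_eq
  have hsub : Y ∪ Z ⊆ (S : Set M) := hS ▸ N.subset_closure _ (Set.subset_univ _)
  have hinv : ∀ y ∈ S, y⁻¹ ∈ S := fun y hy => IsAlgebraic.inv hy
  have hcS : ∀ i, c i ∈ S := fun i => hsub (.inr ⟨.inl i, rfl⟩)
  have hwS : ∀ j, w j ∈ S := fun j => hsub (.inl ⟨.inl j, rfl⟩)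
  have hxS : ∀ j, x j ∈ S := fun j => hsub (.inl ⟨.inr j, rfl⟩)
  have haS' : ∀ i ≠ i₀, ∀ j, a (i, j) ∈ S := fun i hi j => hsub (.inr ⟨.inr (⟨i, hi⟩, j), rfl⟩)
  have haS : ∀ i j, a (i, j) ∈ S := fun i j => by
    by_cases hi : i = i₀
    · subst hi
      have : a (i, j) = (c i)⁻¹ * (w j - ∑ i' ∈ Finset.univ.erase i, c i' * a (i', j)) := by
        simp only [w]
        rw [← Finset.add_sum_erase _ _ (Finset.mem_univ i), add_sub_cancel_right,
          inv_mul_cancel_left₀ hc]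
      rw [this]
      exact mul_mem (hinv _ (hcS i)) (sub_mem (hwS j) (sum_mem fun i' hi' =>
        mul_mem (hcS i') (haS' i' (Finset.ne_of_mem_erase hi') j)))
    · exact haS' i hi j
  have hI : N.Indep (Set.range (Sum.elim (fun _ : Unit => c i₀)
      (Sum.elim (fun i : T => x i) a))) :=
    AlgebraicIndependent.matroid_indep_iff.2 hind.to_subtype_range
  have hle := (hI.encard_le_eRk_of_subset (X := N.closure (Y ∪ Z)) (by
    rw [hS]
    rintro _ ⟨_ | i | ⟨i, j⟩, rfl⟩
    exacts [hcS i₀, hxS i, haS i j])).trans hYZ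
  rw [← Set.image_univ, hind.injective.encard_image, Set.encard_univ, ENat.card_eq_coe_fintype_card,
    Nat.cast_le] at hle
  simp only [Fintype.card_sum, Fintype.card_unit, Fintype.card_coe, Fintype.card_prod,
    Fintype.card_fin] at hle
  obtain ⟨s, rfl⟩ : ∃ s', s = s' + 1 := ⟨s - 1, by have := i₀.pos; omega⟩
  simp only [Nat.add_sub_cancel, add_mul] at hle
  omega

/-- The dimension bound for a point `(x, a)` with values in a domain at which all maximal minors of
`a` times the Hessian of `f` vanish. -/
lemma card_add_le_of_forall_det_eq_zero {k D : Type} [Field k] [CommRing D] [IsDomain D]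
    [Algebra k D] {n s d : ℕ} {f : MvPolynomial (Fin n) k}
    (hd : ringKrullDim (MvPolynomial (Fin n ⊕ Fin n) k ⧸ zSymIdeal f) ≤ d)
    {T : Finset (Fin n)} {x : Fin n → D} {a : Fin s × Fin n → D}
    (hdet : ∀ c : Fin s → Fin n, Matrix.det (Matrix.of fun i j =>
      ∑ l, a (i, l) * aeval x (pderiv (c j) (pderiv l f))) = 0)
    (hind : AlgebraicIndependent k (Sum.elim (fun i : T => x i) a)) :
    T.card + n + 1 ≤ d + s := by
  let M := FractionRing (Polynomial D)
  let ι : D →ₐ[k] M := IsScalarTower.toAlgHom k D M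
  have hDM : Function.Injective (algebraMap (Polynomial D) M) := IsFractionRing.injective _ _
  have hι : Function.Injective (algebraMap D M) := by
    rw [IsScalarTower.algebraMap_eq D (Polynomial D) M]
    exact hDM.comp Polynomial.C_injective
  have : FaithfulSMul D M := (faithfulSMul_iff_algebraMap_injective _ _).2 hι
  let t : M := algebraMap (Polynomial D) M Polynomial.X
  have ht : Transcendental D t :=
    (transcendental_algebraMap_iff (R := D) hDM).2 (Polynomial.transcendental_X D)
  have hx : ∀ p, aeval (ι ∘ x) p = ι (aeval x p) := fun p => by
    rw [← AlgHom.comp_apply, comp_aeval]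
    rfl
  have hdet' : ∀ c : Fin s → Fin n, Matrix.det (Matrix.of fun i j =>
      (Matrix.of fun i l => ∑ j, ι (a (i, j)) * aeval (ι ∘ x) (pderiv l (pderiv j f)) :
        Matrix (Fin s) (Fin n) M) i (c j)) = 0 := fun c => by
    rw [← map_zero ι, ← hdet c, AlgHom.map_det]
    refine congrArg Matrix.det (Matrix.ext fun i j => ?_)
    simp [hx]
  obtain ⟨c, i₀, hc, h⟩ := exists_sum_mul_eq_zero_of_forall_det_eq_zero _ hdet'
  have hind' := hind.sumElim_comp (A := M) (y := fun _ : Unit => t)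
    (algebraicIndependent_unique_type_iff.2 ht)
  have hc' : t / c i₀ * c i₀ = t := div_mul_cancel₀ _ hc
  refine card_add_le_of_algebraicIndependent (c := fun i => t / c i₀ * c i) (i₀ := i₀)
    (x := ι ∘ x) (a := ι ∘ a) (T := T) hd (by
      rw [hc']
      exact fun h0 => ht (h0 ▸ isAlgebraic_zero)) (fun l => ?_) ?_
  · simp only [mul_assoc, ← Finset.mul_sum]
    exact mul_eq_zero_of_right _ (h l)
  · rw [hc']
    rw [Sum.comp_elim] at hind'
    exact hind'

/-- The generic Jacobian ideal meets every coordinate subring in sufficiently many of the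
variables of `f`. -/
lemma exists_rename_mem_genericJacIdeal {k : Type} [Field k] {n s d : ℕ}
    {f : MvPolynomial (Fin n) k}
    (hd : ringKrullDim (MvPolynomial (Fin n ⊕ Fin n) k ⧸ zSymIdeal f) ≤ d)
    {T : Finset (Fin n)} (hT : d + s ≤ T.card + n) :
    ∃ g : MvPolynomial (T ⊕ Fin s × Fin n) k, g ≠ 0 ∧
      rename (Sum.map (↑) id) g ∈ genericJacIdeal s f := by
  by_contra! hg
  let U := (nonZeroDivisors (MvPolynomial (T ⊕ Fin s × Fin n) k)).map
    (rename (R := k) (Sum.map (fun i : T => (i : Fin n)) (id : Fin s × Fin n → _)))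
  obtain ⟨P, hP, hJP, hPU⟩ := Ideal.exists_le_prime_disjoint (genericJacIdeal s f) U (by
    rw [Set.disjoint_left]
    rintro _ hp ⟨g, hg0, rfl⟩
    exact hg g (nonZeroDivisors.ne_zero hg0) hp)
  let π := Ideal.Quotient.mkₐ k P
  have hx : ∀ p, aeval (fun i => π (X (Sum.inl i))) p = π (rename Sum.inl p) := fun p =>
    DFunLike.congr_fun (f := aeval _) (g := π.comp (rename Sum.inl))
      (algHom_ext fun i => by simp) p
  have := card_add_le_of_forall_det_eq_zero (s := s) (T := T)
    (x := fun i => π (X (Sum.inl i))) (a := fun q => π (X (Sum.inr q))) hd (fun c => ?_) ?_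
  · omega
  · rw [← (Ideal.Quotient.eq_zero_iff_mem (I := P)).2 (hJP (Ideal.subset_span ⟨c, rfl⟩))]
    change _ = π _
    rw [AlgHom.map_det]
    refine congrArg Matrix.det (Matrix.ext fun i j => ?_)
    simp [hx]
  · rw [algebraicIndependent_iff]
    intro g hg0
    by_contra hne
    refine Set.disjoint_left.1 hPU ?_ ⟨g, mem_nonZeroDivisors_of_ne_zero hne, rfl⟩
    refine (Ideal.Quotient.eq_zero_iff_mem (I := P)).1 ?_
    rw [← hg0]
    refine DFunLike.congr_fun (f := π.comp (rename _)) (algHom_ext fun i => ?_) g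
    rcases i with i | i <;> simp

/-- Specializing the generic matrix to `v` maps the generic Jacobian ideal into the Jacobian ideal
of the derivatives of `f` along `v`. -/
lemma aeval_mem_jacIdeal {k : Type} [Field k] {n s : ℕ} {f : MvPolynomial (Fin n) k}
    (v : Fin s → Fin n → k) {p : MvPolynomial (Fin n ⊕ Fin s × Fin n) k}
    (hp : p ∈ genericJacIdeal s f) :
    aeval (Sum.elim X fun q => C (v q.1 q.2) :
      Fin n ⊕ Fin s × Fin n → MvPolynomial (Fin n) k) p ∈
      jacIdeal fun i => ∑ j, v i j • pderiv j f := by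
  suffices genericJacIdeal s f ≤ (jacIdeal fun i => ∑ j, v i j • pderiv j f).comap
    (aeval (R := k) (Sum.elim X fun q => C (v q.1 q.2) :
      Fin n ⊕ Fin s × Fin n → MvPolynomial (Fin n) k)) from this hp
  rw [genericJacIdeal, Ideal.span_le]
  rintro _ ⟨c, rfl⟩
  refine Ideal.subset_span ⟨c, ?_⟩
  rw [AlgHom.map_det]
  refine congrArg Matrix.det (Matrix.ext fun i j => ?_)
  have h : ∀ q : MvPolynomial (Fin n) k, aeval (Sum.elim X fun q => C (v q.1 q.2) :
      Fin n ⊕ Fin s × Fin n → MvPolynomial (Fin n) k) (rename Sum.inl q) = q := fun q => by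
    rw [aeval_rename, Sum.elim_comp_inl, aeval_X_left_apply]
  simp [-algHom_C, -aeval_eq_bind₁, h, smul_eq_C_mul]

/-- For generic `v`, the degeneracy locus of the derivatives along `v` has small dimension. -/
lemma exists_forall_ringKrullDim_jacIdeal_lt {k : Type} [Field k] {n s d m : ℕ}
    {f : MvPolynomial (Fin n) k}
    (hd : ringKrullDim (MvPolynomial (Fin n ⊕ Fin n) k ⧸ zSymIdeal f) ≤ d)
    (hm : d + s ≤ m + n) :
    ∃ h : MvPolynomial (Fin s × Fin n) k, h ≠ 0 ∧ ∀ v : Fin s → Fin n → k,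
      eval (fun q => v q.1 q.2) h ≠ 0 →
        ringKrullDim (MvPolynomial (Fin n) k ⧸ jacIdeal fun i => ∑ j, v i j • pderiv j f) < m := by
  have hT : ∀ T : {T : Finset (Fin n) // T.card = m},
      ∃ g : MvPolynomial (T.1 ⊕ Fin s × Fin n) k, g ≠ 0 ∧
        rename (Sum.map (↑) id) g ∈ genericJacIdeal s f := fun T =>
    exists_rename_mem_genericJacIdeal hd (by rw [T.2]; exact hm)
  choose g hg0 hg using hT
  choose h hh0 hh using fun T => exists_forall_eval_ne_zero_aeval_sumElim_ne_zero (g T) (hg0 T)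
  refine ⟨∏ T, h T, Finset.prod_ne_zero_iff.2 fun T _ => hh0 T, fun v hv => ?_⟩
  rw [map_prod, Finset.prod_ne_zero_iff] at hv
  refine ringKrullDim_quotient_lt_of_forall_rename_mem _ m fun T hTm =>
    ⟨_, hh ⟨T, hTm⟩ _ (hv ⟨T, hTm⟩ (Finset.mem_univ _)), ?_⟩
  convert aeval_mem_jacIdeal v (hg ⟨T, hTm⟩) using 1
  rw [← AlgHom.comp_apply, ← AlgHom.comp_apply]
  refine DFunLike.congr_fun (algHom_ext fun i => ?_) _
  rcases i with i | i <;> simp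

/-- Lemma 3.5. Let `f` be a nonzero homogeneous polynomial of degree `d`
on `V`, and `1 ≤ s < dim V`.  Then for generic `(v 1, …, v s) ∈ V^s` (all tuples in a
nonempty Zariski open subset of `V^s`, i.e. where some nonzero polynomial `h` does not
vanish) one has `c'(∂_{v 1} f, …, ∂_{v s} f) ≥ g_sym(f) - s + 1` (written additively as
`g_sym(f) + 1 ≤ c' + s`), where `∂_v f = ∑ j, v j • ∂_j f`. -/
theorem c'_dirDeriv_ge_gsym_generic {k : Type} [Field k] {n d s : ℕ}
    (hs : 1 ≤ s) (hsn : s < n)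
    (f : MvPolynomial (Fin n) k) (hf : f ≠ 0) (hhom : f.IsHomogeneous d) :
    ∃ h : MvPolynomial (Fin s × Fin n) k, h ≠ 0 ∧ ∀ v : Fin s → Fin n → k,
      eval (fun q => v q.1 q.2) h ≠ 0 →
        affineCodim k (zSymIdeal f) + 1 ≤
          affineCodim k (jacIdeal fun i => ∑ j, v i j • pderiv j f) + (s : ℕ∞) := by
  have hle : ∀ (σ : Type) [Fintype σ] (I : Ideal (MvPolynomial σ k)),
      ringKrullDim (MvPolynomial σ k ⧸ I) ≤ Fintype.card σ := fun σ _ I =>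
    (ringKrullDim_quotient_le I).trans (by simp)
  have := Ideal.Quotient.nontrivial_iff.2 (zSymIdeal_ne_top f)
  obtain ⟨d, hd⟩ : ∃ d : ℕ,
      ringKrullDim (MvPolynomial (Fin n ⊕ Fin n) k ⧸ zSymIdeal f) = d := by
    have h0 := ringKrullDim_nonneg_of_nontrivial
      (R := MvPolynomial (Fin n ⊕ Fin n) k ⧸ zSymIdeal f)
    have h1 := hle _ (zSymIdeal f)
    generalize ringKrullDim (MvPolynomial (Fin n ⊕ Fin n) k ⧸ zSymIdeal f) = D at h0 h1
    induction D with
    | bot => simp at h0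
    | coe D =>
      have h2 : D ≤ (Fintype.card (Fin n ⊕ Fin n) : ℕ) := by exact_mod_cast h1
      lift D to ℕ using ne_top_of_le_ne_top (ENat.natCast_ne_top _) h2
      exact ⟨D, rfl⟩
  have hd2 : d ≤ n + n := by
    have h1 := hle _ (zSymIdeal f)
    rw [hd] at h1
    simpa using (by exact_mod_cast h1 : d ≤ Fintype.card (Fin n ⊕ Fin n))
  obtain ⟨h, hh0, hh⟩ := exists_forall_ringKrullDim_jacIdeal_lt (s := s) (m := d + s - n)
    hd.le (by omega)
  refine ⟨h, hh0, fun v hv => ?_⟩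
  have hlt := hh v hv
  have hle' := hle _ (jacIdeal fun i => ∑ j, v i j • pderiv j f)
  simp only [affineCodim, affineDim, hd]
  generalize ringKrullDim (MvPolynomial (Fin n) k ⧸ jacIdeal fun i => ∑ j, v i j • pderiv j f) = e
    at hlt hle'
  induction e with
  | bot => simp
  | coe e =>
    have h2 : e ≤ (Fintype.card (Fin n) : ℕ) := by exact_mod_cast hle'
    lift e to ℕ using ne_top_of_le_ne_top (ENat.natCast_ne_top _) h2
    have h3 : e < d + s - n := Nat.cast_lt.1 (WithBot.coe_lt_coe.1 hlt)
    change ((Fintype.card (Fin n ⊕ Fin n) : ℕ) : ℕ∞) - (d : ℕ∞) + 1 ≤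
      ((Fintype.card (Fin n) : ℕ) : ℕ∞) - (e : ℕ∞) + s
    simp only [Fintype.card_sum, Fintype.card_fin] at h2 ⊢
    norm_cast at h2 ⊢
    omega
end
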